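/- Let d ≥ 2 and let P1 and P2 be d-polytopes in E^d with n1 ≥ d+1 and n2 ≥ d+1 vertices, respectively. Then, for every k with 1 ≤ k ≤ d, the number of (k−1)-faces of the Minkowski sum satisfies f_{k−1}(P1⊕P2) ≤ f_k(C_{d+1}(n1+n2)) − Σ_{i=0}^{⌊(d+1)/2⌋} binom(d+1−i, k+1−i)·( binom(n1−d−2+i, i) + binom(n2−d−2+i, i) ). -/

import Mathlib

open Set Pointwise

noncomputable section

/-- Euclidean `d`-space `E^d`, modeled as `Fin d → ℝ`. -/
abbrev Euc (d : ℕ) : Type := Fin d → ℝ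

/-- The (affine) dimension of a subset of Euclidean space: the dimension of its affine hull. -/
def setDim {d : ℕ} (F : Set (Euc d)) : ℕ :=
  Module.finrank ℝ (affineSpan ℝ F).direction

/-- A (convex) polytope: the convex hull of a finite point set. -/
def IsPolytope {d : ℕ} (P : Set (Euc d)) : Prop :=
  ∃ S : Set (Euc d), S.Finite ∧ P = convexHull ℝ S

/-- `F` is a proper (nonempty) face of `P`: `F` is an exposed face of `P` (the intersection
of `P` with a supporting hyperplane) which is nonempty and different from `P` itself. -/
def IsProperFaceOf {d : ℕ} (P F : Set (Euc d)) : Prop :=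
  IsExposed ℝ P F ∧ F ≠ P ∧ F.Nonempty

/-- The vertex set of a polytope: its set of extreme points. -/
def vertSet {d : ℕ} (P : Set (Euc d)) : Set (Euc d) :=
  Set.extremePoints ℝ P

/-- The number of vertices of a polytope. -/
def vertCount {d : ℕ} (P : Set (Euc d)) : ℕ := (vertSet P).ncard

/-- `faceCount P k` is `f_k(P)`, the number of `k`-dimensional (proper) faces of `P`. -/
def faceCount {d : ℕ} (P : Set (Euc d)) (k : ℕ) : ℕ :=
  {F : Set (Euc d) | IsProperFaceOf P F ∧ setDim F = k}.ncard

/-- The moment curve `t ↦ (t, t², …, t^δ)` in `E^δ`. -/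
def momentCurve (δ : ℕ) (t : ℝ) : Euc δ := fun i => t ^ ((i : ℕ) + 1)

/-- A standard realization of the cyclic `δ`-polytope `C_δ(n)` with `n` vertices:
the convex hull of `n` distinct points on the moment curve. -/
def cyclicPolytope (δ n : ℕ) : Set (Euc δ) :=
  convexHull ℝ (momentCurve δ '' (Set.range fun j : Fin n => (j : ℝ) + 1))

/-- `S` is the vertex set of a proper face of `P` of dimension `|S| - 1`. -/
def IsSimplexFaceVertexSet {d : ℕ} (P S : Set (Euc d)) : Prop :=
  ∃ F : Set (Euc d), IsProperFaceOf P F ∧ vertSet F = S ∧ setDim F + 1 = S.ncard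

/-- A polytope `P` is `(V1; k)`-bineighborly: `V1` is a nonempty proper subset of the vertex
set of `P`, and for all nonempty `S1 ⊆ V1` and `S2 ⊆ V ∖ V1` with `|S1| + |S2| ≤ k`,
the set `S1 ∪ S2` is the vertex set of a face of `P` of dimension `|S1| + |S2| - 1`. -/
def PolytopeBineighborly {d : ℕ} (P V1 : Set (Euc d)) (k : ℕ) : Prop :=
  V1.Nonempty ∧ V1 ⊂ vertSet P ∧
    ∀ S1 S2 : Set (Euc d), S1.Nonempty → S2.Nonempty →
      S1 ⊆ V1 → S2 ⊆ vertSet P \ V1 → S1.ncard + S2.ncard ≤ k →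
        IsSimplexFaceVertexSet P (S1 ∪ S2)

/-- A polytope is `k`-neighborly if every nonempty subset of at most `k` of its vertices is
the vertex set of a face. -/
def PolytopeNeighborly {d : ℕ} (P : Set (Euc d)) (k : ℕ) : Prop :=
  ∀ S : Set (Euc d), S ⊆ vertSet P → S.Nonempty → S.ncard ≤ k →
    ∃ F : Set (Euc d), IsProperFaceOf P F ∧ vertSet F = S

/-- Embed `E^d` into the hyperplane `{x_{d+1} = c}` of `E^{d+1}`. -/
def lift {d : ℕ} (c : ℝ) (x : Euc d) : Euc (d + 1) := Fin.snoc x c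

/-- The Cayley polytope `CH_{d+1}({P1, P2})` of `P1` embedded in `{x_{d+1} = 0}` and
`P2` embedded in `{x_{d+1} = 1}`. -/
def cayley {d : ℕ} (P1 P2 : Set (Euc d)) : Set (Euc (d + 1)) :=
  convexHull ℝ (lift 0 '' P1 ∪ lift 1 '' P2)

/-- `ubTerm n d k = binom (n - d - 2 + k) k` (equal to the true binomial for `n ≥ d + 1`). -/
def ubTerm (n d k : ℕ) : ℕ := (n + k - (d + 2)).choose k

/-- The upper bound for `f_{k-1}(P1 ⊕ P2)`:
`f_k(C_{d+1}(n1+n2)) - ∑_{i=0}^{⌊(d+1)/2⌋} binom(d+1-i, k+1-i) (binom(n1-d-2+i, i) + binom(n2-d-2+i, i))`. -/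
def minkBound (d n1 n2 k : ℕ) : ℤ :=
  (faceCount (cyclicPolytope (d + 1) (n1 + n2)) k : ℤ)
    - ∑ i ∈ Finset.range ((d + 1) / 2 + 1),
        (if i ≤ k + 1 then ((d + 1 - i).choose (k + 1 - i) : ℤ) else 0)
          * ((ubTerm n1 d i : ℤ) + (ubTerm n2 d i : ℤ))

/-- A polytopal complex in `E^N`: a finite nonempty collection of polytopes containing `∅`,
closed under taking faces, such that pairwise intersections are faces of both. -/
structure PolyComplex (N : ℕ) where
  faces : Set (Set (Euc N))
  finite_faces : faces.Finite
  empty_mem : ∅ ∈ faces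
  polytope_mem : ∀ F ∈ faces, IsPolytope F
  down_closed : ∀ F ∈ faces, ∀ G : Set (Euc N), IsExposed ℝ F G → G ∈ faces
  inter_face : ∀ F ∈ faces, ∀ G ∈ faces, IsExposed ℝ F (F ∩ G) ∧ IsExposed ℝ G (F ∩ G)

namespace PolyComplex

/-- The vertex set of a complex: its `0`-dimensional faces. -/
def verts {N : ℕ} (C : PolyComplex N) : Set (Euc N) := {v : Euc N | {v} ∈ C.faces}

/-- `C` is a (pure-dimension-bounded) `d`-complex: all faces have dimension at most `d`
and some face has dimension exactly `d`. -/
def IsDComplex {N : ℕ} (C : PolyComplex N) (d : ℕ) : Prop :=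
  (∀ F ∈ C.faces, setDim F ≤ d) ∧ ∃ F ∈ C.faces, setDim F = d

/-- A complex `C` is `(V1; k)`-bineighborly. -/
def Bineighborly {N : ℕ} (C : PolyComplex N) (V1 : Set (Euc N)) (k : ℕ) : Prop :=
  V1.Nonempty ∧ V1 ⊂ C.verts ∧
    ∀ S1 S2 : Set (Euc N), S1.Nonempty → S2.Nonempty →
      S1 ⊆ V1 → S2 ⊆ C.verts \ V1 → S1.ncard + S2.ncard ≤ k →
        ∃ F ∈ C.faces, vertSet F = S1 ∪ S2 ∧ setDim F + 1 = S1.ncard + S2.ncard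

/-- A complex is `k`-neighborly if every nonempty subset of at most `k` of its vertices is
the vertex set of a face. -/
def Neighborly {N : ℕ} (C : PolyComplex N) (k : ℕ) : Prop :=
  ∀ S : Set (Euc N), S ⊆ C.verts → S.Nonempty → S.ncard ≤ k →
    ∃ F ∈ C.faces, vertSet F = S

end PolyComplex

/-- `F` is a simplex: the convex hull of an affinely independent finite point set. -/
def IsSimplexSet {d : ℕ} (F : Set (Euc d)) : Prop :=
  ∃ S : Finset (Euc d),
    AffineIndependent ℝ (fun v : {x // x ∈ S} => (v : Euc d)) ∧
      F = convexHull ℝ (S : Set (Euc d))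

/-- A simplicial polytope: all its proper faces are simplices. -/
def IsSimplicialPolytope {d : ℕ} (P : Set (Euc d)) : Prop :=
  IsPolytope P ∧ ∀ F : Set (Euc d), IsProperFaceOf P F → IsSimplexSet F

/-- The collection `𝓕` of proper faces of the Cayley polytope of `P1`, `P2` having at least one
vertex in (the embedded copy of) each of `P1` and `P2`. -/
def cayleyFaces {d : ℕ} (P1 P2 : Set (Euc d)) : Set (Set (Euc (d + 1))) :=
  {F : Set (Euc (d + 1)) | IsProperFaceOf (cayley P1 P2) F ∧
    (vertSet F ∩ lift 0 '' P1).Nonempty ∧ (vertSet F ∩ lift 1 '' P2).Nonempty}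

/-- `fFm1 P1 P2 k = f_{k-1}(𝓕)`, with the convention `f_{-1}(𝓕) = -1`. -/
def fFm1 {d : ℕ} (P1 P2 : Set (Euc d)) : ℕ → ℤ
  | 0 => -1
  | (k + 1) => (({F ∈ cayleyFaces P1 P2 | setDim F = k} : Set (Set (Euc (d + 1)))).ncard : ℤ)

/-- The `h`-vector of `𝓕`: `h_k(𝓕) = ∑_{i=0}^{k} (-1)^{k-i} binom(d+1-i, d+1-k) f_{i-1}(𝓕)`. -/
def hF {d : ℕ} (P1 P2 : Set (Euc d)) (k : ℕ) : ℤ :=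
  ∑ i ∈ Finset.range (k + 1),
    (-1 : ℤ) ^ (k - i) * ((d + 1 - i).choose (d + 1 - k) : ℤ) * fFm1 P1 P2 i

/-- `fBdm1 P k = f_{k-1}(∂P)`, with `f_{-1}(∂P) = 1`. -/
def fBdm1 {d : ℕ} (P : Set (Euc d)) : ℕ → ℤ
  | 0 => 1
  | (k + 1) => (faceCount P k : ℤ)

/-- The `h`-vector of the boundary complex of a `d`-polytope `P ⊆ E^d`:
`h_k(∂P) = ∑_{i=0}^{k} (-1)^{k-i} binom(d-i, d-k) f_{i-1}(∂P)`. -/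
def hBd {d : ℕ} (P : Set (Euc d)) (k : ℕ) : ℤ :=
  ∑ i ∈ Finset.range (k + 1),
    (-1 : ℤ) ^ (k - i) * ((d - i).choose (d - k) : ℤ) * fBdm1 P i

/-- The `g`-vector of `∂P`: `g_0 = h_0 (= 1)` and `g_k = h_k - h_{k-1}`, with the
convention `h_{d+1}(∂P) = 0`. -/
def gBd {d : ℕ} (P : Set (Euc d)) (k : ℕ) : ℤ :=
  (if k ≤ d then hBd P k else 0)
    - (if k = 0 then 0 else if k - 1 ≤ d then hBd P (k - 1) else 0)

/-- `fCycm1 δ n k = f_{k-1}(C_δ(n))`, with `f_{-1} = 1`. -/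
def fCycm1 (δ n k : ℕ) : ℤ :=
  if k = 0 then 1 else (faceCount (cyclicPolytope δ n) (k - 1) : ℤ)

/-- The upper bound for `f_{k-1}(𝓕)`:
`f_{k-1}(C_{d+1}(n1+n2)) - ∑_{i=0}^{⌊(d+1)/2⌋} binom(d+1-i, k-i)(binom(n1-d-2+i,i)+binom(n2-d-2+i,i))`. -/
def cayleyBound (d n1 n2 k : ℕ) : ℤ :=
  fCycm1 (d + 1) (n1 + n2) k
    - ∑ i ∈ Finset.range ((d + 1) / 2 + 1),
        (if i ≤ k then ((d + 1 - i).choose (k - i) : ℤ) else 0)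
          * ((ubTerm n1 d i : ℤ) + (ubTerm n2 d i : ℤ))

/-- The moment-like curve `γ1(t; ζ) = (t, ζ t^d, t², t³, …, t^{d-1}, 0)` in `E^{d+1}`. -/
def gamma1 (d : ℕ) (ζ t : ℝ) : Euc (d + 1) := fun i =>
  if (i : ℕ) = 0 then t
  else if (i : ℕ) = 1 then ζ * t ^ d
  else if (i : ℕ) = d then 0
  else t ^ (i : ℕ)

/-- The moment-like curve `γ2(s; ζ) = (ζ s^d, s, s², s³, …, s^{d-1}, 1)` in `E^{d+1}`. -/
def gamma2 (d : ℕ) (ζ s : ℝ) : Euc (d + 1) := fun i =>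
  if (i : ℕ) = 0 then ζ * s ^ d
  else if (i : ℕ) = 1 then s
  else if (i : ℕ) = d then 1
  else s ^ (i : ℕ)

/-- The `(k+ℓ) × (k+ℓ)` matrix whose determinant is `D_{k,ℓ}(τ)`: rows are
`(1,…,1,0,…,0)`, `(x₁τ,…,x_kτ,0,…,0)`, `(0,…,0,1,…,1)`, `(0,…,0,y₁,…,y_ℓ)` and
`(x₁^pτ^p,…,x_k^pτ^p,y₁^p,…,y_ℓ^p)` for `p = 2, …, k+ℓ-3`. -/
def Dmat (k l : ℕ) (x : Fin k → ℝ) (y : Fin l → ℝ) (τ : ℝ) :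
    Matrix (Fin (k + l)) (Fin (k + l)) ℝ :=
  Matrix.of fun r c =>
    have hcl : (c : ℕ) < k + l := c.isLt
    if hc : (c : ℕ) < k then
      if (r : ℕ) = 0 then 1
      else if (r : ℕ) = 1 then x ⟨(c : ℕ), hc⟩ * τ
      else if (r : ℕ) = 2 then 0
      else if (r : ℕ) = 3 then 0
      else (x ⟨(c : ℕ), hc⟩ * τ) ^ ((r : ℕ) - 2)
    else
      have hck : (c : ℕ) - k < l := by omega
      if (r : ℕ) = 0 then 0
      else if (r : ℕ) = 1 then 0
      else if (r : ℕ) = 2 then 1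
      else if (r : ℕ) = 3 then y ⟨(c : ℕ) - k, hck⟩
      else y ⟨(c : ℕ) - k, hck⟩ ^ ((r : ℕ) - 2)

/-- The exponent vector `μ = (0, 1, k, k+1, …, k+ℓ-3)`. -/
def muExp (k i : ℕ) : ℕ := if i = 0 then 0 else if i = 1 then 1 else k + i - 2

/-- The Vandermonde determinant `VD(x) = ∏_{i<j} (x_j - x_i)`. -/
def VDprod {k : ℕ} (x : Fin k → ℝ) : ℝ :=
  ∏ p ∈ Finset.univ.filter (fun p : Fin k × Fin k => p.1 < p.2), (x p.2 - x p.1)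

/-- The generalized Vandermonde determinant `GVD(y; μ) = det (y_j^{μ_i})` with exponent
vector `μ = (0, 1, k, k+1, …, k+ℓ-3)`. -/
def GVDdet (k : ℕ) {l : ℕ} (y : Fin l → ℝ) : ℝ :=
  (Matrix.of fun i j : Fin l => y j ^ muExp k (i : ℕ)).det

/-- `binom(a, b)` for an integer lower index, zero when `b < 0` or `b > a`. -/
def zchoose (a : ℕ) (b : ℤ) : ℝ := if 0 ≤ b then (a.choose b.toNat : ℝ) else 0

set_option linter.unusedSectionVars false

namespace MinkUB

section Functionals
variable {E : Type*} [NormedAddCommGroup E] [NormedSpace ℝ E] [FiniteDimensional ℝ E]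

theorem exists_functional_of_linearIndepOn {ι : Type*} {f : ι → E} {T : Set ι}
    (h : LinearIndepOn ℝ f T) (t : ι → ℝ) : ∃ u : E →L[ℝ] ℝ, ∀ i ∈ T, u (f i) = t i := by
  obtain ⟨g, hg⟩ := LinearMap.exists_extend
    ((Module.Basis.span h.linearIndependent).constr ℝ (fun i : T => t i))
  refine ⟨LinearMap.toContinuousLinearMap g, fun i hi => ?_⟩
  have h1 : ((Module.Basis.span h.linearIndependent) ⟨i, hi⟩ : E) = f i := by
    simp [Module.Basis.span_apply]
  have := LinearMap.congr_fun hg ((Module.Basis.span h.linearIndependent) ⟨i, hi⟩)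
  simp only [LinearMap.comp_apply, Submodule.subtype_apply, Module.Basis.constr_basis, h1] at this
  simpa using this

theorem exists_expansion_of_linearIndepOn {ι : Type*} {f : ι → E} {T : Finset ι}
    (h : LinearIndepOn ℝ f (T : Set ι)) (hc : T.card = Module.finrank ℝ E) (w : E) :
    ∃ a : ι → ℝ, w = ∑ i ∈ T, a i • f i := by
  have h1 := h.linearIndependent.span_eq_top_of_card_eq_finrank' (by simpa using hc)
  have h2 : w ∈ Submodule.span ℝ (f '' (T : Set ι)) := by
    have : Set.range (fun x : (T : Set ι) => f x) = f '' (T : Set ι) := by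
      rw [Set.image_eq_range]
    rw [← this, h1]; trivial
  rw [Submodule.mem_span_image_finset_iff_exists_fun] at h2
  obtain ⟨a, ha⟩ := h2
  classical
  refine ⟨fun i => if hi : i ∈ T then a ⟨i, hi⟩ else 0, ?_⟩
  rw [← ha, Finset.univ_eq_attach, ← Finset.sum_attach T]
  refine Finset.sum_congr rfl fun i _ => ?_
  simp

theorem exists_functional_of_notMem {p : Submodule ℝ E} {x : E} (hx : x ∉ p) :
    ∃ u : E →L[ℝ] ℝ, (∀ z ∈ p, u z = 0) ∧ u x = 1 := by
  obtain ⟨g, hg, hgx⟩ := LinearMap.exists_extend_of_notMem (0 : p →ₗ[ℝ] ℝ) hx 1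
  refine ⟨LinearMap.toContinuousLinearMap g, fun z hz => ?_, by simpa using hgx⟩
  have := LinearMap.congr_fun hg ⟨z, hz⟩
  simpa using this

end Functionals

section LP
variable {E : Type*} [NormedAddCommGroup E] [NormedSpace ℝ E] [FiniteDimensional ℝ E]
variable {J : Type*} [Fintype J] [DecidableEq J]

/-- A functional that is nonnegative on all the vectors of a configuration. -/
def Nonneg (v : J → E) (y : E →L[ℝ] ℝ) : Prop := ∀ j, 0 ≤ y (v j)

open Classical in
/-- The indices of the vectors of a configuration killed by a functional. -/
def zeroSet (v : J → E) (y : E →L[ℝ] ℝ) : Finset J := Finset.univ.filter fun j => y (v j) = 0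

theorem mem_zeroSet {v : J → E} {y : E →L[ℝ] ℝ} {j : J} : j ∈ zeroSet v y ↔ y (v j) = 0 := by
  simp [zeroSet]

theorem Nonneg.pos {v : J → E} {y : E →L[ℝ] ℝ} (hy : Nonneg v y) {j : J} (hj : j ∉ zeroSet v y) :
    0 < y (v j) := lt_of_le_of_ne (hy j) fun h => hj (mem_zeroSet.2 h.symm)

/-- The faces seen by the linear program that minimizes `w` on the section `c = 1` of the dual
cone of the configuration `v`. -/
def system (v : J → E) (c w : E) : Set (Finset J) :=
  {T | (∃ y : E →L[ℝ] ℝ, Nonneg v y ∧ zeroSet v y = T ∧ 0 < y c) ∧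
    ∀ y : E →L[ℝ] ℝ, Nonneg v y → T ⊆ zeroSet v y → y ≠ 0 → 0 < y w}

open Classical in
/-- The simple vertices of the linear program attached to `c` and `w`. -/
def facets (v : J → E) (c w : E) : Finset (Finset J) :=
  Finset.univ.filter fun S => S.card + 1 = Module.finrank ℝ E ∧
    ∃ y : E →L[ℝ] ℝ, Nonneg v y ∧ zeroSet v y = S ∧ 0 < y c ∧ 0 < y w

theorem mem_facets {v : J → E} {c w : E} {S : Finset J} :
    S ∈ facets v c w ↔ S.card + 1 = Module.finrank ℝ E ∧
    ∃ y : E →L[ℝ] ℝ, Nonneg v y ∧ zeroSet v y = S ∧ 0 < y c ∧ 0 < y w := by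
  simp [facets]

theorem facets_comm (v : J → E) (c w : E) : facets v c w = facets v w c := by
  ext S
  simp only [mem_facets]
  constructor <;> rintro ⟨h, y, h1, h2, h3, h4⟩ <;> exact ⟨h, y, h1, h2, h4, h3⟩

/-- The family `𝒯` is the disjoint union of the intervals `[N S, S]`, for `S ∈ 𝒮`. -/
structure IsPartition (𝒯 : Set (Finset J)) (𝒮 : Finset (Finset J)) (N : Finset J → Finset J)
    (r : ℕ) : Prop where
  card : ∀ S ∈ 𝒮, S.card = r
  sub : ∀ S ∈ 𝒮, N S ⊆ S
  mem : ∀ S ∈ 𝒮, ∀ T, N S ⊆ T → T ⊆ S → T ∈ 𝒯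
  ex : ∀ T ∈ 𝒯, ∃ S ∈ 𝒮, N S ⊆ T ∧ T ⊆ S
  uniq : ∀ S ∈ 𝒮, ∀ S' ∈ 𝒮, ∀ T, N S ⊆ T → T ⊆ S → N S' ⊆ T → T ⊆ S' → S = S'

theorem IsPartition.congr {𝒯 : Set (Finset J)} {𝒮 : Finset (Finset J)}
    {N N' : Finset J → Finset J} {r : ℕ} (h : IsPartition 𝒯 𝒮 N r) (hN : ∀ S ∈ 𝒮, N S = N' S) :
    IsPartition 𝒯 𝒮 N' r where
  card := h.card
  sub := fun S hS => hN S hS ▸ h.sub S hS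
  mem := fun S hS => hN S hS ▸ h.mem S hS
  ex := fun T hT => by
    obtain ⟨S, hS, h1, h2⟩ := h.ex T hT
    exact ⟨S, hS, hN S hS ▸ h1, h2⟩
  uniq := fun S hS S' hS' => hN S hS ▸ hN S' hS' ▸ h.uniq S hS S' hS'

/-- The nondegeneracy hypotheses of the linear program. -/
structure IsGeneric (v : J → E) (c w : E) : Prop where
  indep : ∀ y : E →L[ℝ] ℝ, Nonneg v y → 0 < y c → 0 < y w →
    LinearIndepOn ℝ v (zeroSet v y : Set J)
  notMem : ∀ y : E →L[ℝ] ℝ, Nonneg v y → 0 < y c → 0 < y w →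
    (zeroSet v y).card + 1 < Module.finrank ℝ E →
    w ∉ Submodule.span ℝ (insert c (v '' (zeroSet v y : Set J)))
  left_nonneg : ∀ y : E →L[ℝ] ℝ, Nonneg v y → 0 ≤ y c
  right_nonneg : ∀ y : E →L[ℝ] ℝ, Nonneg v y → 0 ≤ y w
  eq_zero : ∀ y : E →L[ℝ] ℝ, Nonneg v y → y c = 0 → y w = 0 → y = 0

theorem exists_small {v : J → E} {y u : E →L[ℝ] ℝ} (hy : Nonneg v y) :
    ∃ ε : ℝ, 0 < ε ∧ ∀ j, j ∉ zeroSet v y → 0 < (y + ε • u) (v j) := by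
  have h : ∀ᶠ ε : ℝ in nhdsWithin 0 (Ioi 0), ∀ j, j ∉ zeroSet v y → 0 < (y + ε • u) (v j) := by
    rw [Filter.eventually_all]
    intro j
    by_cases hj : j ∈ zeroSet v y
    · simp [hj]
    · have hc : Continuous fun ε : ℝ => (y + ε • u) (v j) := by
        simp only [add_apply, smul_apply]
        fun_prop
      have : ∀ᶠ ε : ℝ in nhds 0, 0 < (y + ε • u) (v j) :=
        hc.continuousAt.eventually (lt_mem_nhds (by simpa using hy.pos hj))
      filter_upwards [nhdsWithin_le_nhds this] with ε hε _ using hε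
  obtain ⟨ε, h1, h2⟩ := (h.and self_mem_nhdsWithin).exists
  exact ⟨ε, h2, h1⟩

theorem indepOn_option {v : J → E} {c : E} {y : E →L[ℝ] ℝ} (hc : 0 < y c)
    (hi : LinearIndepOn ℝ v (zeroSet v y : Set J)) :
    LinearIndepOn ℝ (fun o : Option J => o.elim c v)
      (Finset.insertNone (zeroSet v y) : Set (Option J)) := by
  have h0 : ((Finset.insertNone (zeroSet v y) : Finset (Option J)) : Set (Option J)) =
      insert none (some '' (zeroSet v y : Set J)) := by
    ext o
    cases o <;> simp
  rw [h0, linearIndepOn_insert (by simp)]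
  refine ⟨LinearIndepOn.image_of_comp _ _ hi, fun h => ?_⟩
  have hle : Submodule.span ℝ ((fun o : Option J => o.elim c v) '' (some '' (zeroSet v y : Set J)))
      ≤ LinearMap.ker (y : E →ₗ[ℝ] ℝ) := by
    rw [Submodule.span_le]
    rintro _ ⟨_, ⟨j, hj, rfl⟩, rfl⟩
    simpa [mem_zeroSet] using hj
  have := hle h
  simp at this
  exact hc.ne' this

theorem exists_dual_functional {v : J → E} {c : E} {y : E →L[ℝ] ℝ} (hc : 0 < y c)
    (hi : LinearIndepOn ℝ v (zeroSet v y : Set J)) (t : J → ℝ) :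
    ∃ u : E →L[ℝ] ℝ, u c = 0 ∧ ∀ j ∈ zeroSet v y, u (v j) = t j := by
  obtain ⟨u, hu⟩ := exists_functional_of_linearIndepOn (indepOn_option hc hi)
    (fun o => o.elim 0 t)
  exact ⟨u, by simpa using hu none (by simp), fun j hj => by
    simpa using hu (some j) (by simpa using hj)⟩

theorem exists_expansion {v : J → E} {c : E} {y : E →L[ℝ] ℝ} (hc : 0 < y c)
    (hi : LinearIndepOn ℝ v (zeroSet v y : Set J))
    (hcard : (zeroSet v y).card + 1 = Module.finrank ℝ E) (w : E) :
    ∃ (a : J → ℝ) (κ : ℝ), w = ∑ j ∈ zeroSet v y, a j • v j + κ • c := by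
  obtain ⟨a, ha⟩ := exists_expansion_of_linearIndepOn (indepOn_option hc hi)
    (by simpa using hcard) w
  refine ⟨fun j => a (some j), a none, ?_⟩
  rw [ha, Finset.sum_insertNone, add_comm]
  rfl

theorem exists_min {v : J → E} {c w : E} {T : Finset J} (hT : T ∈ system v c w) :
    ∃ y : E →L[ℝ] ℝ, Nonneg v y ∧ T ⊆ zeroSet v y ∧ y c = 1 ∧
      ∀ y' : E →L[ℝ] ℝ, Nonneg v y' → T ⊆ zeroSet v y' → y' c = 1 → y w ≤ y' w := by
  obtain ⟨⟨y₁, hy₁, hz₁, hc₁⟩, hpos⟩ := hT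
  set K : Set (E →L[ℝ] ℝ) := {y | Nonneg v y ∧ T ⊆ zeroSet v y} with hK
  have hcont : ∀ x : E, Continuous fun y : E →L[ℝ] ℝ => y x := fun x => by fun_prop
  have hKc : IsClosed K := by
    have : K = (⋂ j, {y : E →L[ℝ] ℝ | 0 ≤ y (v j)}) ∩ ⋂ j ∈ T, {y : E →L[ℝ] ℝ | y (v j) = 0} := by
      ext y
      simp [hK, Nonneg, Finset.subset_iff, mem_zeroSet]
    rw [this]
    exact (isClosed_iInter fun j => isClosed_le continuous_const (hcont _)).inter
      (isClosed_iInter fun j => isClosed_iInter fun _ => isClosed_eq (hcont _) continuous_const)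
  have hsmul : ∀ y ∈ K, ∀ t : ℝ, 0 ≤ t → t • y ∈ K := by
    rintro y ⟨h1, h2⟩ t ht
    refine ⟨fun j => ?_, fun j hj => ?_⟩
    · simpa using mul_nonneg ht (h1 j)
    · have := mem_zeroSet.1 (h2 hj)
      simp [mem_zeroSet, this]
  have : ProperSpace (E →L[ℝ] ℝ) := FiniteDimensional.proper_real _
  have hy₁K : y₁ ∈ K := ⟨hy₁, hz₁.ge⟩
  have hy₁0 : y₁ ≠ 0 := by rintro rfl; simp at hc₁
  obtain ⟨z, ⟨hzs, hzK⟩, hzmin⟩ : ∃ z ∈ Metric.sphere (0 : E →L[ℝ] ℝ) 1 ∩ K,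
      IsMinOn (fun y : E →L[ℝ] ℝ => y w) (Metric.sphere (0 : E →L[ℝ] ℝ) 1 ∩ K) z := by
    refine ((isCompact_sphere _ _).inter_right hKc).exists_isMinOn ?_ (hcont w).continuousOn
    refine ⟨‖y₁‖⁻¹ • y₁, ?_, hsmul _ hy₁K _ (by positivity)⟩
    simp [norm_smul, hy₁0]
  have hz0 : z ≠ 0 := by rintro rfl; simp at hzs
  have hη : 0 < z w := hpos z hzK.1 hzK.2 hz0
  have hbound : ∀ y ∈ K, z w * ‖y‖ ≤ y w := by
    intro y hy
    by_cases hy0 : y = 0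
    · simp [hy0]
    have hn : 0 < ‖y‖ := norm_pos_iff.2 hy0
    have h1 : z w ≤ (‖y‖⁻¹ • y) w := hzmin ⟨by simp [norm_smul, hy0], hsmul _ hy _ (by positivity)⟩
    simp only [smul_apply, smul_eq_mul] at h1
    rw [inv_mul_eq_div, le_div_iff₀ hn] at h1
    exact h1
  set y₂ : E →L[ℝ] ℝ := (y₁ c)⁻¹ • y₁
  have hy₂K : y₂ ∈ K := hsmul _ hy₁K _ (by positivity)
  have hy₂c : y₂ c = 1 := by simp [y₂, hc₁.ne']
  set G : Set (E →L[ℝ] ℝ) := (K ∩ {y | y c = 1}) ∩ {y | y w ≤ y₂ w}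
  have hGc : IsCompact G := by
    refine Metric.isCompact_of_isClosed_isBounded ((hKc.inter (isClosed_eq (hcont c)
      continuous_const)).inter (isClosed_le (hcont w) continuous_const)) ?_
    refine (Metric.isBounded_closedBall (x := (0 : E →L[ℝ] ℝ)) (r := y₂ w / z w)).subset ?_
    rintro y ⟨⟨hyK, -⟩, hyw⟩
    rw [mem_closedBall_zero_iff, le_div_iff₀ hη, mul_comm]
    exact (hbound y hyK).trans hyw
  obtain ⟨y, ⟨⟨hyK, hyc⟩, hyw⟩, hymin⟩ := hGc.exists_isMinOn
    ⟨y₂, ⟨hy₂K, hy₂c⟩, le_refl (y₂ w)⟩ (hcont w).continuousOn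
  refine ⟨y, hyK.1, hyK.2, hyc, fun y' h1 h2 h3 => ?_⟩
  by_cases h : y' w ≤ y₂ w
  · exact hymin ⟨⟨⟨h1, h2⟩, h3⟩, h⟩
  · exact le_trans hyw (not_le.1 h).le

theorem eval_expansion {v : J → E} {c w : E} {S : Finset J} {a : J → ℝ} {κ : ℝ}
    (h : w = ∑ j ∈ S, a j • v j + κ • c) (y : E →L[ℝ] ℝ) :
    y w = ∑ j ∈ S, a j * y (v j) + κ * y c := by
  conv_lhs => rw [h]
  simp

theorem expansion_term_nonneg {v : J → E} {S T : Finset J} (a : J → ℝ)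
    (hN : S.filter (fun j => a j < 0) ⊆ T) {y : E →L[ℝ] ℝ} (hy : Nonneg v y)
    (hT : T ⊆ zeroSet v y) : ∀ j ∈ S, 0 ≤ a j * y (v j) := by
  intro j hj
  by_cases hjT : j ∈ T
  · simp [mem_zeroSet.1 (hT hjT)]
  · refine mul_nonneg (not_lt.1 fun h => hjT (hN ?_)) (hy j)
    simp [hj, h]

theorem sum_expansion_nonneg {v : J → E} {S T : Finset J} (a : J → ℝ)
    (hN : S.filter (fun j => a j < 0) ⊆ T) {y : E →L[ℝ] ℝ} (hy : Nonneg v y)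
    (hT : T ⊆ zeroSet v y) : 0 ≤ ∑ j ∈ S, a j * y (v j) :=
  Finset.sum_nonneg (expansion_term_nonneg a hN hy hT)

theorem isPartition_aux {v : J → E} {c w : E} (hg : IsGeneric v c w)
    (a : Finset J → J → ℝ) (κ : Finset J → ℝ)
    (hexp : ∀ S ∈ facets v c w, w = ∑ j ∈ S, a S j • v j + κ S • c)
    (hκ : ∀ S ∈ facets v c w, 0 < κ S)
    (ha : ∀ S ∈ facets v c w, ∀ j ∈ S, a S j ≠ 0) :
    IsPartition (system v c w) (facets v c w) (fun S => S.filter fun j => a S j < 0)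
      (Module.finrank ℝ E - 1) where
  card := by
    intro S hS
    have := (mem_facets.1 hS).1
    omega
  sub := fun S _ => Finset.filter_subset _ _
  mem := by
    intro S hS T hNT hTS
    obtain ⟨hcard, y, hy, rfl, hc, hw⟩ := mem_facets.1 hS
    set S := zeroSet v y
    constructor
    · obtain ⟨u, huc, hu⟩ := exists_dual_functional hc (hg.indep y hy hc hw)
        (fun j => if j ∈ T then 0 else 1)
      obtain ⟨ε, hε, hpos⟩ := exists_small hy (u := u)
      refine ⟨y + ε • u, fun j => ?_, ?_, by simpa [huc] using hc⟩
      · by_cases hj : j ∈ S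
        · have h1 := mem_zeroSet.1 hj
          simp only [add_apply, smul_apply, h1, hu j hj, smul_eq_mul]
          split_ifs <;> simp [hε.le]
        · exact (hpos j hj).le
      · ext j
        rw [mem_zeroSet]
        by_cases hj : j ∈ S
        · have h1 := mem_zeroSet.1 hj
          simp only [add_apply, smul_apply, h1, hu j hj, smul_eq_mul]
          split_ifs with hT <;> simp [hε.ne', hT]
        · exact ⟨fun h => absurd h (hpos j hj).ne', fun h => absurd (hTS h) hj⟩
    · intro y' hy' hT hne
      have hval := eval_expansion (hexp S hS) y'
      have hs := sum_expansion_nonneg (a S) hNT hy' hT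
      have hc' := hg.left_nonneg y' hy'
      have hk := mul_nonneg (hκ S hS).le hc'
      refine lt_of_le_of_ne (by linarith) fun h0 => hne ?_
      refine hg.eq_zero y' hy' ?_ h0.symm
      have : κ S * y' c = 0 := by linarith
      exact (mul_eq_zero.1 this).resolve_left (hκ S hS).ne'
  ex := by
    intro T hT
    obtain ⟨y, hy, hTy, hyc, hmin⟩ := exists_min hT
    have hc : 0 < y c := by rw [hyc]; exact one_pos
    have hw : 0 < y w := hT.2 y hy hTy fun h => by simp [h] at hyc
    have hi := hg.indep y hy hc hw
    have hle : (zeroSet v y).card + 1 ≤ Module.finrank ℝ E := by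
      have := (indepOn_option hc hi).linearIndependent.fintype_card_le_finrank
      simpa only [Finset.coe_sort_coe, Fintype.card_coe, Finset.card_insertNone] using this
    have hcard : (zeroSet v y).card + 1 = Module.finrank ℝ E := by
      by_contra hne
      obtain ⟨u, hu, huw⟩ := exists_functional_of_notMem
        (hg.notMem y hy hc hw (lt_of_le_of_ne hle hne))
      obtain ⟨ε, hε, hpos⟩ := exists_small hy (u := -u)
      have huS : ∀ j ∈ zeroSet v y, (y + ε • -u) (v j) = 0 := fun j hj => by
        have := hu (v j) (Submodule.subset_span (mem_insert_of_mem _ ⟨j, hj, rfl⟩))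
        simp [mem_zeroSet.1 hj, this]
      have := hmin (y + ε • -u) (fun j => ?_) (fun j hj => mem_zeroSet.2 (huS j (hTy hj)))
        (by simp [hyc, hu c (Submodule.subset_span (mem_insert _ _))])
      · simp [huw] at this
        linarith
      · by_cases hj : j ∈ zeroSet v y
        · exact (huS j hj).ge
        · exact (hpos j hj).le
    have hS : zeroSet v y ∈ facets v c w := mem_facets.2 ⟨hcard, y, hy, rfl, hc, hw⟩
    refine ⟨_, hS, fun s hs => ?_, hTy⟩
    obtain ⟨hs, has⟩ := Finset.mem_filter.1 hs
    by_contra hsT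
    obtain ⟨u, huc, hu⟩ := exists_dual_functional hc hi (fun j => if j = s then 1 else 0)
    obtain ⟨ε, hε, hpos⟩ := exists_small hy (u := u)
    have huw : u w = a (zeroSet v y) s := by
      rw [eval_expansion (hexp _ hS) u, huc, Finset.sum_eq_single s]
      · simp [hu s hs]
      · intro j hj hjs
        simp [hu j hj, hjs]
      · exact fun h => absurd hs h
    have := hmin (y + ε • u) (fun j => ?_) (fun j hj => ?_) (by simp [hyc, huc])
    · simp only [add_apply, smul_apply, smul_eq_mul, huw] at this
      nlinarith
    · by_cases hj : j ∈ zeroSet v y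
      · simp only [add_apply, smul_apply, mem_zeroSet.1 hj, hu j hj, smul_eq_mul]
        split_ifs <;> simp [hε.le]
      · exact (hpos j hj).le
    · have : j ≠ s := fun h => hsT (h ▸ hj)
      simp [mem_zeroSet, mem_zeroSet.1 (hTy hj), hu j (hTy hj), this]
  uniq := by
    have key : ∀ S ∈ facets v c w, ∀ S' ∈ facets v c w, ∀ T, S.filter (fun j => a S j < 0) ⊆ T →
        T ⊆ S' → κ S ≤ κ S' ∧ (κ S = κ S' → S ⊆ S') := by
      intro S hS S' hS' T hNT hTS
      obtain ⟨-, y', hy', hz', hc', -⟩ := mem_facets.1 hS'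
      have h1 := eval_expansion (hexp S hS) y'
      have h2 := eval_expansion (hexp S' hS') y'
      rw [Finset.sum_eq_zero (fun j hj => by
        rw [mem_zeroSet.1 (hz'.symm ▸ hj : j ∈ zeroSet v y'), mul_zero]), zero_add] at h2
      have hs := sum_expansion_nonneg (a S) hNT hy' (hz'.symm ▸ hTS)
      have h3 : κ S * y' c ≤ κ S' * y' c := by linarith
      refine ⟨le_of_mul_le_mul_right h3 hc', fun h j hj => ?_⟩
      rw [h] at h1
      have h4 : ∑ j ∈ S, a S j * y' (v j) = 0 := by linarith
      rw [Finset.sum_eq_zero_iff_of_nonneg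
        (fun j hj => expansion_term_nonneg (a S) hNT hy' (hz'.symm ▸ hTS) j hj)] at h4
      have := (mul_eq_zero.1 (h4 j hj)).resolve_left (ha S hS j hj)
      rw [← hz']
      exact mem_zeroSet.2 this
    intro S hS S' hS' T h1 h2 h3 h4
    obtain ⟨h5, h6⟩ := key S hS S' hS' T h1 h4
    obtain ⟨h7, -⟩ := key S' hS' S hS T h3 h2
    refine Finset.eq_of_subset_of_card_le (h6 (le_antisymm h5 h7)) ?_
    have := (mem_facets.1 hS).1
    have := (mem_facets.1 hS').1
    omega

theorem apply_eq_zero_of_mem_span {v : J → E} {y : E →L[ℝ] ℝ} {S : Finset J}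
    (h : S ⊆ zeroSet v y) {x : E} (hx : x ∈ Submodule.span ℝ (v '' (S : Set J))) : y x = 0 := by
  have hle : Submodule.span ℝ (v '' (S : Set J)) ≤ LinearMap.ker (y : E →ₗ[ℝ] ℝ) := by
    rw [Submodule.span_le]
    rintro _ ⟨j, hj, rfl⟩
    simpa [mem_zeroSet] using h hj
  simpa using hle hx

theorem IsGeneric.symm {v : J → E} {c w : E} (hg : IsGeneric v c w) : IsGeneric v w c where
  indep := fun y hy hw hc => hg.indep y hy hc hw
  notMem := by
    intro y hy hw hc hcard hmem
    obtain ⟨t, z, hz, rfl⟩ := Submodule.mem_span_insert.1 hmem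
    have hyz := apply_eq_zero_of_mem_span (Finset.Subset.refl _) hz
    have ht : t ≠ 0 := by
      rintro rfl
      simp [hyz] at hc
    refine hg.notMem y hy hc hw hcard (Submodule.mem_span_insert.2 ⟨t⁻¹, -(t⁻¹ • z),
      Submodule.neg_mem _ (Submodule.smul_mem _ _ hz), ?_⟩)
    rw [smul_add, smul_smul, inv_mul_cancel₀ ht]
    simp
  left_nonneg := hg.right_nonneg
  right_nonneg := hg.left_nonneg
  eq_zero := fun y hy h1 h2 => hg.eq_zero y hy h2 h1

theorem IsGeneric.exists_isPartition {v : J → E} {c w : E} (hg : IsGeneric v c w) :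
    ∃ N : Finset J → Finset J,
      IsPartition (system v c w) (facets v c w) N (Module.finrank ℝ E - 1) ∧
      IsPartition (system v w c) (facets v c w) (fun S => S \ N S) (Module.finrank ℝ E - 1) ∧
      ∀ S ∈ facets v c w, ∀ s ∈ S, ∀ u : E →L[ℝ] ℝ, u c = 0 → u (v s) = 1 →
        (∀ t ∈ S, t ≠ s → u (v t) = 0) → 0 ≤ u w → s ∉ N S := by
  have hex : ∀ S : Finset J, ∃ (a : J → ℝ) (κ : ℝ), S ∈ facets v c w →
      w = ∑ j ∈ S, a j • v j + κ • c := by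
    intro S
    by_cases hS : S ∈ facets v c w
    · obtain ⟨hcard, y, hy, rfl, hc, hw⟩ := mem_facets.1 hS
      obtain ⟨a, κ, h⟩ := exists_expansion hc (hg.indep y hy hc hw) hcard w
      exact ⟨a, κ, fun _ => h⟩
    · exact ⟨0, 0, fun h => absurd h hS⟩
  choose a κ hexp using hex
  have hκ : ∀ S ∈ facets v c w, 0 < κ S := by
    intro S hS
    obtain ⟨-, y, hy, hz, hc, hw⟩ := mem_facets.1 hS
    rw [eval_expansion (hexp S hS) y, Finset.sum_eq_zero (fun j hj => by
        rw [mem_zeroSet.1 (hz.symm ▸ hj : j ∈ zeroSet v y), mul_zero]), zero_add] at hw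
    exact pos_of_mul_pos_left hw hc.le
  have ha : ∀ S ∈ facets v c w, ∀ j ∈ S, a S j ≠ 0 := by
    intro S hS s hs has
    obtain ⟨hcard, y, hy, hz, hc, hw⟩ := mem_facets.1 hS
    obtain ⟨u, huc, hu⟩ := exists_dual_functional hc (hg.indep y hy hc hw)
      (fun j => if j = s then 1 else 0)
    obtain ⟨ε, hε, hpos⟩ := exists_small hy (u := u)
    rw [hz] at hu hpos
    have hvS : ∀ j ∈ S, y (v j) = 0 := fun j hj => mem_zeroSet.1 (hz.symm ▸ hj)
    have huS : ∀ j ∈ S, u (v j) = 0 ∨ j = s := fun j hj => by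
      by_cases h : j = s
      · exact Or.inr h
      · exact Or.inl (by simp [hu j hj, h])
    have hy' : Nonneg v (y + ε • u) := by
      intro j
      by_cases hj : j ∈ S
      · simp only [add_apply, smul_apply, hvS j hj, hu j hj, smul_eq_mul]
        split_ifs <;> simp [hε.le]
      · exact (hpos j hj).le
    have hz' : zeroSet v (y + ε • u) = S.erase s := by
      ext j
      rw [mem_zeroSet, Finset.mem_erase]
      by_cases hj : j ∈ S
      · by_cases hjs : j = s
        · subst hjs
          simp [hvS _ hj, hu _ hj, hε.ne']
        · simp [hvS _ hj, hu _ hj, hjs, hj]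
      · exact ⟨fun h => absurd h (hpos j hj).ne', fun h => absurd h.2 hj⟩
    have huw : u w = 0 := by
      rw [eval_expansion (hexp S hS) u, huc, Finset.sum_eq_zero, zero_add, mul_zero]
      intro j hj
      obtain h | rfl := huS j hj
      · simp [h]
      · simp [has]
    refine hg.notMem (y + ε • u) hy' (by simpa [huc] using hc) (by simpa [huw] using hw) ?_ ?_
    · rw [hz', Finset.card_erase_of_mem hs]
      have := Finset.card_pos.2 ⟨s, hs⟩
      omega
    · rw [hexp S hS]
      refine Submodule.add_mem _ (Submodule.sum_mem _ fun j hj => ?_)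
        (Submodule.smul_mem _ _ (Submodule.subset_span (mem_insert _ _)))
      by_cases hjs : j = s
      · rw [hjs, has, zero_smul]
        exact Submodule.zero_mem _
      · refine Submodule.smul_mem _ _ (Submodule.subset_span (mem_insert_of_mem _ ⟨j, ?_, rfl⟩))
        rw [hz']
        simp [hj, hjs]
  refine ⟨fun S => S.filter fun j => a S j < 0, isPartition_aux hg a κ hexp hκ ha, ?_, ?_⟩
  · have := isPartition_aux hg.symm (fun S j => -(κ S)⁻¹ * a S j) (fun S => (κ S)⁻¹) ?_ ?_ ?_
    · rw [facets_comm v w c] at this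
      refine this.congr fun S hS => ?_
      ext j
      simp only [Finset.mem_filter, Finset.mem_sdiff, not_and, not_lt]
      refine and_congr_right fun hj => ?_
      have h1 := inv_pos.2 (hκ S hS)
      have h2 := ha S hS j hj
      constructor
      · intro h _
        by_contra! h3
        nlinarith
      · intro h
        have := lt_of_le_of_ne (h hj) h2.symm
        nlinarith
    · intro S hS
      rw [facets_comm] at hS
      have h0 := (hκ S hS).ne'
      have h := hexp S hS
      have h1 : (κ S)⁻¹ • w = (κ S)⁻¹ • ∑ j ∈ S, a S j • v j + c := by
        conv_lhs => rw [h]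
        rw [smul_add, smul_smul, inv_mul_cancel₀ h0, one_smul]
      rw [h1, ← add_assoc, Finset.smul_sum, ← Finset.sum_add_distrib, Finset.sum_eq_zero, zero_add]
      intro j _
      rw [smul_smul, ← add_smul]
      simp
    · intro S hS
      rw [facets_comm] at hS
      exact inv_pos.2 (hκ S hS)
    · intro S hS j hj
      rw [facets_comm] at hS
      exact mul_ne_zero (neg_ne_zero.2 (inv_ne_zero (hκ S hS).ne')) (ha S hS j hj)
  · intro S hS s hs u huc hus hu huw hN
    have h := eval_expansion (hexp S hS) u
    rw [huc, Finset.sum_eq_single s (fun j hj hjs => by rw [hu j hj hjs, mul_zero])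
      (fun h => absurd hs h), hus] at h
    have := (Finset.mem_filter.1 hN).2
    linarith

end LP

section Counting
open Polynomial
variable {J : Type*} [Fintype J] [DecidableEq J]

open Classical in
/-- The face enumerator of a family of finite sets. -/
def fpoly (𝒯 : Set (Finset J)) : ℤ[X] := ∑ T ∈ Finset.univ.filter (· ∈ 𝒯), X ^ T.card

/-- The face enumerator with a given `h`-vector. -/
def hpoly (r : ℕ) (h : ℕ → ℤ) : ℤ[X] :=
  ∑ i ∈ Finset.range (r + 1), C (h i) * (X ^ i * (1 + X) ^ (r - i))

/-- The number of intervals whose bottom has `i` elements. -/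
def hnum (𝒮 : Finset (Finset J)) (N : Finset J → Finset J) (i : ℕ) : ℤ :=
  (𝒮.filter fun S => (N S).card = i).card

/-- The sets of a family that contain `u`, with `u` deleted. -/
def link (𝒯 : Set (Finset J)) (u : J) : Set (Finset J) := {T | u ∉ T ∧ insert u T ∈ 𝒯}

theorem mem_link {𝒯 : Set (Finset J)} {u : J} {T : Finset J} :
    T ∈ link 𝒯 u ↔ u ∉ T ∧ insert u T ∈ 𝒯 := Iff.rfl

theorem hpoly_congr {r : ℕ} {h h' : ℕ → ℤ} (H : ∀ i ≤ r, h i = h' i) : hpoly r h = hpoly r h' :=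
  Finset.sum_congr rfl fun i hi => by rw [H i (by simpa [Nat.lt_succ_iff] using hi)]

theorem hpoly_add (r : ℕ) (h h' : ℕ → ℤ) :
    hpoly r (fun i => h i + h' i) = hpoly r h + hpoly r h' := by
  simp [hpoly, add_mul, Finset.sum_add_distrib]

theorem hpoly_sub (r : ℕ) (h h' : ℕ → ℤ) :
    hpoly r (fun i => h i - h' i) = hpoly r h - hpoly r h' := by
  simp [hpoly, sub_mul, Finset.sum_sub_distrib]

theorem hpoly_sum {ι : Type*} (s : Finset ι) (r : ℕ) (h : ι → ℕ → ℤ) :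
    hpoly r (fun i => ∑ u ∈ s, h u i) = ∑ u ∈ s, hpoly r (h u) := by
  simp only [hpoly, map_sum, Finset.sum_mul]
  rw [Finset.sum_comm]

theorem coeff_hpoly (r : ℕ) (h : ℕ → ℤ) (m : ℕ) :
    (hpoly r h).coeff m =
      ∑ i ∈ Finset.range (r + 1), (if i ≤ m then ((r - i).choose (m - i) : ℤ) else 0) * h i := by
  simp only [hpoly, finsetSum_coeff, coeff_C_mul, coeff_X_pow_mul']
  refine Finset.sum_congr rfl fun i _ => ?_
  split_ifs
  · rw [coeff_one_add_X_pow, mul_comm]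
  · simp

theorem hpoly_injective {r : ℕ} {h h' : ℕ → ℤ} (H : hpoly r h = hpoly r h') :
    ∀ i ≤ r, h i = h' i := by
  intro i
  induction i using Nat.strong_induction_on with
  | _ i ih =>
    intro hi
    have h1 := congrArg (fun p => coeff p i) H
    simp only [coeff_hpoly] at h1
    rw [← sub_eq_zero, ← Finset.sum_sub_distrib, Finset.sum_eq_single i] at h1
    · simpa [sub_eq_zero] using h1
    · intro j hj hji
      rcases lt_or_gt_of_ne hji with hlt | hgt
      · rw [ih j hlt (by omega), sub_self]
      · simp [not_le.2 hgt]
    · intro h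
      simp at h
      omega

theorem derivative_hpoly (r : ℕ) (h : ℕ → ℤ) :
    derivative (hpoly (r + 1) h) =
      hpoly r (fun i => (i + 1) * h (i + 1) + (r + 1 - i) * h i) := by
  rw [hpoly_add]
  simp only [hpoly, derivative_sum]
  have : ∀ i ∈ Finset.range (r + 1 + 1), derivative (C (h i) * (X ^ i * (1 + X) ^ (r + 1 - i))) =
      C (i * h i) * (X ^ (i - 1) * (1 + X) ^ (r - (i - 1) : ℕ)) * (if i = 0 then 0 else 1) +
      C ((r + 1 - i) * h i) * (X ^ i * (1 + X) ^ (r - i)) := by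
    intro i hi
    have hi : i ≤ r + 1 := by simpa [Nat.lt_succ_iff] using hi
    rw [derivative_C_mul, derivative_mul, derivative_X_pow, derivative_pow]
    rcases Nat.eq_zero_or_pos i with rfl | hi0
    · simp
      ring
    · rw [show r - (i - 1) = r + 1 - i by omega, show r + 1 - i - 1 = r - i by omega]
      have : ((r + 1 - i : ℕ) : ℤ[X]) = (r : ℤ[X]) + 1 - i := by
        rw [Nat.cast_sub hi]; push_cast; rfl
      simp only [if_neg hi0.ne', map_mul, map_natCast, map_sub, map_add, map_one, this,
        derivative_one, derivative_X]
      ring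
  rw [Finset.sum_congr rfl this, Finset.sum_add_distrib]
  congr 1
  · rw [Finset.sum_range_succ']
    simp
  · rw [Finset.sum_range_succ]
    simp

theorem derivative_fpoly (𝒯 : Set (Finset J)) :
    derivative (fpoly 𝒯) = ∑ u, fpoly (link 𝒯 u) := by
  classical
  simp only [fpoly, derivative_sum, derivative_X_pow]
  have h1 : ∀ T ∈ Finset.univ.filter (· ∈ 𝒯), C (T.card : ℤ) * X ^ (T.card - 1) =
      ∑ u : J, if u ∈ T then (X : ℤ[X]) ^ (T.card - 1) else 0 := by
    intro T _
    rw [Finset.sum_ite_mem, Finset.univ_inter, Finset.sum_const]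
    simp
  rw [Finset.sum_congr rfl h1, Finset.sum_comm]
  refine Finset.sum_congr rfl fun u _ => ?_
  rw [← Finset.sum_filter]
  refine Finset.sum_bij' (fun T _ => T.erase u) (fun T _ => insert u T) ?_ ?_ ?_ ?_ ?_
  · intro T hT
    simp only [Finset.mem_filter, Finset.mem_univ, true_and] at hT
    rw [Finset.mem_filter]
    exact ⟨Finset.mem_univ _, Finset.notMem_erase _ _, (Finset.insert_erase hT.2).symm ▸ hT.1⟩
  · intro T hT
    simp only [Finset.mem_filter, Finset.mem_univ, true_and, mem_link] at hT
    simp [hT.2]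
  · intro T hT
    simp only [Finset.mem_filter, Finset.mem_univ, true_and] at hT
    exact Finset.insert_erase hT.2
  · intro T hT
    simp only [Finset.mem_filter, Finset.mem_univ, true_and, mem_link] at hT
    exact Finset.erase_insert hT.1
  · intro T hT
    simp only [Finset.mem_filter, Finset.mem_univ, true_and] at hT
    rw [Finset.card_erase_of_mem hT.2]

theorem sum_Icc_pow_card {N S : Finset J} (h : N ⊆ S) :
    ∑ T ∈ Finset.Icc N S, (X : ℤ[X]) ^ T.card = X ^ N.card * (1 + X) ^ (S.card - N.card) := by
  rw [Finset.Icc_eq_image_powerset h, Finset.sum_image, ← Finset.card_sdiff_of_subset h,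
    add_comm 1 X, ← Finset.sum_pow_mul_eq_add_pow, Finset.mul_sum]
  · refine Finset.sum_congr rfl fun T hT => ?_
    rw [Finset.card_union_of_disjoint, pow_add, one_pow, mul_one]
    exact Finset.disjoint_sdiff.mono_right (Finset.mem_powerset.1 hT)
  · intro T hT T' hT' hTT
    have h1 : Disjoint N T := Finset.disjoint_sdiff.mono_right (Finset.mem_powerset.1 hT)
    have h2 : Disjoint N T' := Finset.disjoint_sdiff.mono_right (Finset.mem_powerset.1 hT')
    simp only at hTT
    rw [← Finset.union_sdiff_cancel_left h1, hTT, Finset.union_sdiff_cancel_left h2]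

theorem IsPartition.fpoly_eq {𝒯 : Set (Finset J)} {𝒮 : Finset (Finset J)}
    {N : Finset J → Finset J} {r : ℕ} (h : IsPartition 𝒯 𝒮 N r) :
    fpoly 𝒯 = hpoly r (hnum 𝒮 N) := by
  classical
  have h1 : Finset.univ.filter (· ∈ 𝒯) = 𝒮.biUnion fun S => Finset.Icc (N S) S := by
    ext T
    simp only [Finset.mem_filter, Finset.mem_univ, true_and, Finset.mem_biUnion, Finset.mem_Icc]
    exact ⟨fun hT => h.ex T hT, fun ⟨S, hS, h1, h2⟩ => h.mem S hS T h1 h2⟩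
  rw [fpoly, h1, Finset.sum_biUnion]
  · have h2 : ∀ S ∈ 𝒮, ∑ T ∈ Finset.Icc (N S) S, (X : ℤ[X]) ^ T.card =
        ∑ i ∈ Finset.range (r + 1), if (N S).card = i then X ^ i * (1 + X) ^ (r - i) else 0 := by
      intro S hS
      rw [sum_Icc_pow_card (h.sub S hS), Finset.sum_ite_eq, h.card S hS, if_pos]
      have := Finset.card_le_card (h.sub S hS)
      rw [h.card S hS] at this
      simpa [Nat.lt_succ_iff] using this
    rw [Finset.sum_congr rfl h2, Finset.sum_comm, hpoly]
    refine Finset.sum_congr rfl fun i _ => ?_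
    rw [← Finset.sum_filter, Finset.sum_const, hnum]
    simp
  · intro S hS S' hS' hne
    refine Finset.disjoint_left.2 fun T hT hT' => hne ?_
    rw [Finset.mem_Icc] at hT hT'
    exact h.uniq S hS S' hS' T hT.1 hT.2 hT'.1 hT'.2

theorem IsPartition.hnum_sdiff {𝒯 : Set (Finset J)} {𝒮 : Finset (Finset J)}
    {N : Finset J → Finset J} {r : ℕ} (h : IsPartition 𝒯 𝒮 N r) {i : ℕ} (hi : i ≤ r) :
    hnum 𝒮 (fun S => S \ N S) i = hnum 𝒮 N (r - i) := by
  rw [hnum, hnum]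
  congr 2
  refine Finset.filter_congr fun S hS => ?_
  have h1 := h.card S hS
  have h2 := Finset.card_le_card (h.sub S hS)
  rw [Finset.card_sdiff_of_subset (h.sub S hS)]
  omega

theorem IsPartition.link {𝒯 : Set (Finset J)} {𝒮 : Finset (Finset J)}
    {N : Finset J → Finset J} {r : ℕ} (h : IsPartition 𝒯 𝒮 N (r + 1)) {u : J}
    (hu : ∀ S ∈ 𝒮, u ∈ S → u ∉ N S) :
    IsPartition (link 𝒯 u) ((𝒮.filter (u ∈ ·)).image (·.erase u)) (fun S => N (insert u S)) r := by
  have key : ∀ S' ∈ (𝒮.filter (u ∈ ·)).image (·.erase u),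
      u ∉ S' ∧ insert u S' ∈ 𝒮 ∧ u ∉ N (insert u S') := by
    intro S' hS'
    obtain ⟨S, hS, rfl⟩ := Finset.mem_image.1 hS'
    obtain ⟨hS, huS⟩ := Finset.mem_filter.1 hS
    rw [Finset.insert_erase huS]
    exact ⟨by simp, hS, hu S hS huS⟩
  refine ⟨fun S hS => ?_, fun S hS => ?_, fun S hS T h1 h2 => ?_, fun T hT => ?_,
    fun S hS S' hS' T h1 h2 h3 h4 => ?_⟩
  · obtain ⟨h1, h2, -⟩ := key S hS
    have := h.card _ h2
    rw [Finset.card_insert_of_notMem h1] at this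
    omega
  · obtain ⟨h1, h2, h3⟩ := key S hS
    exact (Finset.subset_insert_iff_of_notMem h3).1 (h.sub _ h2)
  · obtain ⟨h3, h4, h5⟩ := key S hS
    exact ⟨fun h => h3 (h2 h), h.mem _ h4 _ (h1.trans (Finset.subset_insert _ _))
      (Finset.insert_subset_insert _ h2)⟩
  · obtain ⟨S, hS, h1, h2⟩ := h.ex _ hT.2
    have huS : u ∈ S := h2 (Finset.mem_insert_self _ _)
    refine ⟨S.erase u, Finset.mem_image.2 ⟨S, by simp [hS, huS], rfl⟩, ?_, ?_⟩
    · rw [Finset.insert_erase huS]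
      exact (Finset.subset_insert_iff_of_notMem (hu S hS huS)).1 h1
    · rw [Finset.subset_erase]
      exact ⟨(Finset.subset_insert _ _).trans h2, hT.1⟩
  · obtain ⟨a1, a2, -⟩ := key S hS
    obtain ⟨b1, b2, -⟩ := key S' hS'
    have := h.uniq _ a2 _ b2 (insert u T) (h1.trans (Finset.subset_insert _ _))
      (Finset.insert_subset_insert _ h2) (h3.trans (Finset.subset_insert _ _))
      (Finset.insert_subset_insert _ h4)
    rw [← Finset.erase_insert a1, this, Finset.erase_insert b1]

theorem IsPartition.exists_link {𝒯 : Set (Finset J)} {𝒮 : Finset (Finset J)}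
    {N : Finset J → Finset J} {r : ℕ} (h : IsPartition 𝒯 𝒮 N (r + 1)) {u : J}
    (hu : ∀ S ∈ 𝒮, u ∈ S → u ∉ N S) :
    ∃ h' : ℕ → ℤ, fpoly (MinkUB.link 𝒯 u) = hpoly r h' ∧ ∀ i, h' i ≤ hnum 𝒮 N i := by
  refine ⟨_, (h.link hu).fpoly_eq, fun i => ?_⟩
  rw [hnum, hnum, Nat.cast_le]
  refine Finset.card_le_card_of_injOn (insert u) ?_ ?_
  · intro S hS
    simp only [Finset.coe_filter, Finset.mem_image, Finset.mem_filter, mem_ofPred_eq] at hS ⊢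
    obtain ⟨⟨S, hS, rfl⟩, hc⟩ := hS
    rw [Finset.insert_erase hS.2] at hc ⊢
    exact ⟨hS.1, hc⟩
  · intro S hS S' hS' hSS
    simp only [Finset.coe_filter, Finset.mem_image, Finset.mem_filter, mem_ofPred_eq] at hS hS'
    obtain ⟨⟨S, hS, rfl⟩, -⟩ := hS
    obtain ⟨⟨S', hS', rfl⟩, -⟩ := hS'
    rw [Finset.insert_erase hS.2, Finset.insert_erase hS'.2] at hSS
    rw [hSS]

theorem coeff_fpoly (𝒯 : Set (Finset J)) (m : ℕ) :
    (fpoly 𝒯).coeff m = ({T | T ∈ 𝒯 ∧ T.card = m} : Set (Finset J)).ncard := by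
  classical
  rw [fpoly, finsetSum_coeff]
  simp only [coeff_X_pow]
  rw [← Finset.sum_filter, Finset.sum_const, Finset.filter_filter, ← Set.ncard_coe_finset]
  simp [eq_comm]

theorem fpoly_union {𝒯 𝒯' : Set (Finset J)} (h : Disjoint 𝒯 𝒯') :
    fpoly (𝒯 ∪ 𝒯') = fpoly 𝒯 + fpoly 𝒯' := by
  classical
  rw [fpoly, fpoly, fpoly, ← Finset.sum_union]
  · congr 1
    ext T
    simp
  · exact Finset.disjoint_left.2 fun T h1 h2 => Set.disjoint_left.1 h
      (by simpa using h1) (by simpa using h2)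

theorem fpoly_image {J' : Type*} [Fintype J'] [DecidableEq J'] (f : J' ↪ J) (𝒯 : Set (Finset J')) :
    fpoly ((fun T => T.map f) '' 𝒯) = fpoly 𝒯 := by
  classical
  rw [fpoly, fpoly]
  symm
  refine Finset.sum_bij (fun T _ => T.map f) ?_ ?_ ?_ ?_
  · intro T hT
    simp only [Finset.mem_filter, Finset.mem_univ, true_and] at hT ⊢
    exact ⟨T, hT, rfl⟩
  · intro T _ T' _ h
    exact Finset.map_injective f h
  · intro T hT
    simp only [Finset.mem_filter, Finset.mem_univ, true_and] at hT
    obtain ⟨T', h1, h2⟩ := hT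
    exact ⟨T', by simpa using h1, h2⟩
  · intro T _
    simp

end Counting

section Perturbation
open Filter Topology
variable {E : Type*} [NormedAddCommGroup E] [NormedSpace ℝ E] [FiniteDimensional ℝ E]
variable {J : Type*} [Fintype J] [DecidableEq J]

theorem eventually_eval_ne_zero {p : Polynomial ℝ} (hp : p ≠ 0) :
    ∀ᶠ τ : ℝ in 𝓝[>] 0, p.eval τ ≠ 0 := by
  have h1 : ∀ᶠ τ : ℝ in cofinite, p.eval τ ≠ 0 := by
    rw [eventually_cofinite]
    simpa [Polynomial.IsRoot] using Polynomial.finite_setOfPred_isRoot hp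
  exact (nhdsWithin_mono _ (fun x hx => (ne_of_gt hx : x ≠ 0)) : 𝓝[>] (0 : ℝ) ≤ 𝓝[≠] 0)
    |>.trans (nhdsNE_le_cofinite 0) h1

theorem exists_perturb {ι κ : Type*} [Finite ι] [Finite κ] (v : J → E) (A : Finset J) (u : E)
    (φ : ι → E →L[ℝ] ℝ) (hφ : ∀ i, ∃ j ∈ A, φ i (v j) ≠ 0) (ψ : κ → E →L[ℝ] ℝ)
    (hψ : ∀ k, 0 < ψ k u) : ∃ t : J → ℝ, (∀ j, 0 < t j) ∧
      (∀ i, φ i (u + ∑ j ∈ A, t j • v j) ≠ 0) ∧ ∀ k, 0 < ψ k (u + ∑ j ∈ A, t j • v j) := by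
  classical
  let e := Fintype.equivFin J
  let w : ℝ → E := fun τ => u + ∑ j ∈ A, τ ^ ((e j : ℕ) + 1) • v j
  have hw : Continuous w := by fun_prop
  have hw0 : w 0 = u := by simp [w]
  have h1 : ∀ i, ∀ᶠ τ : ℝ in 𝓝[>] 0, φ i (w τ) ≠ 0 := by
    intro i
    obtain ⟨j, hj, hne⟩ := hφ i
    let p : Polynomial ℝ := Polynomial.C (φ i u) +
      ∑ j ∈ A, Polynomial.C (φ i (v j)) * Polynomial.X ^ ((e j : ℕ) + 1)
    have hp : p ≠ 0 := by
      intro h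
      have : p.coeff ((e j : ℕ) + 1) = φ i (v j) := by
        simp only [p, Polynomial.coeff_add, Polynomial.coeff_C_succ, zero_add,
          Polynomial.finsetSum_coeff, Polynomial.coeff_C_mul_X_pow]
        rw [Finset.sum_eq_single j]
        · simp
        · intro j' _ hne'
          rw [if_neg]
          intro h
          exact hne' (e.injective (Fin.ext (by omega)))
        · exact fun h => absurd hj h
      rw [h] at this
      exact hne (by simpa using this.symm)
    filter_upwards [eventually_eval_ne_zero hp] with τ hτ
    have : φ i (w τ) = p.eval τ := by
      simp only [w, p, map_add, map_sum, map_smul, smul_eq_mul, Polynomial.eval_add,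
        Polynomial.eval_C, Polynomial.eval_finsetSum, Polynomial.eval_mul, Polynomial.eval_pow,
        Polynomial.eval_X, mul_comm]
    rwa [this]
  have h2 : ∀ k, ∀ᶠ τ : ℝ in 𝓝[>] 0, 0 < ψ k (w τ) := by
    intro k
    have hc : Continuous fun τ => ψ k (w τ) := by fun_prop
    exact nhdsWithin_le_nhds (hc.continuousAt.eventually (lt_mem_nhds (by simpa [hw0] using hψ k)))
  obtain ⟨τ, ⟨h3, h4⟩, h5⟩ := ((eventually_all.2 h1).and (eventually_all.2 h2)).and
    self_mem_nhdsWithin |>.exists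
  exact ⟨fun j => τ ^ ((e j : ℕ) + 1), fun j => pow_pos h5 _, h3, h4⟩

theorem exists_generic (v : J → E) (c u : E) (A : Finset J)
    (hA : ∀ y : E →L[ℝ] ℝ, Nonneg v y → 0 < y c → (zeroSet v y).card + 1 < Module.finrank ℝ E →
      ∃ j ∈ A, v j ∉ Submodule.span ℝ (insert c (v '' (zeroSet v y : Set J)))) :
    ∃ t : J → ℝ, (∀ j, 0 < t j) ∧
      (∀ y : E →L[ℝ] ℝ, Nonneg v y → 0 < y c → (zeroSet v y).card + 1 < Module.finrank ℝ E →
        u + ∑ j ∈ A, t j • v j ∉ Submodule.span ℝ (insert c (v '' (zeroSet v y : Set J)))) ∧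
      ∀ y : E →L[ℝ] ℝ, 0 < y c → LinearIndepOn ℝ v (zeroSet v y : Set J) →
        ∀ s ∈ zeroSet v y, v s = u → ∃ φ : E →L[ℝ] ℝ, φ c = 0 ∧ φ (v s) = 1 ∧
          (∀ t ∈ zeroSet v y, t ≠ s → φ (v t) = 0) ∧ 0 < φ (u + ∑ j ∈ A, t j • v j) := by
  classical
  let ι := {S : Finset J // ∃ φ : E →L[ℝ] ℝ, (∀ z ∈ Submodule.span ℝ (insert c (v '' (S : Set J))),
    φ z = 0) ∧ ∃ j ∈ A, φ (v j) ≠ 0}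
  let κ := {p : Finset J × J // v p.2 = u ∧ ∃ φ : E →L[ℝ] ℝ, φ c = 0 ∧ φ (v p.2) = 1 ∧
          (∀ t ∈ p.1, t ≠ p.2 → φ (v t) = 0)}
  obtain ⟨t, ht, h1, h2⟩ := exists_perturb v A u (fun i : ι => i.2.choose)
    (fun i => i.2.choose_spec.2) (fun k : κ => k.2.2.choose) (fun k => by
      have := k.2.2.choose_spec.2.1
      have h' : ∀ x, x = u → (k.2.2.choose) x = 1 → 0 < (k.2.2.choose) u := by
        rintro _ rfl h
        rw [h]
        exact one_pos
      exact h' _ k.2.1 this)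
  refine ⟨t, ht, fun y hy hc hcard hmem => ?_, fun y hc hi s hs hsu => ?_⟩
  · obtain ⟨j, hj, hnot⟩ := hA y hy hc hcard
    obtain ⟨φ, hφ, hφj⟩ := exists_functional_of_notMem hnot
    let i : ι := ⟨zeroSet v y, φ, hφ, j, hj, by simp [hφj]⟩
    exact h1 i (i.2.choose_spec.1 _ hmem)
  · obtain ⟨φ, hφc, hφ⟩ := exists_dual_functional hc hi (fun j => if j = s then 1 else 0)
    let k : κ := ⟨(zeroSet v y, s), hsu, φ, hφc, by simp [hφ s hs], fun t ht hts => by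
      simp [hφ t ht, hts]⟩
    obtain ⟨a1, a2, a3⟩ := k.2.2.choose_spec
    exact ⟨k.2.2.choose, a1, a2, a3, h2 k⟩

theorem finrank_span_insert_le (v : J → E) (c : E) (S : Finset J) :
    Module.finrank ℝ (Submodule.span ℝ (insert c (v '' (S : Set J)))) ≤ S.card + 1 := by
  classical
  have h : (insert c (v '' (S : Set J))) = ((insert c (S.image v) : Finset E) : Set E) := by simp
  rw [h]
  exact (finrank_span_finset_le_card _).trans ((Finset.card_insert_le _ _).trans
    (Nat.add_le_add_right Finset.card_image_le _))

end Perturbation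

section HVector
open Polynomial
variable {J : Type*} [Fintype J] [DecidableEq J]

theorem sum_link_le {𝒯 : Set (Finset J)} {r : ℕ} {h : ℕ → ℤ}
    (hh : derivative (fpoly 𝒯) = derivative (hpoly (r + 1) h))
    {b : J → ℕ → ℤ} (hb : ∀ u, ∃ h', fpoly (link 𝒯 u) = hpoly r h' ∧ ∀ i ≤ r, h' i ≤ b u i) :
    ∀ i ≤ r, (i + 1) * h (i + 1) + (r + 1 - i) * h i ≤ ∑ u, b u i := by
  choose h' h1 h2 using hb
  have h3 := derivative_fpoly 𝒯
  rw [hh, derivative_hpoly, Finset.sum_congr rfl (fun u _ => h1 u), ← hpoly_sum] at h3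
  intro i hi
  rw [hpoly_injective h3 i hi]
  exact Finset.sum_le_sum fun u _ => h2 u i hi

theorem X_mul_hpoly (r : ℕ) (h : ℕ → ℤ) :
    X * hpoly r h = hpoly (r + 1) (fun i => if i = 0 then 0 else h (i - 1)) := by
  rw [hpoly, hpoly, Finset.sum_range_succ' _ (r + 1), Finset.mul_sum]
  simp only [if_true, map_zero, zero_mul, add_zero, Nat.add_sub_add_right, Nat.add_sub_cancel,
    Nat.succ_ne_zero, if_false]
  exact Finset.sum_congr rfl fun i _ => by ring

theorem hpoly_succ {r : ℕ} {h : ℕ → ℤ} (h0 : h (r + 1) = 0) :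
    hpoly r h = hpoly (r + 1) (fun i => h i - if i = 0 then 0 else h (i - 1)) := by
  rw [hpoly_sub, ← X_mul_hpoly, hpoly, hpoly, Finset.sum_range_succ _ (r + 1), h0, Finset.mul_sum,
    map_zero, zero_mul, add_zero, ← Finset.sum_sub_distrib]
  refine Finset.sum_congr rfl fun i hi => ?_
  rw [Nat.succ_sub (by simpa [Nat.lt_succ_iff] using hi), pow_succ]
  ring

theorem fpoly_mem (𝒯 : Set (Finset J)) (u : J) :
    fpoly {T ∈ 𝒯 | u ∈ T} = X * fpoly (link 𝒯 u) := by
  classical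
  rw [fpoly, fpoly, Finset.mul_sum]
  refine Finset.sum_bij' (fun T _ => T.erase u) (fun T _ => insert u T) ?_ ?_ ?_ ?_ ?_
  · intro T hT
    simp only [Finset.mem_filter, Finset.mem_univ, true_and, mem_link, mem_ofPred_eq] at hT ⊢
    exact ⟨Finset.notMem_erase _ _, (Finset.insert_erase hT.2).symm ▸ hT.1⟩
  · intro T hT
    simp only [Finset.mem_filter, Finset.mem_univ, true_and, mem_link, mem_ofPred_eq] at hT ⊢
    exact ⟨hT.2, Finset.mem_insert_self _ _⟩
  · intro T hT
    simp only [Finset.mem_filter, Finset.mem_univ, true_and, mem_ofPred_eq] at hT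
    exact Finset.insert_erase hT.2
  · intro T hT
    simp only [Finset.mem_filter, Finset.mem_univ, true_and, mem_link] at hT
    exact Finset.erase_insert hT.1
  · intro T hT
    simp only [Finset.mem_filter, Finset.mem_univ, true_and, mem_ofPred_eq] at hT
    rw [Finset.card_erase_of_mem hT.2, ← pow_succ', Nat.sub_add_cancel
      (Finset.card_pos.2 ⟨u, hT.2⟩)]

theorem fpoly_eq_notMem_add (𝒯 : Set (Finset J)) (u : J) :
    fpoly 𝒯 = fpoly {T ∈ 𝒯 | u ∉ T} + X * fpoly (link 𝒯 u) := by
  rw [← fpoly_mem, ← fpoly_union]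
  · congr 1
    ext T
    simp only [mem_union, mem_ofPred_eq]
    tauto
  · exact Set.disjoint_left.2 fun T h1 h2 => h1.2 h2.2

end HVector

section Uniform
variable {E : Type*} [NormedAddCommGroup E] [NormedSpace ℝ E] [FiniteDimensional ℝ E]
variable {J : Type*} [Fintype J] [DecidableEq J]

/-- A configuration of vectors in general position in an open half-space. -/
structure IsUniform (v : J → E) : Prop where
  indep_of_card_eq : ∀ S : Finset J, S.card = Module.finrank ℝ E → LinearIndepOn ℝ v (S : Set J)
  finrank_le : Module.finrank ℝ E ≤ Fintype.card J
  exists_pos : ∃ y : E →L[ℝ] ℝ, ∀ j, 0 < y (v j)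

/-- The faces of a configuration, as index sets. -/
def faces (v : J → E) : Set (Finset J) :=
  {T | ∃ y : E →L[ℝ] ℝ, Nonneg v y ∧ y ≠ 0 ∧ zeroSet v y = T}

theorem eq_zero_of_linearIndepOn {v : J → E} {S : Finset J} (h : LinearIndepOn ℝ v (S : Set J))
    (hc : S.card = Module.finrank ℝ E) {y : E →L[ℝ] ℝ} (hy : S ⊆ zeroSet v y) : y = 0 := by
  ext x
  obtain ⟨a, rfl⟩ := exists_expansion_of_linearIndepOn h hc x
  simp only [map_sum, map_smul, zero_apply, smul_zero, Finset.sum_const_zero]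
  exact Finset.sum_eq_zero fun j hj => by rw [mem_zeroSet.1 (hy hj), smul_zero]

theorem Nonneg.sum_nonneg {v : J → E} {y : E →L[ℝ] ℝ} (hy : Nonneg v y) {t : J → ℝ}
    (ht : ∀ j, 0 < t j) (A : Finset J) : 0 ≤ y (∑ j ∈ A, t j • v j) := by
  simp only [map_sum, map_smul, smul_eq_mul]
  exact Finset.sum_nonneg fun j _ => mul_nonneg (ht j).le (hy j)

theorem Nonneg.sum_eq_zero_iff {v : J → E} {y : E →L[ℝ] ℝ} (hy : Nonneg v y) {t : J → ℝ}
    (ht : ∀ j, 0 < t j) (A : Finset J) : y (∑ j ∈ A, t j • v j) = 0 ↔ A ⊆ zeroSet v y := by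
  simp only [map_sum, map_smul, smul_eq_mul]
  rw [Finset.sum_eq_zero_iff_of_nonneg fun j _ => mul_nonneg (ht j).le (hy j)]
  refine forall₂_congr fun j _ => ?_
  rw [mem_zeroSet, mul_eq_zero, or_iff_right (ht j).ne']

namespace IsUniform
variable {v : J → E}

theorem indep (hv : IsUniform v) {S : Finset J} (hS : S.card ≤ Module.finrank ℝ E) :
    LinearIndepOn ℝ v (S : Set J) := by
  obtain ⟨S', h1, h2⟩ := Finset.exists_superset_card_eq hS (by simpa using hv.finrank_le)
  exact (hv.indep_of_card_eq S' h2).mono (by simpa using h1)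

theorem card_zeroSet (hv : IsUniform v) {y : E →L[ℝ] ℝ} (hy : y ≠ 0) :
    (zeroSet v y).card + 1 ≤ Module.finrank ℝ E := by
  by_contra! h
  obtain ⟨S, h1, h2⟩ := Finset.exists_subset_card_eq (Nat.lt_succ_iff.1 h)
  exact hy (eq_zero_of_linearIndepOn (hv.indep_of_card_eq S h2) h2 h1)

theorem indep_zeroSet (hv : IsUniform v) {y : E →L[ℝ] ℝ} (hy : y ≠ 0) :
    LinearIndepOn ℝ v (zeroSet v y : Set J) :=
  hv.indep ((Nat.le_succ _).trans (hv.card_zeroSet hy))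

theorem exists_notMem_span (hv : IsUniform v) {S : Finset J} {c : E}
    (hS : S.card + 1 < Module.finrank ℝ E) :
    ∃ j ∈ Finset.univ, v j ∉ Submodule.span ℝ (insert c (v '' (S : Set J))) := by
  by_contra! h
  obtain ⟨S', h1, h2⟩ := Finset.exists_superset_card_eq (s := (∅ : Finset J)) (Nat.zero_le _)
    (by simpa using hv.finrank_le)
  have h3 := (hv.indep_of_card_eq S' h2).linearIndependent.span_eq_top_of_card_eq_finrank'
    (by simpa using h2)
  have h4 : (⊤ : Submodule ℝ E) ≤ Submodule.span ℝ (insert c (v '' (S : Set J))) := by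
    rw [← h3, Submodule.span_le]
    rintro _ ⟨j, rfl⟩
    exact h j (Finset.mem_univ _)
  have h5 := finrank_span_insert_le v c S
  rw [top_le_iff.1 h4, finrank_top] at h5
  omega

theorem pos_of_ne_zero (hv : IsUniform v) {y : E →L[ℝ] ℝ} (hy : Nonneg v y) (h0 : y ≠ 0) {t : J → ℝ}
    (ht : ∀ j, 0 < t j) : 0 < y (∑ j, t j • v j) := by
  refine lt_of_le_of_ne (hy.sum_nonneg ht _) fun h => ?_
  have h1 := Finset.card_le_card ((hy.sum_eq_zero_iff ht _).1 h.symm)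
  have h2 := hv.card_zeroSet h0
  have h3 := hv.finrank_le
  rw [Finset.card_univ] at h1
  omega

/-- The common consequence of genericity: `w` may be chosen close to any vector of the
configuration, and then the family has a partition compatible with that vector. -/
theorem exists_interior (hv : IsUniform v) {c : E} (hc : ∀ y : E →L[ℝ] ℝ, Nonneg v y → 0 ≤ y c)
    (u : J) : ∃ w : E, (∀ y : E →L[ℝ] ℝ, Nonneg v y → y ≠ 0 → 0 < y w) ∧
      ∃ N : Finset J → Finset J,
      IsPartition (system v c w) (facets v c w) N (Module.finrank ℝ E - 1) ∧
      IsPartition (system v w c) (facets v c w) (fun S => S \ N S) (Module.finrank ℝ E - 1) ∧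
      ∀ S ∈ facets v c w, u ∈ S → u ∉ N S := by
  obtain ⟨t, ht, h1, h2⟩ := exists_generic v c (v u) Finset.univ
    fun y _ _ hcard => hv.exists_notMem_span hcard
  have hw : ∀ y : E →L[ℝ] ℝ, Nonneg v y → y ≠ 0 → 0 < y (v u + ∑ j, t j • v j) := by
    intro y hy h0
    rw [map_add]
    exact add_pos_of_nonneg_of_pos (hy u) (hv.pos_of_ne_zero hy h0 ht)
  have hg : IsGeneric v c (v u + ∑ j, t j • v j) :=
    { indep := fun y hy hc _ => hv.indep_zeroSet (by rintro rfl; simp at hc)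
      notMem := fun y hy hc _ hcard => h1 y hy hc hcard
      left_nonneg := hc
      right_nonneg := fun y hy => by
        by_cases h : y = 0
        · simp [h]
        · exact (hw y hy h).le
      eq_zero := fun y hy _ h => by
        by_contra h0
        exact (hw y hy h0).ne' h }
  obtain ⟨N, hN, hN', hN''⟩ := hg.exists_isPartition
  refine ⟨_, hw, N, hN, hN', fun S hS hu => ?_⟩
  obtain ⟨-, y, hy, rfl, hyc, hyw⟩ := mem_facets.1 hS
  obtain ⟨φ, a1, a2, a3, a4⟩ := h2 y hyc (hg.indep y hy hyc hyw) u hu rfl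
  exact hN'' _ hS u hu φ a1 a2 a3 a4.le

theorem system_eq {c w : E} (hw : ∀ y : E →L[ℝ] ℝ, Nonneg v y → y ≠ 0 → 0 < y w) :
    system v c w = {T | ∃ y : E →L[ℝ] ℝ, Nonneg v y ∧ zeroSet v y = T ∧ 0 < y c} := by
  ext T
  exact ⟨fun h => h.1, fun h => ⟨h, fun y hy _ h0 => hw y hy h0⟩⟩

theorem system_eq_faces {c w : E} (hc : ∀ y : E →L[ℝ] ℝ, Nonneg v y → y ≠ 0 → 0 < y c)
    (hw : ∀ y : E →L[ℝ] ℝ, Nonneg v y → y ≠ 0 → 0 < y w) : system v c w = faces v := by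
  rw [system_eq hw]
  ext T
  refine ⟨fun ⟨y, h1, h2, h3⟩ => ⟨y, h1, ?_, h2⟩, fun ⟨y, h1, h2, h3⟩ => ⟨y, h1, h3, hc y h1 h2⟩⟩
  rintro rfl
  simp at h3

theorem system_eq_antistar {w : E} {x : J}
    (hw : ∀ y : E →L[ℝ] ℝ, Nonneg v y → y ≠ 0 → 0 < y w) :
    system v (v x) w = {T ∈ faces v | x ∉ T} := by
  rw [system_eq hw]
  ext T
  constructor
  · rintro ⟨y, h1, rfl, h3⟩
    refine ⟨⟨y, h1, ?_, rfl⟩, ?_⟩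
    · rintro rfl
      simp at h3
    · rw [mem_zeroSet]
      exact h3.ne'
  · rintro ⟨⟨y, h1, h2, rfl⟩, h3⟩
    exact ⟨y, h1, rfl, h1.pos h3⟩

/-- The Dehn–Sommerville relations, and the monotonicity of the `h`-vector under links. -/
theorem exists_hvector (hv : IsUniform v) {e : ℕ} (he : Module.finrank ℝ E = e + 2) :
    ∃ h : ℕ → ℤ, fpoly (faces v) = hpoly (e + 1) h ∧ (∀ i ≤ e + 1, h (e + 1 - i) = h i) ∧
      ∀ x, ∃ h', fpoly (link (faces v) x) = hpoly e h' ∧ ∀ i ≤ e, h' i ≤ h i := by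
  have hJ : Nonempty J := by
    have := hv.finrank_le
    exact Fintype.card_pos_iff.1 (by omega)
  have he' : Module.finrank ℝ E - 1 = e + 1 := by omega
  set c : E := ∑ j, (1 : ℝ) • v j
  have hc : ∀ y : E →L[ℝ] ℝ, Nonneg v y → y ≠ 0 → 0 < y c :=
    fun y hy h0 => hv.pos_of_ne_zero hy h0 fun _ => one_pos
  have hc' : ∀ y : E →L[ℝ] ℝ, Nonneg v y → 0 ≤ y c := fun y hy => hy.sum_nonneg (fun _ => one_pos) _
  have key : ∀ u : J, ∃ h : ℕ → ℤ, fpoly (faces v) = hpoly (e + 1) h ∧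
      (∀ i ≤ e + 1, h (e + 1 - i) = h i) ∧
      ∃ h', fpoly (link (faces v) u) = hpoly e h' ∧ ∀ i ≤ e, h' i ≤ h i := by
    intro u
    obtain ⟨w, hw, N, h1, h2, h3⟩ := hv.exists_interior hc' u
    rw [system_eq_faces hc hw, he'] at h1
    rw [system_eq_faces hw hc, he'] at h2
    refine ⟨_, h1.fpoly_eq, fun i hi => ?_, ?_⟩
    · rw [← h1.hnum_sdiff hi]
      exact hpoly_injective (h2.fpoly_eq.symm.trans h1.fpoly_eq) i hi
    · obtain ⟨h', a1, a2⟩ := h1.exists_link h3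
      exact ⟨h', a1, fun i _ => a2 i⟩
  obtain ⟨h, h1, h2, -⟩ := key hJ.some
  refine ⟨h, h1, h2, fun x => ?_⟩
  obtain ⟨k, k1, -, h', k2, k3⟩ := key x
  refine ⟨h', k2, fun i hi => (k3 i hi).trans_eq ?_⟩
  exact hpoly_injective (k1.symm.trans h1) i (by omega)

theorem empty_mem_faces (hv : IsUniform v) (h0 : 0 < Module.finrank ℝ E) : ∅ ∈ faces v := by
  obtain ⟨y, hy⟩ := hv.exists_pos
  refine ⟨y, fun j => (hy j).le, ?_, ?_⟩
  · rintro rfl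
    obtain ⟨j⟩ := Fintype.card_pos_iff.1 (h0.trans_le hv.finrank_le)
    simpa using hy j
  · ext j
    simp [mem_zeroSet, (hy j).ne']

theorem coeff_zero_fpoly {𝒯 : Set (Finset J)} (h : ∅ ∈ 𝒯) : (fpoly 𝒯).coeff 0 = 1 := by
  have : ({T | T ∈ 𝒯 ∧ T.card = 0} : Set (Finset J)) = {∅} := by
    ext T
    simp only [mem_ofPred_eq, Finset.card_eq_zero, mem_singleton_iff]
    exact ⟨fun h => h.2, fun hT => ⟨hT ▸ h, hT⟩⟩
  rw [coeff_fpoly, this]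
  simp

theorem hpoly_coeff_zero (r : ℕ) (h : ℕ → ℤ) : (hpoly r h).coeff 0 = h 0 := by
  rw [coeff_hpoly, Finset.sum_eq_single 0]
  · simp
  · intro i _ hi
    simp [hi]
  · simp

theorem link_eq_empty_of_notMem {𝒯 : Set (Finset J)} {x : J} :
    link {T ∈ 𝒯 | x ∉ T} x = ∅ := by
  ext T
  simp [mem_link]

theorem fpoly_empty : fpoly (∅ : Set (Finset J)) = 0 := by
  simp [fpoly]

/-- McMullen's inequality for the `h`-vector of the antistar of a vertex. -/
theorem exists_antistar (hv : IsUniform v) {e : ℕ} (he : Module.finrank ℝ E = e + 2) (x : J) :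
    ∃ h : ℕ → ℤ, fpoly {T ∈ faces v | x ∉ T} = hpoly (e + 1) h ∧ h 0 = 1 ∧
      ∀ i ≤ e, (i + 1) * h (i + 1) ≤ (Fintype.card J + i - (e + 2)) * h i := by
  have he' : Module.finrank ℝ E - 1 = e + 1 := by omega
  have key : ∀ u : J, ∃ h : ℕ → ℤ, fpoly {T ∈ faces v | x ∉ T} = hpoly (e + 1) h ∧
      ∃ h', fpoly (link {T ∈ faces v | x ∉ T} u) = hpoly e h' ∧ ∀ i ≤ e, h' i ≤ h i := by
    intro u
    obtain ⟨w, hw, N, h1, -, h3⟩ := hv.exists_interior (c := v x) (fun y hy => hy x) u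
    rw [system_eq_antistar hw, he'] at h1
    obtain ⟨h', a1, a2⟩ := h1.exists_link h3
    exact ⟨_, h1.fpoly_eq, h', a1, fun i _ => a2 i⟩
  obtain ⟨h, h1, -⟩ := key x
  have h0 : h 0 = 1 := by
    rw [← hpoly_coeff_zero (e + 1) h, ← h1, coeff_zero_fpoly]
    exact ⟨hv.empty_mem_faces (by omega), Finset.notMem_empty _⟩
  refine ⟨h, h1, h0, fun i hi => ?_⟩
  have := sum_link_le (congrArg _ h1) (b := fun u i => if u = x then 0 else h i) (fun u => ?_) i hi
  · rw [← Finset.sum_filter_add_sum_filter_not _ (· = x)] at this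
    simp only [Finset.filter_eq', Finset.mem_univ, if_true, Finset.sum_singleton, zero_add] at this
    rw [Finset.sum_congr rfl (fun u hu => if_neg (Finset.mem_filter.1 hu).2), Finset.sum_const,
      Finset.filter_not, Finset.filter_eq'] at this
    simp only [Finset.mem_univ, if_true, Finset.card_univ_sdiff, Finset.card_singleton,
      nsmul_eq_mul] at this
    rw [Nat.cast_sub (Fintype.card_pos_iff.2 ⟨x⟩)] at this
    push_cast at this
    linarith
  · by_cases hu : u = x
    · refine ⟨fun _ => 0, ?_, fun i _ => by simp [hu]⟩
      rw [hu, link_eq_empty_of_notMem, fpoly_empty]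
      simp [hpoly]
    · obtain ⟨k, k1, h', k2, k3⟩ := key u
      refine ⟨h', k2, fun i hi => ?_⟩
      rw [if_neg hu]
      exact (k3 i hi).trans_eq (hpoly_injective (k1.symm.trans h1) i (by omega))

theorem le_choose_of_step {n e : ℕ} (hn : e + 2 ≤ n) {h : ℕ → ℤ} (h0 : h 0 = 1)
    (hs : ∀ i ≤ e, (i + 1) * h (i + 1) ≤ (n + i - (e + 2) : ℤ) * h i) :
    ∀ i ≤ e + 1, h i ≤ ((n + i - (e + 3)).choose i : ℤ) := by
  intro i
  induction i with
  | zero => intro _; simp [h0]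
  | succ i ih =>
    intro hi
    have h1 := hs i (by omega)
    have h2 := ih (by omega)
    rcases Nat.eq_zero_or_pos (n + i - (e + 2)) with hz | hp
    · have hi0 : i = 0 := by omega
      subst hi0
      have : (n : ℤ) = e + 2 := by omega
      simp only [h0, Nat.cast_zero, this] at h1
      have : h (0 + 1) ≤ 0 := by linarith
      exact this.trans (by positivity)
    · obtain ⟨m, hm⟩ : ∃ m, n + i - (e + 2) = m + 1 := ⟨_, (Nat.succ_pred_eq_of_pos hp).symm⟩
      have hm' : (n + i - (e + 2) : ℤ) = m + 1 := by omega
      rw [show n + (i + 1) - (e + 3) = m + 1 by omega]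
      rw [show n + i - (e + 3) = m by omega] at h2
      rw [hm'] at h1
      have h3 : ((m + 1 : ℕ) : ℤ) * (m.choose i : ℤ) = ((m + 1).choose (i + 1) : ℤ) *
          (i + 1 : ℕ) := by
        exact_mod_cast Nat.add_one_mul_choose_eq m i
      push_cast at h3
      have h4 : ((m : ℤ) + 1) * h i ≤ (m + 1) * (m.choose i) :=
        mul_le_mul_of_nonneg_left h2 (by positivity)
      have h5 : ((i : ℤ) + 1) * h (i + 1) ≤ (i + 1) * ((m + 1).choose (i + 1) : ℤ) := by linarith
      exact le_of_mul_le_mul_left h5 (by positivity)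

/-- The generalized lower bound side of the upper bound theorem: `g`-vectors of simplicial
configurations. -/
theorem exists_gvector (hv : IsUniform v) {e : ℕ} (he : Module.finrank ℝ E = e + 2) :
    ∃ g : ℕ → ℤ, fpoly (faces v) = hpoly (e + 2) g ∧ g 0 = 1 ∧
      (∀ i ≤ e + 2, g (e + 2 - i) = -g i) ∧
      ∀ i ≤ e + 1, g i ≤ ((Fintype.card J + i - (e + 3)).choose i : ℤ) := by
  obtain ⟨h₀, h1', h2', h3'⟩ := hv.exists_hvector he
  set h : ℕ → ℤ := fun i => if i ≤ e + 1 then h₀ i else 0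
  have hh : ∀ i ≤ e + 1, h i = h₀ i := fun i hi => if_pos hi
  have h1 : fpoly (faces v) = hpoly (e + 1) h := by
    rw [h1']
    exact hpoly_congr fun i hi => (hh i hi).symm
  have hlast : h (e + 2) = 0 := if_neg (by omega)
  have h00 : h 0 = 1 := by
    rw [← hpoly_coeff_zero (e + 1) h, ← h1, coeff_zero_fpoly (hv.empty_mem_faces (by omega))]
  have hsymm : ∀ i ≤ e + 1, h (e + 1 - i) = h i := fun i hi => by
    rw [hh i hi, hh _ (by omega), h2' i hi]
  refine ⟨fun i => h i - if i = 0 then 0 else h (i - 1), ?_, by simp [h00], fun i hi => ?_,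
    fun i hi => ?_⟩
  · rw [h1]
    exact hpoly_succ hlast
  · rcases Nat.eq_zero_or_pos i with rfl | hi0
    · have := hsymm 0 (by omega)
      simp only [Nat.sub_zero] at this
      simp [hlast, this]
    · rcases eq_or_lt_of_le hi with rfl | hlt
      · have := hsymm 0 (by omega)
        simp only [Nat.sub_zero] at this
        simp [hlast, this]
      · have a1 := hsymm i (by omega)
        have a2 := hsymm (i - 1) (by omega)
        rw [show e + 1 - (i - 1) = e + 2 - i by omega] at a2
        simp only
        rw [if_neg (by omega), if_neg hi0.ne', show e + 2 - i - 1 = e + 1 - i by omega, a1, a2]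
        ring
  · have hJ : Nonempty J := by
      have := hv.finrank_le
      exact Fintype.card_pos_iff.1 (by omega)
    obtain ⟨x⟩ := hJ
    obtain ⟨b, b1, b2, b3⟩ := hv.exists_antistar he x
    refine le_trans ?_ (le_choose_of_step (he ▸ hv.finrank_le) b2 b3 i hi)
    obtain ⟨h', k1, k2⟩ := h3' x
    have k3 := fpoly_eq_notMem_add (faces v) x
    rw [h1, b1, k1, X_mul_hpoly, ← hpoly_add] at k3
    have k4 := hpoly_injective k3 i hi
    simp only at k4 ⊢
    rw [k4]
    split_ifs with hi0
    · simp
    · have := k2 (i - 1) (by omega)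
      rw [← hh _ (by omega)] at this
      linarith

end IsUniform
end Uniform

section Cayley
open Polynomial
variable {E : Type*} [NormedAddCommGroup E] [NormedSpace ℝ E] [FiniteDimensional ℝ E]
variable {J : Type*} [Fintype J] [DecidableEq J]

/-- A configuration in Cayley position: it lies in two hyperplanes, and it is simplicial apart from
the two corresponding facets. -/
structure IsCayley (v : J → E) (A B : Finset J) : Prop where
  disjoint : Disjoint A B
  union : A ∪ B = Finset.univ
  left : ∃ y : E →L[ℝ] ℝ, Nonneg v y ∧ zeroSet v y = A
  right : ∃ y : E →L[ℝ] ℝ, Nonneg v y ∧ zeroSet v y = B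
  left_nonempty : A.Nonempty
  right_nonempty : B.Nonempty
  finrank_left : Module.finrank ℝ (Submodule.span ℝ (v '' (A : Set J))) + 1 = Module.finrank ℝ E
  finrank_right : Module.finrank ℝ (Submodule.span ℝ (v '' (B : Set J))) + 1 = Module.finrank ℝ E
  indep : ∀ y : E →L[ℝ] ℝ, Nonneg v y → ¬ A ⊆ zeroSet v y → ¬ B ⊆ zeroSet v y →
    LinearIndepOn ℝ v (zeroSet v y : Set J)

/-- The faces of a configuration that meet both `A` and `B`. -/
def mixed (v : J → E) (A B : Finset J) : Set (Finset J) :=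
  {T | ∃ y : E →L[ℝ] ℝ, Nonneg v y ∧ y ≠ 0 ∧ zeroSet v y = T ∧ (T ∩ A).Nonempty ∧ (T ∩ B).Nonempty}

/-- The faces of the subconfiguration indexed by `A`. -/
def facesOn (v : J → E) (A : Finset J) : Set (Finset J) :=
  {T | ∃ y : E →L[ℝ] ℝ, (∀ j ∈ A, 0 ≤ y (v j)) ∧ (∃ j ∈ A, y (v j) ≠ 0) ∧ zeroSet v y ∩ A = T}

/-- The vector `c` is in the relative interior of the cone spanned by the vectors indexed
by `A`. -/
def IsRelInt (v : J → E) (A : Finset J) (c : E) : Prop :=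
  ∀ y : E →L[ℝ] ℝ, Nonneg v y → 0 ≤ y c ∧ (y c = 0 ↔ A ⊆ zeroSet v y)

theorem IsRelInt.pos_iff {v : J → E} {A : Finset J} {c : E} (hc : IsRelInt v A c) {y : E →L[ℝ] ℝ}
    (hy : Nonneg v y) : 0 < y c ↔ ¬ A ⊆ zeroSet v y := by
  rw [← (hc y hy).2, lt_iff_le_and_ne, and_iff_right (hc y hy).1, ne_comm]

theorem mixed_comm (v : J → E) (A B : Finset J) : mixed v A B = mixed v B A := by
  ext T
  constructor <;> rintro ⟨y, h1, h2, h3, h4, h5⟩ <;> exact ⟨y, h1, h2, h3, h5, h4⟩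

namespace IsCayley
variable {v : J → E} {A B : Finset J}

theorem symm (h : IsCayley v A B) : IsCayley v B A where
  disjoint := h.disjoint.symm
  union := by rw [Finset.union_comm, h.union]
  left := h.right
  right := h.left
  left_nonempty := h.right_nonempty
  right_nonempty := h.left_nonempty
  finrank_left := h.finrank_right
  finrank_right := h.finrank_left
  indep := fun y h1 h2 h3 => h.indep y h1 h3 h2

theorem eq_zero (h : IsCayley v A B) {y : E →L[ℝ] ℝ} (hy : A ⊆ zeroSet v y) {j : J} (hj : j ∈ B)
    (hyj : j ∈ zeroSet v y) : y = 0 := by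
  obtain ⟨yA, -, hyA⟩ := h.left
  by_contra h0
  have hlt : Submodule.span ℝ (v '' (A : Set J)) < ⊤ := by
    refine lt_top_iff_ne_top.2 fun htop => ?_
    have := h.finrank_left
    rw [htop, finrank_top] at this
    omega
  have hle : Submodule.span ℝ (v '' (A : Set J)) ≤ LinearMap.ker (y : E →ₗ[ℝ] ℝ) := by
    rw [Submodule.span_le]
    rintro _ ⟨j, hj, rfl⟩
    simpa [mem_zeroSet] using hy hj
  have hker : LinearMap.ker (y : E →ₗ[ℝ] ℝ) < ⊤ := by
    refine lt_top_iff_ne_top.2 fun htop => h0 ?_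
    ext x
    have : x ∈ LinearMap.ker (y : E →ₗ[ℝ] ℝ) := htop ▸ Submodule.mem_top
    simpa using this
  have hfr := Submodule.finrank_lt hker.ne
  have hfin := h.finrank_left
  have heq := Submodule.eq_of_le_of_finrank_le hle (by omega)
  have hjm : v j ∈ Submodule.span ℝ (v '' (A : Set J)) := by
    rw [heq]
    simpa using mem_zeroSet.1 hyj
  have := apply_eq_zero_of_mem_span hyA.ge hjm
  rw [← mem_zeroSet, hyA] at this
  exact Finset.disjoint_left.1 h.disjoint this hj

theorem exists_notMem_span (h : IsCayley v A B) {S : Finset J} {c : E} (hc : IsRelInt v B c)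
    (hS : S.card + 1 < Module.finrank ℝ E) :
    ∃ j ∈ A, v j ∉ Submodule.span ℝ (insert c (v '' (S : Set J))) := by
  by_contra! hcon
  obtain ⟨yA, hA, hyA⟩ := h.left
  have hle : Submodule.span ℝ (v '' (A : Set J)) ≤
      Submodule.span ℝ (insert c (v '' (S : Set J))) := by
    rw [Submodule.span_le]
    rintro _ ⟨j, hj, rfl⟩
    exact hcon j hj
  have h1 := finrank_span_insert_le v c S
  have h2 := h.finrank_left
  have heq := Submodule.eq_of_le_of_finrank_le hle (by omega)
  have hcm : c ∈ Submodule.span ℝ (v '' (A : Set J)) := by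
    rw [heq]
    exact Submodule.subset_span (mem_insert _ _)
  have h3 := apply_eq_zero_of_mem_span hyA.ge hcm
  rw [(hc yA hA).2, hyA] at h3
  obtain ⟨j, hj⟩ := h.right_nonempty
  exact Finset.disjoint_left.1 h.disjoint (h3 hj) hj

theorem system_eq (h : IsCayley v A B) {c w : E} (hc : IsRelInt v B c) (hw : IsRelInt v A w) :
    system v c w = mixed v A B ∪ facesOn v B \ {∅} := by
  obtain ⟨yA, hA, hyA⟩ := h.left
  obtain ⟨yB, hB, hyB⟩ := h.right
  obtain ⟨jB, hjB⟩ := h.right_nonempty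
  have second : ∀ T : Finset J, (∀ y : E →L[ℝ] ℝ, Nonneg v y → T ⊆ zeroSet v y → y ≠ 0 → 0 < y w) ↔
      (T ∩ B).Nonempty := by
    intro T
    constructor
    · intro hT
      by_contra hemp
      rw [Finset.not_nonempty_iff_eq_empty, ← Finset.disjoint_iff_inter_eq_empty] at hemp
      have h1 : T ⊆ A := fun j hj => by
        have : j ∈ A ∪ B := h.union ▸ Finset.mem_univ j
        exact (Finset.mem_union.1 this).resolve_right (Finset.disjoint_left.1 hemp hj)
      have := hT yA hA (hyA.symm ▸ h1) ?_
      · rw [hw.pos_iff hA] at this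
        exact this hyA.ge
      · rintro rfl
        have : jB ∈ A := by
          rw [← hyA]
          simp [mem_zeroSet]
        exact Finset.disjoint_left.1 h.disjoint this hjB
    · rintro ⟨j, hj⟩ y hy hT h0
      rw [Finset.mem_inter] at hj
      rw [hw.pos_iff hy]
      exact fun hAy => h0 (h.eq_zero hAy hj.2 (hT hj.1))
  ext T
  constructor
  · rintro ⟨⟨y, hy, rfl, hyc⟩, h2⟩
    rw [second] at h2
    rw [hc.pos_iff hy] at hyc
    by_cases hTA : (zeroSet v y ∩ A).Nonempty
    · refine Or.inl ⟨y, hy, ?_, rfl, hTA, h2⟩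
      rintro rfl
      exact hyc fun j _ => by simp [mem_zeroSet]
    · right
      rw [Finset.not_nonempty_iff_eq_empty, ← Finset.disjoint_iff_inter_eq_empty] at hTA
      refine ⟨⟨y, fun j _ => hy j, ?_, ?_⟩, ?_⟩
      · obtain ⟨j, hj, hj'⟩ := Finset.not_subset.1 hyc
        exact ⟨j, hj, fun h => hj' (mem_zeroSet.2 h)⟩
      · rw [Finset.inter_eq_left]
        intro j hj
        have : j ∈ A ∪ B := h.union ▸ Finset.mem_univ j
        exact (Finset.mem_union.1 this).resolve_left (Finset.disjoint_left.1 hTA hj)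
      · rintro h
        rw [mem_singleton_iff] at h
        simp [h] at h2
  · rintro (⟨y, hy, h0, rfl, h1, h2⟩ | ⟨⟨y, hy, ⟨j, hj, hj'⟩, rfl⟩, hT⟩)
    · refine ⟨⟨y, hy, rfl, ?_⟩, (second _).2 h2⟩
      rw [hc.pos_iff hy]
      intro hBy
      obtain ⟨j, hj⟩ := h1
      rw [Finset.mem_inter] at hj
      exact h0 (h.symm.eq_zero hBy hj.2 hj.1)
    · have hposA : ∀ j ∈ A, 0 < yB (v j) := fun j hj =>
        hB.pos fun h' => Finset.disjoint_left.1 h.disjoint hj (hyB ▸ h')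
      have hzB : ∀ j ∈ B, yB (v j) = 0 := fun j hj => mem_zeroSet.1 (hyB.symm ▸ hj)
      obtain ⟨γ, hγ⟩ : ∃ γ : ℝ, ∀ j ∈ A, 0 < y (v j) + γ * yB (v j) := by
        obtain ⟨γ, hγ⟩ := (A.image fun j => (1 - y (v j)) / yB (v j)).exists_le
        refine ⟨γ, fun j hj => ?_⟩
        have := hγ _ (Finset.mem_image_of_mem _ hj)
        rw [div_le_iff₀ (hposA j hj)] at this
        linarith
      have hval : ∀ j ∈ B, (y + γ • yB) (v j) = y (v j) := fun j hj => by simp [hzB j hj]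
      have hvalA : ∀ j ∈ A, 0 < (y + γ • yB) (v j) := fun j hj => by simpa using hγ j hj
      have hny : Nonneg v (y + γ • yB) := by
        intro j
        have : j ∈ A ∪ B := h.union ▸ Finset.mem_univ j
        rcases Finset.mem_union.1 this with hj | hj
        · exact (hvalA j hj).le
        · rw [hval j hj]
          exact hy j hj
      have hz : zeroSet v (y + γ • yB) = zeroSet v y ∩ B := by
        ext j
        rw [Finset.mem_inter, mem_zeroSet, mem_zeroSet]
        have : j ∈ A ∪ B := h.union ▸ Finset.mem_univ j
        rcases Finset.mem_union.1 this with hj | hj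
        · exact ⟨fun h' => absurd h' (hvalA j hj).ne', fun h' =>
            absurd h'.2 (Finset.disjoint_left.1 h.disjoint hj)⟩
        · rw [hval j hj, and_iff_left hj]
      refine ⟨⟨_, hny, hz, ?_⟩, ?_⟩
      · rw [hc.pos_iff hny, hz]
        exact fun h' => hj' (mem_zeroSet.1 (Finset.mem_inter.1 (h' hj)).1)
      · rw [second, Finset.inter_assoc, Finset.inter_self]
        exact Finset.nonempty_iff_ne_empty.2 hT

theorem isRelInt_sum {t : J → ℝ} (ht : ∀ j, 0 < t j) (A : Finset J) :
    IsRelInt v A (∑ j ∈ A, t j • v j) :=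
  fun _ hy => ⟨hy.sum_nonneg ht A, hy.sum_eq_zero_iff ht A⟩

theorem isRelInt_add_sum {t : J → ℝ} (ht : ∀ j, 0 < t j) {A : Finset J} {u : J} (hu : u ∈ A) :
    IsRelInt v A (v u + ∑ j ∈ A, t j • v j) := by
  intro y hy
  rw [map_add]
  refine ⟨add_nonneg (hy u) (hy.sum_nonneg ht A), ?_⟩
  rw [add_eq_zero_iff_of_nonneg (hy u) (hy.sum_nonneg ht A), hy.sum_eq_zero_iff ht A]
  exact ⟨fun h => h.2, fun h => ⟨mem_zeroSet.1 (h hu), h⟩⟩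

theorem exists_isPartition (h : IsCayley v A B) {u : J} (hu : u ∈ A) :
    ∃ (𝒮 : Finset (Finset J)) (N : Finset J → Finset J),
      IsPartition (mixed v A B ∪ facesOn v B \ {∅}) 𝒮 N (Module.finrank ℝ E - 1) ∧
      IsPartition (mixed v A B ∪ facesOn v A \ {∅}) 𝒮 (fun S => S \ N S)
        (Module.finrank ℝ E - 1) ∧ ∀ S ∈ 𝒮, u ∈ S → u ∉ N S := by
  have hc : IsRelInt v B (∑ j ∈ B, (1 : ℝ) • v j) := isRelInt_sum (fun _ => one_pos) B
  set c := ∑ j ∈ B, (1 : ℝ) • v j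
  obtain ⟨t, ht, h1, h2⟩ := exists_generic v c (v u) A fun y _ _ hcard =>
    h.exists_notMem_span hc hcard
  have hw := isRelInt_add_sum (v := v) ht hu
  have hg : IsGeneric v c (v u + ∑ j ∈ A, t j • v j) :=
    { indep := fun y hy hyc hyw => h.indep y hy ((hw.pos_iff hy).1 hyw) ((hc.pos_iff hy).1 hyc)
      notMem := fun y hy hc _ hcard => h1 y hy hc hcard
      left_nonneg := fun y hy => (hc y hy).1
      right_nonneg := fun y hy => (hw y hy).1
      eq_zero := fun y hy a b => by
        obtain ⟨j, hj⟩ := h.right_nonempty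
        exact h.eq_zero (((hw y hy).2).1 b) hj (((hc y hy).2).1 a hj) }
  obtain ⟨N, hN, hN', hN''⟩ := hg.exists_isPartition
  rw [h.system_eq hc hw] at hN
  rw [h.symm.system_eq hw hc, mixed_comm] at hN'
  refine ⟨_, N, hN, hN', fun S hS hu => ?_⟩
  obtain ⟨-, y, hy, rfl, hyc, hyw⟩ := mem_facets.1 hS
  obtain ⟨φ, a1, a2, a3, a4⟩ := h2 y hyc (hg.indep y hy hyc hyw) u hu rfl
  exact hN'' _ hS u hu φ a1 a2 a3 a4.le

theorem link_union_facesOn (h : IsCayley v A B) {u : J} (hu : u ∈ A) :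
    link (mixed v A B ∪ facesOn v B \ {∅}) u = link (mixed v A B) u := by
  ext T
  rw [mem_link, mem_link, mem_union, or_iff_left]
  rintro ⟨⟨y, -, -, h1⟩, -⟩
  have : u ∈ zeroSet v y ∩ B := h1 ▸ Finset.mem_insert_self _ _
  exact Finset.disjoint_left.1 h.disjoint hu (Finset.mem_inter.1 this).2

theorem fpoly_union_facesOn (h : IsCayley v A B) (h0 : ∅ ∈ facesOn v B) :
    fpoly (mixed v A B ∪ facesOn v B \ {∅}) = fpoly (mixed v A B) - 1 + fpoly (facesOn v B) := by
  rw [fpoly_union]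
  · have h1 : fpoly (facesOn v B) = fpoly (facesOn v B \ {∅}) +
        fpoly ({∅} : Set (Finset J)) := by
      rw [← fpoly_union Set.disjoint_sdiff_left, Set.sdiff_union_of_subset (by simpa using h0)]
    have h2 : fpoly ({∅} : Set (Finset J)) = 1 := by
      rw [fpoly, Finset.sum_eq_single_of_mem ∅ (by simp) (fun T hT h => by simp_all)]
      simp
    rw [h1, h2]
    ring
  · refine Set.disjoint_left.2 ?_
    rintro _ ⟨y, -, -, rfl, h1, -⟩ ⟨⟨y', -, -, h2⟩, -⟩
    obtain ⟨j, hj⟩ := h1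
    rw [Finset.mem_inter, ← h2, Finset.mem_inter] at hj
    exact Finset.disjoint_left.1 h.disjoint hj.2 hj.1.2

/-- The Dehn–Sommerville-like equations and the recurrence for the `h`-vector of the mixed faces
of a Cayley configuration. -/
theorem exists_hvector (h : IsCayley v A B) {e : ℕ} (he : Module.finrank ℝ E = e + 3)
    {gA gB : ℕ → ℤ} (hA : fpoly (facesOn v A) = hpoly (e + 2) gA)
    (hB : fpoly (facesOn v B) = hpoly (e + 2) gB)
    (hA0 : ∅ ∈ facesOn v A) (hB0 : ∅ ∈ facesOn v B)
    (hgA : ∀ i ≤ e + 2, gA (e + 2 - i) = -gA i) :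
    ∃ H : ℕ → ℤ, fpoly (mixed v A B) - 1 = hpoly (e + 2) H ∧ H 0 = -1 ∧
      (∀ i ≤ e + 2, H (e + 2 - i) = H i + gA i + gB i) ∧
      ∀ i ≤ e + 1, (i + 1) * H (i + 1) + (e + 2 - i) * H i ≤
        A.card * (H i + gB i) + B.card * (H i + gA i) := by
  have he' : Module.finrank ℝ E - 1 = e + 2 := by omega
  have main : ∀ {A B : Finset J} {gA gB : ℕ → ℤ}, IsCayley v A B →
      fpoly (facesOn v A) = hpoly (e + 2) gA → fpoly (facesOn v B) = hpoly (e + 2) gB →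
      ∅ ∈ facesOn v A → ∅ ∈ facesOn v B → ∀ u ∈ A, ∃ H : ℕ → ℤ,
        fpoly (mixed v A B) - 1 = hpoly (e + 2) H ∧
        (∀ i ≤ e + 2, H (e + 2 - i) + gA (e + 2 - i) = H i + gB i) ∧
        ∃ h', fpoly (link (mixed v A B) u) = hpoly (e + 1) h' ∧ ∀ i ≤ e + 1, h' i ≤ H i + gB i := by
    intro A B gA gB h hA hB hA0 hB0 u hu
    obtain ⟨𝒮, N, h1, h2, h3⟩ := h.exists_isPartition hu
    rw [he'] at h1 h2
    have e1 := h1.fpoly_eq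
    have e2 := h2.fpoly_eq
    rw [h.fpoly_union_facesOn hB0, hB] at e1
    rw [mixed_comm, h.symm.fpoly_union_facesOn hA0, mixed_comm, hA] at e2
    have e3 : fpoly (mixed v A B) - 1 = hpoly (e + 2) (fun i => hnum 𝒮 N i - gB i) := by
      rw [hpoly_sub, ← e1]
      ring
    refine ⟨_, e3, fun i hi => ?_, ?_⟩
    · rw [e3, ← hpoly_add] at e2
      have := hpoly_injective e2 (e + 2 - i) (by omega)
      rw [this, h1.hnum_sdiff (by omega), Nat.sub_sub_self hi]
      ring
    · obtain ⟨h', a1, a2⟩ := h1.exists_link h3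
      rw [h.link_union_facesOn hu] at a1
      exact ⟨h', a1, fun i _ => by linarith [a2 i]⟩
  obtain ⟨u₀, hu₀⟩ := h.left_nonempty
  obtain ⟨H, H1, H2, -⟩ := main h hA hB hA0 hB0 u₀ hu₀
  refine ⟨H, H1, ?_, fun i hi => ?_, ?_⟩
  · rw [← IsUniform.hpoly_coeff_zero (e + 2) H, ← H1, coeff_sub, coeff_fpoly]
    have : ({T | T ∈ mixed v A B ∧ T.card = 0} : Set (Finset J)) = ∅ := by
      rw [Set.eq_empty_iff_forall_notMem]
      rintro T ⟨⟨y, -, -, -, ⟨j, hj⟩, -⟩, h0⟩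
      rw [Finset.card_eq_zero.1 h0] at hj
      simp at hj
    rw [this]
    simp
  · have := H2 i hi
    rw [hgA i hi] at this
    linarith
  · intro i hi
    have hd : derivative (fpoly (mixed v A B)) = derivative (hpoly (e + 1 + 1) H) := by
      rw [← H1]
      simp
    have := sum_link_le hd (b := fun u i => if u ∈ A then H i + gB i else H i + gA i)
      (fun u => ?_) i hi
    · rw [Finset.sum_ite, Finset.sum_const, Finset.sum_const] at this
      have f1 : Finset.univ.filter (· ∈ A) = A := by ext; simp
      have f2 : Finset.univ.filter (· ∉ A) = B := by
        rw [Finset.filter_not, f1, ← h.union, Finset.union_sdiff_cancel_left h.disjoint]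
      rw [f1, f2] at this
      simp only [nsmul_eq_mul] at this
      push_cast at this
      convert this using 2
      ring
    · by_cases hu : u ∈ A
      · obtain ⟨H', a1, -, h', a2, a3⟩ := main h hA hB hA0 hB0 u hu
        refine ⟨h', a2, fun i hi => (a3 i hi).trans_eq ?_⟩
        rw [if_pos hu, hpoly_injective (a1.symm.trans H1) i (by omega)]
      · have hu' : u ∈ B := by
          have : u ∈ A ∪ B := h.union ▸ Finset.mem_univ u
          exact (Finset.mem_union.1 this).resolve_left hu
        obtain ⟨H', a1, -, h', a2, a3⟩ := main h.symm hB hA hB0 hA0 u hu'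
        rw [mixed_comm] at a1 a2
        refine ⟨h', a2, fun i hi => (a3 i hi).trans_eq ?_⟩
        rw [if_neg hu, hpoly_injective (a1.symm.trans H1) i (by omega)]

end IsCayley
end Cayley

section Arithmetic

theorem succ_mul_ubTerm {n d : ℕ} (h : d + 1 ≤ n) (i : ℕ) :
    ((i : ℤ) + 1) * ubTerm n d (i + 1) = (n - (d + 1) + i) * ubTerm n d i := by
  unfold ubTerm
  rcases Nat.lt_or_ge (n + i) (d + 2) with h1 | h1
  · obtain rfl : i = 0 := by omega
    obtain rfl : n = d + 1 := by omega
    simp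
  · obtain ⟨m, hm⟩ := Nat.exists_eq_add_of_le h1
    have h2 : n + (i + 1) - (d + 2) = m + 1 := by omega
    have h3 : n + i - (d + 2) = m := by omega
    have h4 : (n : ℤ) - (d + 1) + i = m + 1 := by
      have : (n : ℤ) + i = d + 2 + m := by exact_mod_cast hm
      linarith
    rw [h2, h3, h4]
    have := Nat.add_one_mul_choose_eq m i
    rw [mul_comm]
    exact_mod_cast this.symm

theorem le_of_recurrence {d n₁ n₂ : ℕ} (hn₁ : d + 1 ≤ n₁) (hn₂ : d + 1 ≤ n₂) {gA gB H : ℕ → ℤ}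
    (h0 : H 0 = -1) (hA : ∀ i ≤ d, gA i ≤ ubTerm n₁ d i) (hB : ∀ i ≤ d, gB i ≤ ubTerm n₂ d i)
    (hrec : ∀ i ≤ d, ((i : ℤ) + 1) * H (i + 1) + (d + 1 - i) * H i ≤
      n₁ * (H i + gB i) + n₂ * (H i + gA i)) :
    ∀ i ≤ d + 1, H i ≤ ubTerm (n₁ + n₂) d i - ubTerm n₁ d i - ubTerm n₂ d i := by
  intro i
  induction i with
  | zero => simp [h0, ubTerm]
  | succ i ih =>
    intro hi
    have ih := ih (by omega)
    have r := hrec i (by omega)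
    have a := hA i (by omega)
    have b := hB i (by omega)
    have e1 := succ_mul_ubTerm hn₁ i
    have e2 := succ_mul_ubTerm hn₂ i
    have e3 := succ_mul_ubTerm (n := n₁ + n₂) (d := d) (by omega) i
    push_cast at e3
    refine le_of_mul_le_mul_left ?_ (show (0 : ℤ) < i + 1 by positivity)
    have hN : (0 : ℤ) ≤ (n₁ : ℤ) + n₂ - (d + 1) + i := by
      have : (d : ℤ) + 1 ≤ n₁ := by exact_mod_cast hn₁
      have : (0 : ℤ) ≤ n₂ := by positivity
      linarith
    have f1 := mul_le_mul_of_nonneg_left ih hN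
    have f2 := mul_le_mul_of_nonneg_left b (show (0 : ℤ) ≤ n₁ by positivity)
    have f3 := mul_le_mul_of_nonneg_left a (show (0 : ℤ) ≤ n₂ by positivity)
    rw [mul_sub, mul_sub, e1, e2, e3]
    linarith

theorem coeff_hpoly_le {d n₁ n₂ : ℕ} (hn₁ : d + 1 ≤ n₁) (hn₂ : d + 1 ≤ n₂) {gA gB H C : ℕ → ℤ}
    (h0 : H 0 = -1) (hA : ∀ i ≤ d, gA i ≤ ubTerm n₁ d i) (hB : ∀ i ≤ d, gB i ≤ ubTerm n₂ d i)
    (hrec : ∀ i ≤ d, ((i : ℤ) + 1) * H (i + 1) + (d + 1 - i) * H i ≤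
      n₁ * (H i + gB i) + n₂ * (H i + gA i))
    (hsymm : ∀ i ≤ d + 1, H (d + 1 - i) = H i + gA i + gB i)
    (hC : ∀ i ≤ (d + 1) / 2, C i = ubTerm (n₁ + n₂) d i)
    (hCsymm : ∀ i ≤ d + 1, C (d + 1 - i) = C i) (k : ℕ) :
    (hpoly (d + 1) H).coeff (k + 1) ≤ (hpoly (d + 1) C).coeff (k + 1) -
      ∑ i ∈ Finset.range ((d + 1) / 2 + 1),
        (if i ≤ k + 1 then ((d + 1 - i).choose (k + 1 - i) : ℤ) else 0) *
          ((ubTerm n₁ d i : ℤ) + (ubTerm n₂ d i : ℤ)) := by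
  have main := le_of_recurrence hn₁ hn₂ h0 hA hB hrec
  rw [coeff_hpoly, coeff_hpoly]
  have hsub : Finset.range ((d + 1) / 2 + 1) ⊆ Finset.range (d + 1 + 1) := by
    intro i hi
    rw [Finset.mem_range] at *
    omega
  rw [← Finset.sum_sdiff hsub, ← Finset.sum_sdiff hsub, add_sub_assoc, ← Finset.sum_sub_distrib]
  have hw : ∀ i, (0 : ℤ) ≤ if i ≤ k + 1 then ((d + 1 - i).choose (k + 1 - i) : ℤ) else 0 := by
    intro i
    split_ifs <;> positivity
  refine add_le_add (Finset.sum_le_sum fun i hi => mul_le_mul_of_nonneg_left ?_ (hw i))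
    (Finset.sum_le_sum fun i hi => ?_)
  · rw [Finset.mem_sdiff, Finset.mem_range, Finset.mem_range] at hi
    have h1 := hsymm (d + 1 - i) (by omega)
    have h2 := hCsymm (d + 1 - i) (by omega)
    rw [Nat.sub_sub_self (by omega)] at h1 h2
    rw [h1, h2, hC _ (by omega)]
    linarith [main (d + 1 - i) (by omega), hA (d + 1 - i) (by omega), hB (d + 1 - i) (by omega)]
  · rw [Finset.mem_range] at hi
    rw [← mul_sub, hC i (by omega)]
    exact mul_le_mul_of_nonneg_left (by linarith [main i (by omega)]) (hw i)

end Arithmetic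

section Faces

theorem sep_convexHull_eq {V : Type*} [AddCommGroup V] [Module ℝ V] [TopologicalSpace V]
    {J : Type*} {p : J → V} {l : V →L[ℝ] ℝ} {c : ℝ} (h : ∀ j, l (p j) ≤ c) :
    {x ∈ convexHull ℝ (range p) | l x = c} = convexHull ℝ (p '' {j | l (p j) = c}) := by
  have hconv : Convex ℝ ({x | l x < c} ∪ convexHull ℝ (p '' {j | l (p j) = c})) := by
    have hle : ∀ x ∈ {x | l x < c} ∪ convexHull ℝ (p '' {j | l (p j) = c}), l x ≤ c := by
      rintro x (hx | hx)
      · exact le_of_lt hx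
      · refine convexHull_min (t := {x | l x ≤ c}) ?_ (convex_halfSpace_le l.isLinear c) hx
        rintro _ ⟨j, -, rfl⟩
        exact h j
    refine convex_iff_forall_pos.2 fun x hx y hy a b ha hb hab => ?_
    have hlt : l x < c ∨ l y < c → l (a • x + b • y) < c := by
      intro h'
      have hc : c = a * c + b * c := by rw [← add_mul, hab, one_mul]
      rw [map_add, map_smul, map_smul, smul_eq_mul, smul_eq_mul, hc]
      rcases h' with h' | h'
      · exact add_lt_add_of_lt_of_le (mul_lt_mul_of_pos_left h' ha)
          (mul_le_mul_of_nonneg_left (hle y hy) hb.le)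
      · exact add_lt_add_of_le_of_lt (mul_le_mul_of_nonneg_left (hle x hx) ha.le)
          (mul_lt_mul_of_pos_left h' hb)
    rcases hx with hx | hx
    · exact Or.inl (hlt (Or.inl hx))
    rcases hy with hy | hy
    · exact Or.inl (hlt (Or.inr hy))
    exact Or.inr (convex_convexHull ℝ _ hx hy ha.le hb.le hab)
  refine Subset.antisymm ?_ (subset_inter (convexHull_mono (image_subset_range _ _)) ?_)
  · rintro x ⟨hx, hxc⟩
    have hx' : x ∈ {x | l x < c} ∪ convexHull ℝ (p '' {j | l (p j) = c}) := by
      refine convexHull_min ?_ hconv hx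
      rintro _ ⟨j, rfl⟩
      rcases (h j).lt_or_eq with h1 | h1
      · exact Or.inl h1
      · exact Or.inr (subset_convexHull ℝ _ ⟨j, h1, rfl⟩)
    exact hx'.resolve_left fun h => h.ne hxc
  · refine convexHull_min ?_ (convex_hyperplane l.isLinear c)
    rintro _ ⟨j, hj, rfl⟩
    exact hj

variable {d : ℕ} {J : Type*}

theorem exists_of_isExposed {p : J → Euc d} {F : Set (Euc d)}
    (hF : IsExposed ℝ (convexHull ℝ (range p)) F) (hne : F.Nonempty) :
    ∃ (l : Euc d →L[ℝ] ℝ) (c : ℝ), (∀ j, l (p j) ≤ c) ∧ (∃ j, l (p j) = c) ∧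
      F = convexHull ℝ (p '' {j | l (p j) = c}) := by
  obtain ⟨l, hl⟩ := hF hne
  obtain ⟨x, hx⟩ := hne
  have hx' := hx
  rw [hl] at hx'
  have h1 : ∀ j, l (p j) ≤ l x := fun j => hx'.2 _ (subset_convexHull ℝ _ ⟨j, rfl⟩)
  have h2 : F = convexHull ℝ (p '' {j | l (p j) = l x}) := by
    rw [← sep_convexHull_eq h1, hl]
    ext y
    refine and_congr_right fun hy => ⟨fun h => ?_, fun h z hz => h ▸ hx'.2 z hz⟩
    exact le_antisymm (hx'.2 y hy) (h x hx'.1)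
  refine ⟨l, l x, h1, ?_, h2⟩
  rw [h2] at hx
  obtain ⟨_, j, hj, -⟩ := convexHull_nonempty_iff.1 ⟨x, hx⟩
  exact ⟨j, hj⟩

theorem finite_properFace [Finite J] (p : J → Euc d) (k : ℕ) :
    {F | IsProperFaceOf (convexHull ℝ (range p)) F ∧ setDim F = k}.Finite := by
  refine (Set.finite_range fun T : Set J => convexHull ℝ (p '' T)).subset ?_
  rintro F ⟨⟨h1, -, h2⟩, -⟩
  obtain ⟨l, c, -, -, rfl⟩ := exists_of_isExposed h1 h2
  exact ⟨_, rfl⟩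

/-- The homogenization of a point configuration. -/
def homog (p : J → Euc d) (j : J) : Euc d × ℝ := (p j, 1)

theorem finrank_euc_prod : Module.finrank ℝ (Euc d × ℝ) = d + 1 := by
  simp [Module.finrank_prod]

theorem setDim_convexHull (s : Set (Euc d)) :
    setDim (convexHull ℝ s) = Module.finrank ℝ (vectorSpan ℝ s) := by
  rw [setDim, affineSpan_convexHull, direction_affineSpan]

variable [Fintype J] [DecidableEq J]

theorem affineIndependent_of_homog {p : J → Euc d} {T : Finset J}
    (h : LinearIndepOn ℝ (homog p) (T : Set J)) : AffineIndependent ℝ fun j : T => p j := by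
  refine affineIndependent_iff.2 fun s w h0 h1 => ?_
  refine linearIndependent_iff'.1 h.linearIndependent s w ?_
  ext1
  · rw [Prod.fst_sum]
    exact h1
  · rw [Prod.snd_sum]
    simpa [homog] using h0

theorem setDim_add_one_of_homog {p : J → Euc d} {T : Finset J}
    (h : LinearIndepOn ℝ (homog p) (T : Set J)) {k : ℕ} (hT : T.card = k + 1) :
    setDim (convexHull ℝ (p '' (T : Set J))) = k := by
  have := (affineIndependent_of_homog h).finrank_vectorSpan (n := k) (by simpa using hT)
  rw [setDim_convexHull, image_eq_range]
  exact this

theorem IsUniform.ncard_faces_le {p : J → Euc d} (hp : IsUniform (homog p)) (k : ℕ) :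
    {T | T ∈ faces (homog p) ∧ T.card = k + 1}.ncard ≤ faceCount (convexHull ℝ (range p)) k := by
  have key : ∀ T ∈ faces (homog p), ∃ (l : Euc d →L[ℝ] ℝ) (c : ℝ), (∀ j, l (p j) ≤ c) ∧
      (∃ j, j ∉ T) ∧ convexHull ℝ (p '' (T : Set J)) = {x ∈ convexHull ℝ (range p) | l x = c} ∧
        ∀ j, j ∈ T ↔ l (p j) = c := by
    rintro T ⟨y, hy, hy0, rfl⟩
    have hyv : ∀ x : Euc d, y (x, 1) = y (0, 1) - (-(y.comp (.inl ℝ (Euc d) ℝ))) x := by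
      intro x
      simp [← map_add]
    have h1 : ∀ j, (-(y.comp (.inl ℝ (Euc d) ℝ))) (p j) ≤ y (0, 1) := by
      intro j
      have := hy j
      rw [homog, hyv] at this
      linarith
    have h2 : ∀ j, j ∈ zeroSet (homog p) y ↔ (-(y.comp (.inl ℝ (Euc d) ℝ))) (p j) = y (0, 1) := by
      intro j
      rw [mem_zeroSet, homog, hyv, sub_eq_zero, eq_comm]
    refine ⟨_, _, h1, ?_, ?_, h2⟩
    · by_contra! h
      have a1 := hp.card_zeroSet hy0
      have a2 := hp.finrank_le
      rw [Finset.eq_univ_iff_forall.2 h, Finset.card_univ] at a1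
      omega
    · rw [sep_convexHull_eq h1]
      congr 2
      ext j
      exact h2 j
  refine Set.ncard_le_ncard_of_injOn (fun T : Finset J => convexHull ℝ (p '' (T : Set J))) ?_ ?_
    (finite_properFace p k)
  · rintro T ⟨hT, hcard⟩
    obtain ⟨l, c, h1, ⟨j, hj⟩, h3, h4⟩ := key T hT
    have hne : T.Nonempty := Finset.card_pos.1 (by omega)
    have hne' : (convexHull ℝ (p '' (T : Set J))).Nonempty :=
      (hne.to_set.image _).convexHull
    refine ⟨⟨fun _ => ⟨l, ?_⟩, ?_, hne'⟩, ?_⟩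
    · have hle : ∀ x ∈ convexHull ℝ (range p), l x ≤ c := by
        intro x hx
        refine convexHull_min (t := {x | l x ≤ c}) ?_ (convex_halfSpace_le l.isLinear c) hx
        rintro _ ⟨j, rfl⟩
        exact h1 j
      obtain ⟨j', hj'⟩ := hne
      rw [h3]
      ext x
      refine and_congr_right fun hx => ⟨fun h z hz => h ▸ hle z hz, fun h => ?_⟩
      exact le_antisymm (hle x hx)
        (((h4 j').1 hj').symm.le.trans (h _ (subset_convexHull ℝ _ ⟨j', rfl⟩)))
    · intro h
      have : p j ∈ convexHull ℝ (p '' (T : Set J)) := h ▸ subset_convexHull ℝ _ ⟨j, rfl⟩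
      rw [h3] at this
      exact hj ((h4 j).2 this.2)
    · obtain ⟨y, hy, hy0, rfl⟩ := hT
      exact setDim_add_one_of_homog (hp.indep_zeroSet hy0) hcard
  · rintro T ⟨hT, -⟩ T' ⟨hT', -⟩ h
    dsimp only at h
    have key' : ∀ T ∈ faces (homog p), ∀ j, j ∈ T ↔ p j ∈ convexHull ℝ (p '' (T : Set J)) := by
      intro T hT j
      obtain ⟨l, c, h1, -, h3, h4⟩ := key T hT
      rw [h3, h4]
      exact ⟨fun h => ⟨subset_convexHull ℝ _ ⟨j, rfl⟩, h⟩, fun h => h.2⟩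
    ext j
    rw [key' T hT, key' T' hT', h]

end Faces

theorem linearIndepOn_of_dual {E ι : Type*} [NormedAddCommGroup E] [NormedSpace ℝ E] {v : ι → E}
    {S : Finset ι} (h : ∀ i ∈ S, ∃ y : E →L[ℝ] ℝ, y (v i) ≠ 0 ∧ ∀ j ∈ S, j ≠ i → y (v j) = 0) :
    LinearIndepOn ℝ v (S : Set ι) := by
  rw [linearIndepOn_finset_iff]
  intro a ha i hi
  obtain ⟨y, h1, h2⟩ := h i hi
  have h3 := congrArg y ha
  rw [map_sum, Finset.sum_eq_single i, map_smul, map_zero, smul_eq_mul] at h3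
  · exact (mul_eq_zero.1 h3).resolve_right h1
  · intro j hj hji
    rw [map_smul, h2 j hj hji, smul_zero]
  · exact fun h => absurd hi h

section Cyclic
open Polynomial

/-- The linear functional that evaluates a polynomial along the moment curve. -/
def polyFunctional (δ : ℕ) (q : ℝ[X]) : Euc δ × ℝ →L[ℝ] ℝ :=
  LinearMap.toContinuousLinearMap
    (q.coeff 0 • LinearMap.snd ℝ (Euc δ) ℝ +
      (∑ i : Fin δ, q.coeff (i + 1) • LinearMap.proj i) ∘ₗ LinearMap.fst ℝ (Euc δ) ℝ)

theorem polyFunctional_apply {δ : ℕ} {q : ℝ[X]} (hq : q.natDegree ≤ δ) (t : ℝ) :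
    polyFunctional δ q (momentCurve δ t, 1) = q.eval t := by
  rw [eval_eq_sum_range' (Nat.lt_succ_of_le hq), Finset.sum_range_succ', Finset.sum_range]
  simp [polyFunctional, momentCurve, add_comm]

/-- The vertices of the cyclic polytope. -/
def cyclicPoint (δ n : ℕ) (j : Fin n) : Euc δ := momentCurve δ ((j : ℝ) + 1)

theorem cyclicPolytope_eq (δ n : ℕ) :
    cyclicPolytope δ n = convexHull ℝ (range (cyclicPoint δ n)) := by
  rw [cyclicPolytope, ← range_comp]
  rfl

variable {δ n : ℕ}

theorem cyclic_apply {q : ℝ[X]} (hq : q.natDegree ≤ δ) (j : Fin n) :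
    polyFunctional δ q (homog (cyclicPoint δ n) j) = q.eval ((j : ℝ) + 1) :=
  polyFunctional_apply hq _

/-- A polynomial vanishing at given parameters. -/
def nodal (S : Finset (Fin n)) : ℝ[X] := ∏ i ∈ S, (X - C ((i : ℝ) + 1))

theorem natDegree_nodal (S : Finset (Fin n)) : (nodal S).natDegree = S.card := by
  rw [nodal, natDegree_prod_of_monic _ _ fun i _ => monic_X_sub_C _,
    Finset.sum_congr rfl fun i _ => natDegree_X_sub_C _]
  simp

theorem eval_nodal_eq_zero {S : Finset (Fin n)} {j : Fin n} :
    (nodal S).eval ((j : ℝ) + 1) = 0 ↔ j ∈ S := by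
  rw [nodal, eval_prod, Finset.prod_eq_zero_iff]
  constructor
  · rintro ⟨i, hi, h⟩
    have : (j : ℝ) = i := by
      simp only [eval_sub, eval_X, eval_C] at h
      linarith
    rwa [Fin.ext (by exact_mod_cast this : (j : ℕ) = i)]
  · exact fun h => ⟨j, h, by simp⟩

theorem isUniform_cyclic (hn : δ + 1 ≤ n) : IsUniform (homog (cyclicPoint δ n)) where
  indep_of_card_eq S hS := by
    refine linearIndepOn_of_dual fun i hi => ⟨polyFunctional δ (nodal (S.erase i)), ?_, ?_⟩
    · rw [cyclic_apply, Ne, eval_nodal_eq_zero]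
      · simp
      · rw [natDegree_nodal, Finset.card_erase_of_mem hi, hS, finrank_euc_prod]
        rfl
    · intro j hj hji
      rw [cyclic_apply, eval_nodal_eq_zero]
      · exact Finset.mem_erase.2 ⟨hji, hj⟩
      · rw [natDegree_nodal, Finset.card_erase_of_mem hi, hS, finrank_euc_prod]
        rfl
  finrank_le := by simpa [finrank_euc_prod] using hn
  exists_pos := ⟨ContinuousLinearMap.snd ℝ _ _, fun j => one_pos⟩

theorem mem_faces_cyclic (hn : δ + 1 ≤ n) {T : Finset (Fin n)} (hT : 2 * T.card ≤ δ) :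
    T ∈ faces (homog (cyclicPoint δ n)) := by
  have hdeg : (nodal T ^ 2).natDegree ≤ δ := by rwa [natDegree_pow, natDegree_nodal]
  have hz : zeroSet (homog (cyclicPoint δ n)) (polyFunctional δ (nodal T ^ 2)) = T := by
    ext j
    rw [mem_zeroSet, cyclic_apply hdeg, eval_pow, sq_eq_zero_iff, eval_nodal_eq_zero]
  refine ⟨polyFunctional δ (nodal T ^ 2), fun j => ?_, fun h => ?_, hz⟩
  · rw [cyclic_apply hdeg, eval_pow]
    positivity
  · have : T = Finset.univ := by
      rw [← hz, h]
      ext j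
      simp [mem_zeroSet]
    rw [this, Finset.card_univ, Fintype.card_fin] at hT
    omega

theorem coeff_faces_cyclic (hn : δ + 1 ≤ n) {m : ℕ} (hm : 2 * m ≤ δ) :
    (fpoly (faces (homog (cyclicPoint δ n)))).coeff m = n.choose m := by
  have : {T | T ∈ faces (homog (cyclicPoint δ n)) ∧ T.card = m} =
      ((Finset.univ : Finset (Fin n)).powersetCard m : Set (Finset (Fin n))) := by
    ext T
    rw [mem_ofPred_eq, Finset.mem_coe, Finset.mem_powersetCard_univ]
    constructor
    · exact fun h => h.2
    · exact fun h => ⟨mem_faces_cyclic hn (by omega), h⟩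
  rw [coeff_fpoly, this, Set.ncard_coe_finset]
  simp

theorem sum_choose_mul_choose (M : ℕ) : ∀ r m : ℕ, m ≤ r + 1 →
    ∑ i ∈ Finset.range (m + 1), (r - i).choose (m - i) * (M + i).choose i =
      (M + r + 1).choose m := by
  intro r
  induction r with
  | zero =>
    intro m hm
    interval_cases m <;> simp [Finset.sum_range_succ]
  | succ r ih =>
    intro m hm
    rcases m with _ | m
    · simp
    rcases Nat.lt_or_ge m (r + 1) with h | h
    · rw [show M + (r + 1) + 1 = (M + r + 1) + 1 by ring, Nat.choose_succ_succ, ← ih m (by omega),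
        ← ih (m + 1) (by omega), Finset.sum_range_succ, Finset.sum_range_succ (n := m + 1),
        ← add_assoc (Finset.sum _ _), ← Finset.sum_add_distrib]
      congr 1
      · refine Finset.sum_congr rfl fun i hi => ?_
        rw [Finset.mem_range] at hi
        rw [Nat.sub_add_comm (by omega), Nat.sub_add_comm (by omega : i ≤ m), Nat.choose_succ_succ,
          add_mul]
      · simp
    · obtain rfl : m = r + 1 := by omega
      rw [Finset.sum_range_succ, Finset.sum_eq_zero]
      · simp
        congr 1
      · intro i hi
        rw [Finset.mem_range] at hi
        rw [Nat.choose_eq_zero_of_lt (by omega), zero_mul]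

theorem hvector_cyclic (hn : δ + 1 ≤ n) {h : ℕ → ℤ}
    (hh : fpoly (faces (homog (cyclicPoint δ n))) = hpoly δ h) :
    ∀ i ≤ δ / 2, h i = (n + i - (δ + 1)).choose i := by
  intro i
  induction i using Nat.strong_induction_on with
  | _ m ih =>
    intro hm
    have h1 := coeff_faces_cyclic hn (m := m) (by omega)
    have h2 : (hpoly δ h).coeff m =
        ∑ i ∈ Finset.range (m + 1), ((δ - i).choose (m - i) : ℤ) * h i := by
      rw [coeff_hpoly, ← Finset.sum_subset (Finset.range_mono (show m + 1 ≤ δ + 1 by omega))]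
      · refine Finset.sum_congr rfl fun i hi => ?_
        rw [Finset.mem_range] at hi
        rw [if_pos (by omega)]
      · intro i _ hi
        rw [Finset.mem_range] at hi
        rw [if_neg (by omega), zero_mul]
    have h3 := sum_choose_mul_choose (n - (δ + 1)) δ m (by omega)
    rw [show n - (δ + 1) + δ + 1 = n by omega] at h3
    rw [hh, h2, ← h3, Finset.sum_range_succ, Nat.cast_sum, Finset.sum_range_succ,
      Finset.sum_congr rfl
        (g := fun i => (((δ - i).choose (m - i) * (n - (δ + 1) + i).choose i : ℕ) : ℤ))
      fun i hi => ?_] at h1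
    · have := add_left_cancel h1
      simp only [tsub_self, Nat.choose_zero_right, Nat.cast_one, one_mul] at this
      rw [this, show n + m - (δ + 1) = n - (δ + 1) + m by omega]
    · rw [Finset.mem_range] at hi
      rw [ih i hi (by omega), show n + i - (δ + 1) = n - (δ + 1) + i by omega]
      push_cast
      ring

/-- The `h`-vector of a cyclic polytope. -/
theorem exists_hvector_cyclic {d : ℕ} (hn : d + 2 ≤ n) : ∃ h : ℕ → ℤ,
    (∀ i ≤ (d + 1) / 2, h i = ubTerm n d i) ∧ (∀ i ≤ d + 1, h (d + 1 - i) = h i) ∧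
    ∀ k, (hpoly (d + 1) h).coeff (k + 1) ≤ faceCount (cyclicPolytope (d + 1) n) k := by
  have hu := isUniform_cyclic (δ := d + 1) (n := n) (by omega)
  obtain ⟨h, h1, h2, -⟩ := hu.exists_hvector (e := d) finrank_euc_prod
  refine ⟨h, fun i hi => hvector_cyclic (by omega) h1 i hi, h2, fun k => ?_⟩
  rw [← h1, coeff_fpoly, cyclicPolytope_eq]
  exact_mod_cast hu.ncard_faces_le k

end Cyclic

section Perturb
open Filter Topology
variable {E : Type*} [NormedAddCommGroup E] [NormedSpace ℝ E] [FiniteDimensional ℝ E]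
variable {J : Type*} [Fintype J] [DecidableEq J]

open Classical in
/-- The inequalities `0 ≤ g (v j) + ω j`, with `j ∈ T`, that are tight at `g`. -/
def tight (v : J → E) (ω : J → ℝ) (T : Finset J) (g : E →L[ℝ] ℝ) : Finset J :=
  T.filter fun j => g (v j) + ω j = 0

theorem mem_tight {v : J → E} {ω : J → ℝ} {T : Finset J} {g : E →L[ℝ] ℝ} {j : J} :
    j ∈ tight v ω T g ↔ j ∈ T ∧ g (v j) + ω j = 0 := by
  simp [tight]

theorem exists_more_tight {v : J → E} {ω : J → ℝ} {T : Finset J} {g : E →L[ℝ] ℝ}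
    (hg : ∀ j ∈ T, 0 ≤ g (v j) + ω j) {i : J} (hi : i ∈ T)
    (hiv : v i ∉ Submodule.span ℝ (v '' (tight v ω T g : Set J))) :
    ∃ g' : E →L[ℝ] ℝ, (∀ j ∈ T, 0 ≤ g' (v j) + ω j) ∧ tight v ω T g ⊂ tight v ω T g' := by
  obtain ⟨u, hu, hui⟩ := exists_functional_of_notMem hiv
  have hut : ∀ j ∈ tight v ω T g, u (v j) = 0 := fun j hj =>
    hu _ (Submodule.subset_span ⟨j, hj, rfl⟩)
  classical
  obtain ⟨j₁, hj₁, hmin⟩ := (T.filter fun j => 0 < u (v j)).exists_min_image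
    (fun j => (g (v j) + ω j) / u (v j)) ⟨i, by simp [hi, hui]⟩
  rw [Finset.mem_filter] at hj₁
  set t := (g (v j₁) + ω j₁) / u (v j₁) with ht
  have ht0 : 0 ≤ t := div_nonneg (hg _ hj₁.1) hj₁.2.le
  have e : ∀ j, (g - t • u) (v j) + ω j = (g (v j) + ω j) - t * u (v j) := by
    intro j
    simp only [sub_apply, smul_apply, smul_eq_mul]
    ring
  refine ⟨g - t • u, fun j hj => ?_, Finset.ssubset_iff_subset_ne.2 ⟨fun j hj => ?_, fun h => ?_⟩⟩
  · rw [e]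
    rcases le_or_gt (u (v j)) 0 with h | h
    · have := mul_nonpos_of_nonneg_of_nonpos ht0 h
      linarith [hg j hj]
    · have := hmin j (Finset.mem_filter.2 ⟨hj, h⟩)
      rw [le_div_iff₀ h] at this
      linarith
  · rw [mem_tight, e, hut j hj, (mem_tight.1 hj).2]
    exact ⟨(mem_tight.1 hj).1, by simp⟩
  · have : j₁ ∈ tight v ω T g := by
      rw [h, mem_tight, e, ht, div_mul_cancel₀ _ hj₁.2.ne', sub_self]
      exact ⟨hj₁.1, rfl⟩
    exact hj₁.2.ne' (hut _ this)

theorem exists_tight {v : J → E} {σ : E →L[ℝ] ℝ} (hσ : ∀ j, 0 < σ (v j)) (ω : J → ℝ)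
    (T : Finset J) : ∃ g : E →L[ℝ] ℝ, (∀ j ∈ T, 0 ≤ g (v j) + ω j) ∧
      ∀ j ∈ T, v j ∈ Submodule.span ℝ (v '' (tight v ω T g : Set J)) := by
  by_contra! H
  have key : ∀ n : ℕ, ∃ g : E →L[ℝ] ℝ, (∀ j ∈ T, 0 ≤ g (v j) + ω j) ∧ n ≤ (tight v ω T g).card := by
    intro n
    induction n with
    | zero =>
      refine ⟨(∑ j, |ω j| / σ (v j)) • σ, fun j _ => ?_, Nat.zero_le _⟩
      have h1 : |ω j| / σ (v j) ≤ ∑ j, |ω j| / σ (v j) :=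
        Finset.single_le_sum (f := fun j => |ω j| / σ (v j))
          (fun j _ => div_nonneg (abs_nonneg _) (hσ j).le) (Finset.mem_univ j)
      rw [div_le_iff₀ (hσ j)] at h1
      simp only [smul_apply, smul_eq_mul]
      linarith [neg_abs_le (ω j)]
    | succ n ih =>
      obtain ⟨g, hg, hn⟩ := ih
      obtain ⟨i, hi, hiv⟩ := H g hg
      obtain ⟨g', hg', h⟩ := exists_more_tight hg hi hiv
      exact ⟨g', hg', hn.trans_lt (Finset.card_lt_card h)⟩
  obtain ⟨g, -, h⟩ := key (Fintype.card J + 1)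
  have := Finset.card_le_univ (tight v ω T g)
  omega

/-- A face of a configuration contains a simplicial face of full rank of any generic small
perturbation of the configuration. -/
theorem exists_face_perturb {v m : J → E} {σ : E →L[ℝ] ℝ} (hσ : ∀ j, 0 < σ (v j))
    {y : E →L[ℝ] ℝ} (hy : Nonneg v y) (hy0 : y ≠ 0)
    (hgen : ∀ T ⊆ zeroSet v y, LinearIndepOn ℝ v (T : Set J) ∨
      ∃ a : J → ℝ, ∑ j ∈ T, a j • v j = 0 ∧ ∑ j ∈ T, a j * y (m j) ≠ 0) :
    ∃ B ⊆ zeroSet v y, LinearIndepOn ℝ v (B : Set J) ∧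
      (∀ j ∈ zeroSet v y, v j ∈ Submodule.span ℝ (v '' (B : Set J))) ∧
      ∀ᶠ τ : ℝ in 𝓝[>] 0, ∃ y' : E →L[ℝ] ℝ, Nonneg (fun j => v j + τ • m j) y' ∧ y' ≠ 0 ∧
        zeroSet (fun j => v j + τ • m j) y' = B := by
  obtain ⟨g, hg, hspan⟩ := exists_tight hσ (fun j => y (m j)) (zeroSet v y)
  set B := tight v (fun j => y (m j)) (zeroSet v y) g with hB
  have hBT : B ⊆ zeroSet v y := fun j hj => (mem_tight.1 hj).1
  have hBi : LinearIndepOn ℝ v (B : Set J) := by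
    refine (hgen B hBT).resolve_right ?_
    rintro ⟨a, h1, h2⟩
    refine h2 ?_
    have h3 := congrArg g h1
    simp only [map_sum, map_smul, smul_eq_mul, map_zero] at h3
    rw [← neg_zero, ← h3, ← Finset.sum_neg_distrib]
    refine Finset.sum_congr rfl fun j hj => ?_
    rw [← mul_neg, eq_neg_of_add_eq_zero_right (mem_tight.1 hj).2]
  refine ⟨B, hBT, hBi, hspan, ?_⟩
  choose φ hφ using fun i => exists_functional_of_linearIndepOn hBi (Pi.single i (1 : ℝ))
  let K : E →L[ℝ] E := ∑ i ∈ B, (φ i).smulRight (m i)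
  have hK : ∀ i ∈ B, K (v i) = m i := by
    intro i hi
    simp only [K, sum_apply, ContinuousLinearMap.smulRight_apply]
    rw [Finset.sum_eq_single i]
    · rw [hφ i i hi, Pi.single_eq_same, one_smul]
    · intro j hj hji
      rw [hφ j i hi, Pi.single_eq_of_ne hji.symm, zero_smul]
    · exact fun h => absurd hi h
  have hyK : ∀ x ∈ Submodule.span ℝ (v '' (B : Set J)), y (K x) = -g x := by
    intro x hx
    refine LinearMap.eqOn_span (f := ((y.comp K : E →L[ℝ] ℝ) : E →ₗ[ℝ] ℝ))
      (g := ((-g : E →L[ℝ] ℝ) : E →ₗ[ℝ] ℝ)) ?_ hx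
    rintro _ ⟨i, hi, rfl⟩
    show y (K (v i)) = -g (v i)
    rw [hK i hi, eq_neg_of_add_eq_zero_right (mem_tight.1 hi).2]
  let Ψ : ℝ → E →L[ℝ] E := fun τ => 1 + τ • K
  have hΨ : Continuous Ψ := by fun_prop
  have hΨ0 : Ψ 0 = 1 := by simp [Ψ]
  have hinv : Tendsto (fun τ => Ring.inverse (Ψ τ)) (𝓝[>] 0) (𝓝 1) := by
    have h1 := NormedRing.inverse_continuousAt (1 : (E →L[ℝ] E)ˣ)
    have h2 : ContinuousAt (fun τ => Ring.inverse (Ψ τ)) 0 := by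
      refine ContinuousAt.comp (g := Ring.inverse) ?_ hΨ.continuousAt
      rw [hΨ0]
      exact h1
    have h3 := h2.tendsto
    rw [hΨ0, Ring.inverse_one] at h3
    exact h3.mono_left nhdsWithin_le_nhds
  have hunit : ∀ᶠ τ in 𝓝[>] (0 : ℝ), IsUnit (Ψ τ) := by
    have h1 : {x : E →L[ℝ] E | IsUnit x} ∈ 𝓝 (Ψ 0) := by
      rw [hΨ0]
      exact Units.isOpen.mem_nhds isUnit_one
    exact (hΨ.continuousAt.eventually_mem h1).filter_mono nhdsWithin_le_nhds
  have happ : ∀ x, Tendsto (fun τ => y (Ring.inverse (Ψ τ) x)) (𝓝[>] 0) (𝓝 (y x)) := by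
    intro x
    have := (ContinuousLinearMap.apply ℝ E x).continuous.continuousAt.tendsto.comp hinv
    exact (y.continuous.tendsto _).comp this
  have hzero : Tendsto (fun τ : ℝ => τ) (𝓝[>] 0) (𝓝 0) := nhdsWithin_le_nhds
  have hpos : ∀ j, ∀ᶠ τ in 𝓝[>] (0 : ℝ), j ∉ B →
      0 < y (v j) + τ * y (Ring.inverse (Ψ τ) (m j - K (v j))) := by
    intro j
    by_cases hj : j ∈ zeroSet v y
    · by_cases hjB : j ∈ B
      · exact Eventually.of_forall fun τ h => absurd hjB h
      · have h1 : 0 < y (m j - K (v j)) := by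
          rw [map_sub, hyK _ (hspan j hj), sub_neg_eq_add, add_comm]
          exact lt_of_le_of_ne (hg j hj) fun h => hjB (mem_tight.2 ⟨hj, h.symm⟩)
        filter_upwards [(happ _).eventually (lt_mem_nhds h1), self_mem_nhdsWithin] with τ h2 h3 _
        rw [mem_zeroSet.1 hj, zero_add]
        exact mul_pos h3 h2
    · have h1 : Tendsto (fun τ => y (v j) + τ * y (Ring.inverse (Ψ τ) (m j - K (v j))))
          (𝓝[>] 0) (𝓝 (y (v j) + 0 * y (m j - K (v j)))) :=
        tendsto_const_nhds.add (hzero.mul (happ _))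
      rw [zero_mul, add_zero] at h1
      filter_upwards [h1.eventually (lt_mem_nhds (hy.pos hj))] with τ h2 _ using h2
  filter_upwards [hunit, eventually_all.2 hpos] with τ hu hp
  have hcancel : ∀ x, Ring.inverse (Ψ τ) (Ψ τ x) = x := fun x =>
    DFunLike.congr_fun (Ring.inverse_mul_cancel _ hu) x
  have hval : ∀ j, (y.comp (Ring.inverse (Ψ τ))) (v j + τ • m j) =
      y (v j) + τ * y (Ring.inverse (Ψ τ) (m j - K (v j))) := by
    intro j
    have : v j + τ • m j = Ψ τ (v j) + τ • (m j - K (v j)) := by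
      simp [Ψ, smul_sub]
    rw [this, ContinuousLinearMap.comp_apply, map_add, hcancel, map_smul, map_add, map_smul,
      smul_eq_mul]
  have hval0 : ∀ j ∈ B, (y.comp (Ring.inverse (Ψ τ))) (v j + τ • m j) = 0 := by
    intro j hj
    rw [hval, hK j hj, mem_zeroSet.1 (hBT hj)]
    simp
  refine ⟨y.comp (Ring.inverse (Ψ τ)), fun j => ?_, fun h => hy0 ?_, ?_⟩
  · by_cases hj : j ∈ B
    · exact (hval0 j hj).ge
    · show 0 ≤ (y.comp (Ring.inverse (Ψ τ))) (v j + τ • m j)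
      rw [hval]
      exact (hp j hj).le
  · ext x
    have := DFunLike.congr_fun h (Ψ τ x)
    rwa [ContinuousLinearMap.comp_apply, hcancel] at this
  · ext j
    rw [mem_zeroSet]
    refine ⟨fun h => ?_, hval0 j⟩
    by_contra hj
    rw [hval] at h
    exact (hp j hj).ne' h

end Perturb

section Generic
variable {W : Type*} [AddCommGroup W] [Module ℝ W]

/-- A property is generic if it holds somewhere and if it holds at all but finitely many points of
each line on which it holds somewhere. -/
def GenericProp (Q : W → Prop) : Prop :=
  (∃ b, Q b) ∧ ∀ a b, Q b → {ε : ℝ | ¬ Q (a + ε • (b - a))}.Finite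

theorem genericProp_of_forall {Q : W → Prop} (h : ∀ m, Q m) : GenericProp Q :=
  ⟨⟨0, h 0⟩, fun a b _ => by simp [h]⟩

theorem GenericProp.and {Q R : W → Prop} (hQ : GenericProp Q) (hR : GenericProp R) :
    GenericProp fun m => Q m ∧ R m := by
  refine ⟨?_, fun a b hb => ?_⟩
  · obtain ⟨a, ha⟩ := hQ.1
    obtain ⟨b, hb⟩ := hR.1
    have h1 : {ε : ℝ | ¬ Q (a + ε • (b - a))}.Finite := by
      have := (hQ.2 b a ha).preimage (f := fun ε : ℝ => 1 - ε) fun x _ y _ h => by simpa using h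
      refine this.subset fun ε hε => ?_
      have e : b + (1 - ε) • (a - b) = a + ε • (b - a) := by module
      rw [Set.mem_preimage, mem_ofPred_eq, e]
      exact hε
    obtain ⟨ε, hε⟩ := (h1.union (hR.2 a b hb)).exists_notMem
    rw [mem_union, not_or] at hε
    exact ⟨_, not_not.1 hε.1, not_not.1 hε.2⟩
  · refine ((hQ.2 a b hb.1).union (hR.2 a b hb.2)).subset fun ε hε => ?_
    by_contra h
    rw [mem_union, not_or] at h
    exact hε ⟨not_not.1 h.1, not_not.1 h.2⟩

theorem GenericProp.forall {ι : Type*} [Finite ι] {Q : ι → W → Prop}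
    (hQ : ∀ i, GenericProp (Q i)) : GenericProp fun m => ∀ i, Q i m := by
  have := Fintype.ofFinite ι
  have key : ∀ s : Finset ι, GenericProp fun m => ∀ i ∈ s, Q i m := by
    classical
    intro s
    induction s using Finset.induction_on with
    | empty => exact genericProp_of_forall (by simp)
    | insert i s hi ih => simpa only [Finset.forall_mem_insert] using (hQ i).and ih
  simpa using key Finset.univ

theorem GenericProp.congr {Q R : W → Prop} (hQ : GenericProp Q) (h : ∀ m, Q m ↔ R m) :
    GenericProp R := by
  rwa [← funext fun m => propext (h m)]

theorem genericProp_ne_zero {f : W → ℝ} (hf : ∀ a b (ε : ℝ), f (a + ε • (b - a)) =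
    f a + ε * (f b - f a)) (hne : ∃ m, f m ≠ 0) : GenericProp fun m => f m ≠ 0 := by
  refine ⟨hne, fun a b hb => Set.Subsingleton.finite fun ε hε ε' hε' => ?_⟩
  simp only [mem_ofPred_eq, not_not, hf] at hε hε'
  by_contra h
  have h1 : (ε - ε') * (f b - f a) = 0 := by linarith
  have h2 := (mul_eq_zero.1 h1).resolve_left (sub_ne_zero.2 h)
  rw [h2, mul_zero, add_zero] at hε
  exact hb (by linarith)

open Polynomial in
theorem finite_not_linearIndepOn {E J : Type*} [NormedAddCommGroup E] [NormedSpace ℝ E]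
    [FiniteDimensional ℝ E] [DecidableEq J] {x z : J → E} {S : Finset J}
    (h : LinearIndepOn ℝ z (S : Set J)) :
    {ε : ℝ | ¬ LinearIndepOn ℝ (fun j => x j + ε • (z j - x j)) (S : Set J)}.Finite := by
  choose φ hφ using fun i => exists_functional_of_linearIndepOn h (Pi.single i (1 : ℝ))
  let M : Matrix S S ℝ[X] := .of fun i j => C (φ i (x j)) + X * C (φ i (z j) - φ i (x j))
  have hM : ∀ ε : ℝ, M.det.eval ε =
      (Matrix.of fun i j : S => φ i (x j + ε • (z j - x j))).det := by
    intro ε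
    rw [← coe_evalRingHom, RingHom.map_det]
    congr 1
    ext i j
    simp [M]
  have hM0 : M.det ≠ 0 := by
    intro h0
    have h1 := hM 1
    have h2 : (Matrix.of fun i j : S => φ i (x j + (1 : ℝ) • (z j - x j))) = 1 := by
      ext i j
      rw [Matrix.of_apply, one_smul, add_sub_cancel, hφ i j j.2, Matrix.one_apply]
      by_cases hij : i = j
      · rw [hij, if_pos rfl, Pi.single_eq_same]
      · rw [if_neg hij, Pi.single_eq_of_ne fun h => hij (Subtype.ext h.symm)]
    rw [h2, h0, Matrix.det_one, eval_zero] at h1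
    exact zero_ne_one h1
  refine (finite_setOfPred_isRoot hM0).subset fun ε hε => ?_
  by_contra hroot
  refine hε ?_
  have hdet : (Matrix.of fun i j : S => φ i (x j + ε • (z j - x j))).det ≠ 0 := by
    rw [← hM]
    exact hroot
  have key : LinearIndependent ℝ fun j : S => x j + ε • (z j - x j) := by
    refine Fintype.linearIndependent_iff.2 fun a ha i => ?_
    refine congrFun (Matrix.eq_zero_of_mulVec_eq_zero hdet (v := a) (funext fun i => ?_)) i
    have := congrArg (φ i) ha
    rw [map_sum, map_zero] at this
    rw [Pi.zero_apply, ← this]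
    refine Finset.sum_congr rfl fun j _ => ?_
    rw [map_smul, smul_eq_mul, mul_comm]
    rfl
  exact key

end Generic

section CayleyConfiguration
variable {d : ℕ} {J : Type*} [Fintype J] [DecidableEq J]

/-- The Cayley trick: the points `m j` in two copies of `E^d`, according to their colour. -/
def cay (c : J → Bool) (m : J → Euc d) (j : J) : Euc d × (Bool → ℝ) := (m j, Pi.single (c j) 1)

/-- The indices of a given colour. -/
def side (c : J → Bool) (s : Bool) : Finset J := Finset.univ.filter (c · = s)

/-- General position for a Cayley configuration. -/
def IsGP (c : J → Bool) (m : J → Euc d) : Prop :=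
  ∀ S : Finset J, S.card ≤ d + 2 → (∀ s, (S ∩ side c s).card ≤ d + 1) →
    LinearIndepOn ℝ (cay c m) (S : Set J)

/-- The coordinate dual to a colour. -/
def tag (s : Bool) : Euc d × (Bool → ℝ) →L[ℝ] ℝ :=
  (ContinuousLinearMap.proj s).comp (ContinuousLinearMap.snd ℝ _ _)

theorem mem_side {c : J → Bool} {s : Bool} {j : J} : j ∈ side c s ↔ c j = s := by
  simp [side]

theorem tag_cay (c : J → Bool) (m : J → Euc d) (s : Bool) (j : J) :
    tag s (cay c m j) = if c j = s then 1 else 0 := by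
  simp [tag, cay, Pi.single_apply, eq_comm]

theorem finrank_cay : Module.finrank ℝ (Euc d × (Bool → ℝ)) = d + 2 := by
  simp

theorem card_inter_side_add (c : J → Bool) (S : Finset J) (s : Bool) :
    (S ∩ side c s).card + (S ∩ side c !s).card = S.card := by
  rw [← Finset.card_union_of_disjoint, ← Finset.inter_union_distrib_left]
  · congr 1
    ext j
    simp only [Finset.mem_inter, Finset.mem_union, mem_side]
    cases c j <;> cases s <;> simp
  · rw [Finset.disjoint_left]
    intro j h1 h2
    rw [Finset.mem_inter, mem_side] at h1 h2
    rw [h1.2] at h2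
    simp at h2

theorem exists_dual_points {S : Finset J} (hS : S.card ≤ d) :
    ∃ (m : J → Euc d) (φ : J → Euc d →L[ℝ] ℝ),
      ∀ i ∈ S, ∀ j, φ i (m j) = if j = i then 1 else 0 := by
  obtain ⟨f⟩ : Nonempty (S ↪ Fin d) := Function.Embedding.nonempty_of_card_le (by simpa using hS)
  refine ⟨fun j => if h : j ∈ S then Pi.single (f ⟨j, h⟩) 1 else 0,
    fun i => if h : i ∈ S then ContinuousLinearMap.proj (f ⟨i, h⟩) else 0, fun i hi j => ?_⟩
  simp only [dif_pos hi]
  by_cases hj : j ∈ S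
  · rw [dif_pos hj]
    simp [Pi.single_apply, eq_comm]
  · have : j ≠ i := fun h => hj (h ▸ hi)
    simp [hj, this]

theorem exists_transversal {c : J → Bool} {S : Finset J} (hS : S.card ≤ d + 2)
    (hs : ∀ s, (S ∩ side c s).card ≤ d + 1) :
    ∃ R ⊆ S, (∀ i ∈ R, ∀ j ∈ R, c i = c j → i = j) ∧ (S \ R).card ≤ d := by
  have key : ∀ s, S ∩ side c s = ∅ →
      ∃ R ⊆ S, (∀ i ∈ R, ∀ j ∈ R, c i = c j → i = j) ∧ (S \ R).card ≤ d := by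
    intro s h0
    have h1 := card_inter_side_add c S s
    have h2 := hs !s
    rw [h0, Finset.card_empty, zero_add] at h1
    rcases S.eq_empty_or_nonempty with rfl | ⟨i, hi⟩
    · exact ⟨∅, by simp⟩
    · refine ⟨{i}, by simpa using hi, by simp, ?_⟩
      rw [Finset.card_sdiff_of_subset (by simpa using hi), Finset.card_singleton]
      omega
  rcases (S ∩ side c true).eq_empty_or_nonempty with h | ⟨i, hi⟩
  · exact key _ h
  rcases (S ∩ side c false).eq_empty_or_nonempty with h | ⟨j, hj⟩
  · exact key _ h
  rw [Finset.mem_inter, mem_side] at hi hj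
  have hsub : ({i, j} : Finset J) ⊆ S := by
    rw [Finset.insert_subset_iff, Finset.singleton_subset_iff]
    exact ⟨hi.1, hj.1⟩
  have hij : i ≠ j := by
    rintro rfl
    simp [hi.2] at hj
  refine ⟨{i, j}, hsub, ?_, ?_⟩
  · simp [hi.2, hj.2]
  · rw [Finset.card_sdiff_of_subset hsub, Finset.card_pair hij]
    omega

theorem exists_linearIndepOn_cay {c : J → Bool} {S : Finset J} (hS : S.card ≤ d + 2)
    (hs : ∀ s, (S ∩ side c s).card ≤ d + 1) :
    ∃ m : J → Euc d, LinearIndepOn ℝ (cay c m) (S : Set J) := by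
  obtain ⟨R, hRS, hR, hcard⟩ := exists_transversal hS hs
  obtain ⟨m, φ, hφ⟩ := exists_dual_points hcard
  obtain ⟨ψ, hψ⟩ : ∃ ψ : J → Euc d × (Bool → ℝ) →L[ℝ] ℝ,
      ∀ i ∈ S \ R, ∀ j, ψ i (cay c m j) = if j = i then 1 else 0 :=
    ⟨fun i => (φ i).comp (ContinuousLinearMap.fst ℝ _ _), hφ⟩
  refine ⟨m, linearIndepOn_of_dual fun i hi => ?_⟩
  by_cases hiR : i ∈ R
  · have key : ∀ j, (tag (c i) - ∑ k ∈ (S \ R).filter (c · = c i), ψ k : Euc d × (Bool → ℝ) →L[ℝ] ℝ)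
        (cay c m j) =
        (if c j = c i then 1 else 0) - if j ∈ S \ R ∧ c j = c i then 1 else 0 := by
      intro j
      rw [sub_apply, tag_cay, sum_apply]
      rw [Finset.sum_congr rfl fun k hk => hψ k (Finset.mem_filter.1 hk).1 j, Finset.sum_ite_eq]
      simp only [Finset.mem_filter]
    refine ⟨tag (c i) - ∑ k ∈ (S \ R).filter (c · = c i), ψ k, ?_, fun j hj hji => ?_⟩
    · rw [key]
      simp [hiR]
    · rw [key]
      by_cases hjR : j ∈ R
      · have : c j ≠ c i := fun h => hji (hR j hjR i hiR h)
        simp [this]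
      · have : j ∈ S \ R := Finset.mem_sdiff.2 ⟨hj, hjR⟩
        simp [this]
  · have hi' : i ∈ S \ R := Finset.mem_sdiff.2 ⟨hi, hiR⟩
    refine ⟨ψ i, ?_, fun j _ hji => ?_⟩
    · rw [hψ i hi', if_pos rfl]
      exact one_ne_zero
    · rw [hψ i hi', if_neg hji]

theorem cay_add_smul_sub (c : J → Bool) (a b : J → Euc d) (ε : ℝ) (j : J) :
    cay c (a + ε • (b - a)) j = cay c a j + ε • (cay c b j - cay c a j) := by
  refine Prod.ext rfl ?_
  simp [cay]

theorem genericProp_isGP (c : J → Bool) : GenericProp fun m : J → Euc d => IsGP c m := by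
  have : GenericProp fun m : J → Euc d =>
      ∀ S : {S : Finset J // S.card ≤ d + 2 ∧ ∀ s, (S ∩ side c s).card ≤ d + 1},
        LinearIndepOn ℝ (cay c m) (S.1 : Set J) := by
    refine GenericProp.forall fun S => ⟨exists_linearIndepOn_cay S.2.1 S.2.2, fun a b hb => ?_⟩
    simp only [funext (cay_add_smul_sub c a b _)]
    exact finite_not_linearIndepOn hb
  exact this.congr fun m => ⟨fun h S h1 h2 => h ⟨S, h1, h2⟩, fun h S => h S.1 S.2.1 S.2.2⟩

end CayleyConfiguration

section GeneralPosition
variable {d : ℕ} {J : Type*} [Fintype J] [DecidableEq J] {c : J → Bool} {m : J → Euc d}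

theorem tag_ne_zero (s : Bool) : (tag s : Euc d × (Bool → ℝ) →L[ℝ] ℝ) ≠ 0 := by
  intro h
  have : tag s ((0, Pi.single s 1) : Euc d × (Bool → ℝ)) = 0 := by rw [h]; rfl
  simp [tag] at this

theorem finrank_ker_tag (s : Bool) :
    Module.finrank ℝ (LinearMap.ker (tag s : Euc d × (Bool → ℝ) →L[ℝ] ℝ).toLinearMap) + 1
      = d + 2 := by
  have h := LinearMap.finrank_range_add_finrank_ker (tag s : Euc d × (Bool → ℝ) →L[ℝ] ℝ).toLinearMap
  rw [LinearMap.range_eq_top.2, finrank_top, Module.finrank_self, finrank_cay] at h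
  · omega
  · exact LinearMap.surjective fun h => tag_ne_zero s (ContinuousLinearMap.coe_injective h)

theorem span_side_le (s : Bool) :
    Submodule.span ℝ (cay c m '' (side c s : Set J)) ≤
      LinearMap.ker (tag (!s) : Euc d × (Bool → ℝ) →L[ℝ] ℝ).toLinearMap := by
  rw [Submodule.span_le]
  rintro _ ⟨j, hj, rfl⟩
  have := mem_side.1 hj
  change tag (!s) (cay c m j) = 0
  rw [tag_cay, this, if_neg (by cases s <;> simp)]

namespace IsGP

theorem linearIndepOn_of_card_le (h : IsGP c m) {S : Finset J} (hc : S.card ≤ d + 1) :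
    LinearIndepOn ℝ (cay c m) (S : Set J) :=
  h S (by omega) fun _ => (Finset.card_le_card Finset.inter_subset_left).trans hc

theorem span_eq (h : IsGP c m) {s : Bool} {S : Finset J} (hS : S ⊆ side c s)
    (hc : S.card = d + 1) : Submodule.span ℝ (cay c m '' (S : Set J)) =
      LinearMap.ker (tag (!s) : Euc d × (Bool → ℝ) →L[ℝ] ℝ).toLinearMap := by
  refine Submodule.eq_of_le_of_finrank_le
    ((Submodule.span_mono (image_mono (by simpa using hS))).trans (span_side_le s)) ?_
  have h1 := finrank_ker_tag (d := d) (!s)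
  have h2 : Module.finrank ℝ (Submodule.span ℝ (cay c m '' (S : Set J))) = d + 1 := by
    rw [← hc, image_eq_range]
    simpa using finrank_span_eq_card (h.linearIndepOn_of_card_le hc.le)
  omega

theorem span_side (h : IsGP c m) {s : Bool} (hs : d + 1 ≤ (side c s).card) :
    Submodule.span ℝ (cay c m '' (side c s : Set J)) =
      LinearMap.ker (tag (!s) : Euc d × (Bool → ℝ) →L[ℝ] ℝ).toLinearMap := by
  obtain ⟨S, h1, h2⟩ := Finset.exists_subset_card_eq hs
  refine le_antisymm (span_side_le s) ?_
  rw [← h.span_eq h1 h2]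
  exact Submodule.span_mono (image_mono (by simpa using h1))

theorem side_subset (h : IsGP c m) {s : Bool} {y : Euc d × (Bool → ℝ) →L[ℝ] ℝ}
    (hy : d + 1 ≤ (zeroSet (cay c m) y ∩ side c s).card) : side c s ⊆ zeroSet (cay c m) y := by
  obtain ⟨S, h1, h2⟩ := Finset.exists_subset_card_eq hy
  rw [Finset.subset_inter_iff] at h1
  intro j hj
  rw [mem_zeroSet]
  refine apply_eq_zero_of_mem_span h1.1 ?_
  rw [h.span_eq h1.2 h2]
  exact span_side_le s (Submodule.subset_span (mem_image_of_mem _ (by simpa using hj)))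

theorem indep_zeroSet (h : IsGP c m) {y : Euc d × (Bool → ℝ) →L[ℝ] ℝ}
    (hy : ∀ s, ¬ side c s ⊆ zeroSet (cay c m) y) :
    LinearIndepOn ℝ (cay c m) (zeroSet (cay c m) y : Set J) := by
  have hlt : ∀ s, (zeroSet (cay c m) y ∩ side c s).card ≤ d + 1 := fun s => by
    by_contra! hlt
    exact hy s (h.side_subset hlt.le)
  rcases Nat.le_total (zeroSet (cay c m) y).card (d + 2) with hle | hle
  · exact h _ hle hlt
  · obtain ⟨S, h1, h2⟩ := Finset.exists_subset_card_eq hle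
    have h3 := h S h2.le fun s =>
      (Finset.card_le_card (Finset.inter_subset_inter_right h1)).trans (hlt s)
    have h4 := eq_zero_of_linearIndepOn h3 (h2.trans finrank_cay.symm) h1
    refine absurd (fun j _ => ?_) (hy true)
    rw [mem_zeroSet, h4]
    rfl

theorem zeroSet_tag (c : J → Bool) (m : J → Euc d) (s : Bool) :
    zeroSet (cay c m) (tag (!s)) = side c s := by
  ext j
  rw [mem_zeroSet, tag_cay, mem_side]
  cases c j <;> cases s <;> simp

theorem nonneg_tag (c : J → Bool) (m : J → Euc d) (s : Bool) : Nonneg (cay c m) (tag s) := by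
  intro j
  rw [tag_cay]
  split_ifs
  · exact zero_le_one
  · exact le_rfl

theorem isCayley (h : IsGP c m) (hs : ∀ s, d + 1 ≤ (side c s).card) :
    IsCayley (cay c m) (side c true) (side c false) where
  disjoint := Finset.disjoint_left.2 fun j h1 h2 => by
    rw [mem_side] at h1 h2
    simp [h1] at h2
  union := by
    ext j
    simp only [Finset.mem_union, mem_side, Finset.mem_univ]
    cases c j <;> simp
  left := ⟨tag false, nonneg_tag c m _, zeroSet_tag c m true⟩
  right := ⟨tag true, nonneg_tag c m _, zeroSet_tag c m false⟩
  left_nonempty := Finset.card_pos.1 ((Nat.succ_pos d).trans_le (hs _))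
  right_nonempty := Finset.card_pos.1 ((Nat.succ_pos d).trans_le (hs _))
  finrank_left := by rw [h.span_side (hs _), finrank_ker_tag, finrank_cay]
  finrank_right := by rw [h.span_side (hs _), finrank_ker_tag, finrank_cay]
  indep y _ h1 h2 := h.indep_zeroSet fun s => by cases s <;> assumption

/-- The inclusion of the (homogenized) space of one colour. -/
def incl (s : Bool) : Euc d × ℝ →L[ℝ] Euc d × (Bool → ℝ) :=
  LinearMap.toContinuousLinearMap (LinearMap.prodMap LinearMap.id
    (LinearMap.single ℝ (fun _ : Bool => ℝ) s))

theorem incl_homog {s : Bool} (j : {j // c j = s}) :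
    incl s (homog (fun j : {j // c j = s} => m j) j) = cay c m j := by
  change ((m j, Pi.single s 1) : Euc d × (Bool → ℝ)) = (m j, Pi.single (c j) 1)
  rw [j.2]

theorem isUniform (h : IsGP c m) {s : Bool} (hs : d + 1 ≤ (side c s).card) :
    IsUniform (homog fun j : {j // c j = s} => m j) where
  indep_of_card_eq S hS := by
    rw [finrank_euc_prod] at hS
    have h1 := h.linearIndepOn_of_card_le (S := S.map (Function.Embedding.subtype _)) (by simp [hS])
    refine linearIndepOn_of_dual fun i hi => ?_
    obtain ⟨u, hu⟩ := exists_functional_of_linearIndepOn h1 (Pi.single i.1 (1 : ℝ))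
    have hu' : ∀ j ∈ S, u (cay c m j) = (Pi.single i.1 (1 : ℝ) : J → ℝ) j := fun j hj =>
      hu j (Finset.mem_coe.2 (Finset.mem_map_of_mem (Function.Embedding.subtype _) hj))
    refine ⟨u.comp (incl s), ?_, fun j hj hji => ?_⟩
    · rw [ContinuousLinearMap.comp_apply, incl_homog, hu' i hi, Pi.single_eq_same]
      exact one_ne_zero
    · rw [ContinuousLinearMap.comp_apply, incl_homog, hu' j hj,
        Pi.single_eq_of_ne fun h => hji (Subtype.ext h)]
  finrank_le := by
    rw [finrank_euc_prod, Fintype.card_subtype]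
    exact hs
  exists_pos := ⟨ContinuousLinearMap.snd ℝ _ _, fun j => one_pos⟩

theorem facesOn_eq (h : IsGP c m) {s : Bool} (hs : d + 1 ≤ (side c s).card) :
    facesOn (cay c m) (side c s) = (fun T => T.map (Function.Embedding.subtype _)) ''
      faces (homog fun j : {j // c j = s} => m j) := by
  have hu := h.isUniform hs
  have hmap : ∀ (y : Euc d × (Bool → ℝ) →L[ℝ] ℝ) (z : Euc d × ℝ →L[ℝ] ℝ),
      (∀ j : {j // c j = s}, z (homog (fun j : {j // c j = s} => m j) j) = y (cay c m j)) →
      (zeroSet (homog fun j : {j // c j = s} => m j) z).map (Function.Embedding.subtype _) =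
        zeroSet (cay c m) y ∩ side c s := by
    intro y z hyz
    ext j
    simp only [Finset.mem_map, Finset.mem_inter, mem_zeroSet, hyz, mem_side]
    constructor
    · rintro ⟨i, hi, rfl⟩
      exact ⟨hi, i.2⟩
    · rintro ⟨h1, h2⟩
      exact ⟨⟨j, h2⟩, h1, rfl⟩
  ext T
  constructor
  · rintro ⟨y, h1, ⟨j, hj, hyj⟩, rfl⟩
    refine ⟨_, ⟨y.comp (incl s), fun j => ?_, fun h0 => hyj ?_, rfl⟩, hmap _ _ fun j => ?_⟩
    · rw [ContinuousLinearMap.comp_apply, incl_homog]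
      exact h1 _ (mem_side.2 j.2)
    · rw [← incl_homog ⟨j, mem_side.1 hj⟩, ← ContinuousLinearMap.comp_apply, h0]
      rfl
    · rw [ContinuousLinearMap.comp_apply, incl_homog]
  · rintro ⟨_, ⟨z, h1, h2, rfl⟩, rfl⟩
    have hz : ∀ j : {j // c j = s}, z (homog (fun j : {j // c j = s} => m j) j) =
        (z.comp ((ContinuousLinearMap.fst ℝ _ _).prod (tag s))) (cay c m j) := fun j => by
      change z (m j, 1) = z (m j, tag s (cay c m j))
      rw [tag_cay, if_pos j.2]
    refine ⟨_, fun j hj => ?_, ?_, (hmap _ _ hz).symm⟩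
    · exact (h1 ⟨j, mem_side.1 hj⟩).trans_eq (hz ⟨j, mem_side.1 hj⟩)
    · by_contra! h0
      obtain ⟨S, -, hS⟩ := Finset.exists_subset_card_eq
          (hu.finrank_le.trans_eq Finset.card_univ.symm)
      refine h2 (eq_zero_of_linearIndepOn (hu.indep_of_card_eq S hS) hS fun j _ => ?_)
      rw [mem_zeroSet, hz]
      exact h0 j (mem_side.2 j.2)

theorem empty_mem_facesOn (h : IsGP c m) {s : Bool} (hs : d + 1 ≤ (side c s).card) :
    ∅ ∈ facesOn (cay c m) (side c s) := by
  rw [h.facesOn_eq hs]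
  exact ⟨∅, (h.isUniform hs).empty_mem_faces (by rw [finrank_euc_prod]; omega), rfl⟩

theorem exists_gvector {e : ℕ} {m : J → Euc (e + 1)} (h : IsGP c m) {s : Bool}
    (hs : e + 2 ≤ (side c s).card) : ∃ g : ℕ → ℤ,
      fpoly (facesOn (cay c m) (side c s)) = hpoly (e + 2) g ∧
      (∀ i ≤ e + 2, g (e + 2 - i) = -g i) ∧
      ∀ i ≤ e + 1, g i ≤ ubTerm (side c s).card (e + 1) i := by
  obtain ⟨g, h1, -, h2, h3⟩ := (h.isUniform hs).exists_gvector finrank_euc_prod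
  rw [Fintype.card_subtype] at h3
  exact ⟨g, by rw [h.facesOn_eq hs, fpoly_image, h1], h2, h3⟩

/-- The upper bound theorem for simplicial Cayley configurations. -/
theorem ncard_mixed_le {e : ℕ} {m : J → Euc (e + 1)} (h : IsGP c m)
    (hs : ∀ s, e + 2 ≤ (side c s).card) (k : ℕ) :
    ({T | T ∈ mixed (cay c m) (side c true) (side c false) ∧ T.card = k + 1}.ncard : ℤ) ≤
      minkBound (e + 1) (side c true).card (side c false).card k := by
  obtain ⟨gA, a1, a2, a3⟩ := h.exists_gvector (hs true)
  obtain ⟨gB, b1, b2, b3⟩ := h.exists_gvector (hs false)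
  obtain ⟨H, h1, h2, h3, h4⟩ := (h.isCayley hs).exists_hvector finrank_cay a1 b1
    (h.empty_mem_facesOn (hs true)) (h.empty_mem_facesOn (hs false)) a2
  have ha := hs true
  have hb := hs false
  obtain ⟨C, c1, c2, c3⟩ := exists_hvector_cyclic (d := e + 1)
    (n := (side c true).card + (side c false).card) (by omega)
  have := coeff_hpoly_le (d := e + 1) ha hb h2 a3 b3 (fun i hi => ?_) h3 c1 c2 k
  · rw [← coeff_fpoly]
    have h5 := congrArg (fun p => p.coeff (k + 1)) h1
    simp only [Polynomial.coeff_sub, Polynomial.coeff_one, if_neg (Nat.succ_ne_zero k),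
      sub_zero] at h5
    rw [h5]
    refine this.trans (sub_le_sub_right (c3 k) _)
  · have := h4 i hi
    push_cast at this ⊢
    linarith

end IsGP
end GeneralPosition

section Deformation
open Filter Topology
variable {d : ℕ} {J : Type*} [Fintype J] [DecidableEq J] {c : J → Bool} {m₀ : J → Euc d}

theorem exists_apply_fst_ne_zero {y : Euc d × (Bool → ℝ) →L[ℝ] ℝ} (hy : y ≠ 0)
    (hs : ∀ s, (zeroSet (cay c m₀) y ∩ side c s).Nonempty) : ∃ x : Euc d, y (x, 0) ≠ 0 := by
  by_contra! h
  have h1 : ∀ s, y (0, Pi.single s 1) = 0 := fun s => by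
    obtain ⟨j, hj⟩ := hs s
    rw [Finset.mem_inter, mem_zeroSet, mem_side] at hj
    have h2 : cay c m₀ j = (m₀ j, 0) + (0, Pi.single s 1) := by
      simp [cay, hj.2]
    rw [h2, map_add, h, zero_add] at hj
    exact hj.1
  refine hy (ContinuousLinearMap.ext fun x => ?_)
  have h2 : x =
      (x.1, 0) + x.2 true • (0, Pi.single true 1) + x.2 false • (0, Pi.single false 1) := by
    refine Prod.ext (by simp) (funext fun s => ?_)
    cases s <;> simp
  rw [h2, map_add, map_add, map_smul, map_smul, h, h1, h1]
  simp

theorem genericProp_relation {y : Euc d × (Bool → ℝ) →L[ℝ] ℝ} (hy : y ≠ 0)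
    (hs : ∀ s, (zeroSet (cay c m₀) y ∩ side c s).Nonempty) {T : Finset J} {a : J → ℝ}
    (ha : ∑ j ∈ T, a j • cay c m₀ j = 0) (ha0 : ∃ j ∈ T, a j ≠ 0) :
    GenericProp fun m : J → Euc d => ∑ j ∈ T, a j * y (cay c m j) ≠ 0 := by
  refine genericProp_ne_zero (fun m m' ε => ?_) ?_
  · rw [← Finset.sum_sub_distrib, Finset.mul_sum, ← Finset.sum_add_distrib]
    refine Finset.sum_congr rfl fun j _ => ?_
    rw [cay_add_smul_sub, map_add, map_smul, map_sub, smul_eq_mul]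
    ring
  · obtain ⟨x, hx⟩ := exists_apply_fst_ne_zero hy hs
    refine ⟨fun j => a j • x, ?_⟩
    have h1 : ∑ j ∈ T, a j • ((0, Pi.single (c j) 1) : Euc d × (Bool → ℝ)) = 0 := by
      have := congrArg (LinearMap.prodMap (0 : Euc d →ₗ[ℝ] Euc d) LinearMap.id) ha
      rw [map_sum, map_zero] at this
      simp only [map_smul] at this
      exact this
    have h2 : ∀ j, a j * y (cay c (fun j => a j • x) j) =
        a j ^ 2 * y (x, 0) + y (a j • (0, Pi.single (c j) 1)) := fun j => by
      have : cay c (fun j => a j • x) j = a j • (x, 0) + (0, Pi.single (c j) 1) := by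
        simp [cay]
      rw [this, map_add, map_smul, map_smul, smul_eq_mul, smul_eq_mul]
      ring
    rw [Finset.sum_congr rfl fun j _ => h2 j, Finset.sum_add_distrib, ← map_sum, h1, map_zero,
      add_zero, ← Finset.sum_mul]
    refine mul_ne_zero (ne_of_gt ?_) hx
    obtain ⟨j, hj, hj0⟩ := ha0
    exact Finset.sum_pos' (fun i _ => sq_nonneg _) ⟨j, hj, by positivity⟩

theorem eventually_isGP {m : J → Euc d} (hm : IsGP c m) (m₀ : J → Euc d) :
    ∀ᶠ τ : ℝ in 𝓝[>] 0, IsGP c (m₀ + (τ / (1 + τ)) • (m - m₀)) := by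
  have hfin := (genericProp_isGP c).2 m₀ m hm
  have hF : ({τ : ℝ | 0 < τ ∧ ¬ IsGP c (m₀ + (τ / (1 + τ)) • (m - m₀))}).Finite := by
    refine Set.Finite.of_finite_image (f := fun τ : ℝ => τ / (1 + τ)) (hfin.subset ?_) ?_
    · rintro _ ⟨τ, hτ, rfl⟩
      exact hτ.2
    · intro τ hτ τ' hτ' h
      have h1 : 0 < 1 + τ := by linarith [hτ.1]
      have h2 : 0 < 1 + τ' := by linarith [hτ'.1]
      simp only at h
      rw [div_eq_div_iff h1.ne' h2.ne'] at h
      linarith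
  have h0 : (0 : ℝ) ∉ {τ : ℝ | 0 < τ ∧ ¬ IsGP c (m₀ + (τ / (1 + τ)) • (m - m₀))} :=
    fun h => lt_irrefl _ h.1
  filter_upwards [nhdsWithin_le_nhds (hF.isClosed.isOpen_compl.mem_nhds h0), self_mem_nhdsWithin]
    with τ h1 h2
  by_contra h
  exact h1 ⟨h2, h⟩

/-- A Cayley configuration can be moved into general position without decreasing the number of
mixed faces. -/
theorem exists_isGP_ncard_le (c : J → Bool) (m₀ : J → Euc d) : ∃ m : J → Euc d, IsGP c m ∧ ∀ k,
    {T | T ∈ mixed (cay c m₀) (side c true) (side c false) ∧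
      Module.finrank ℝ (Submodule.span ℝ (cay c m₀ '' (T : Set J))) = k}.ncard ≤
    {T | T ∈ mixed (cay c m) (side c true) (side c false) ∧ T.card = k}.ncard := by
  choose y hy0 hy1 hy2 hy3 hy4 using
    fun T : mixed (cay c m₀) (side c true) (side c false) => T.2
  have hs : ∀ T s, (zeroSet (cay c m₀) (y T) ∩ side c s).Nonempty := fun T s => by
    rw [hy2]
    cases s
    · exact hy4 T
    · exact hy3 T
  have hrel : ∀ T : {T : Finset J // ¬ LinearIndepOn ℝ (cay c m₀) (T : Set J)}, ∃ a : J → ℝ,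
      ∑ j ∈ T.1, a j • cay c m₀ j = 0 ∧ ∃ j ∈ T.1, a j ≠ 0 := fun T => by
    have := T.2
    rw [linearIndepOn_finset_iff] at this
    push Not at this
    exact this
  choose a ha ha0 using hrel
  obtain ⟨m, hm, hgen⟩ := ((genericProp_isGP c).and
    (GenericProp.forall fun T => GenericProp.forall fun T' =>
      genericProp_relation (hy1 T) (hs T) (ha T') (ha0 T'))).1
  choose B hB1 hB2 hB3 hB4 using fun T =>
    exists_face_perturb (m := cay c m) (σ := tag true + tag false)
      (fun j => by
        rw [add_apply, tag_cay, tag_cay]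
        cases c j <;> simp) (hy0 T) (hy1 T) fun T' _ =>
        or_iff_not_imp_left.2 fun h => ⟨a ⟨T', h⟩, ha _, hgen T ⟨T', h⟩⟩
  obtain ⟨τ, ⟨h1, h2⟩, hτ : 0 < τ⟩ := (((eventually_all.2 hB4).and (eventually_isGP hm m₀)).and
    self_mem_nhdsWithin).exists
  have hτ' : 0 < 1 + τ := by linarith
  refine ⟨_, h2, fun k => ?_⟩
  have hcay : ∀ (z : Euc d × (Bool → ℝ) →L[ℝ] ℝ) j, z (cay c m₀ j + τ • cay c m j) =
      (1 + τ) * z (cay c (m₀ + (τ / (1 + τ)) • (m - m₀)) j) := fun z j => by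
    rw [cay_add_smul_sub, map_add, map_add, map_smul, map_smul, map_sub, smul_eq_mul, smul_eq_mul]
    field_simp
    ring
  have hmem : ∀ T j, j ∈ T.1 ↔ cay c m₀ j ∈ Submodule.span ℝ (cay c m₀ '' (B T : Set J)) :=
    fun T j => ⟨fun hj => hB3 T j (by rwa [hy2]), fun hj => by
      rw [← hy2, mem_zeroSet]
      exact apply_eq_zero_of_mem_span (hB1 T) hj⟩
  have hspan : ∀ T, Submodule.span ℝ (cay c m₀ '' (T.1 : Set J)) =
      Submodule.span ℝ (cay c m₀ '' (B T : Set J)) := fun T => by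
    refine le_antisymm (Submodule.span_le.2 ?_) (Submodule.span_mono (image_mono ?_))
    · rintro _ ⟨j, hj, rfl⟩
      exact (hmem T j).1 hj
    · have := hB1 T
      rw [hy2] at this
      exact Finset.coe_subset.2 this
  have hcard : ∀ T, (B T).card =
      Module.finrank ℝ (Submodule.span ℝ (cay c m₀ '' (T.1 : Set J))) := fun T => by
    rw [hspan, image_eq_range]
    simpa using (finrank_span_eq_card (hB2 T)).symm
  have hside : ∀ T s, (B T ∩ side c s).Nonempty := fun T s => by
    obtain ⟨j, hj⟩ := hs T s
    rw [Finset.mem_inter, hy2] at hj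
    by_contra hne
    rw [Finset.not_nonempty_iff_eq_empty] at hne
    have hz : B T ⊆ zeroSet (cay c m₀) (tag s) := fun i hi => by
      rw [mem_zeroSet, tag_cay, if_neg]
      intro hi'
      have : i ∈ B T ∩ side c s := Finset.mem_inter.2 ⟨hi, mem_side.2 hi'⟩
      simp [hne] at this
    have := apply_eq_zero_of_mem_span hz ((hmem T j).1 hj.1)
    rw [tag_cay, if_pos (mem_side.1 hj.2)] at this
    exact one_ne_zero this
  classical
  refine Set.ncard_le_ncard_of_injOn
    (fun T => if h : T ∈ mixed (cay c m₀) (side c true) (side c false) then B ⟨T, h⟩ else ∅)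
    (fun T hT => ?_) (fun T hT T' hT' h => ?_) (toFinite _)
  · rw [dif_pos hT.1]
    obtain ⟨z, z1, z2, z3⟩ := h1 ⟨T, hT.1⟩
    refine ⟨⟨z, fun j => ?_, z2, ?_, hside _ _, hside _ _⟩, ?_⟩
    · have := z1 j
      simp only [hcay] at this
      exact nonneg_of_mul_nonneg_right this hτ'
    · rw [← z3]
      ext j
      rw [mem_zeroSet, mem_zeroSet, hcay, mul_eq_zero, or_iff_right hτ'.ne']
    · exact (hcard ⟨T, hT.1⟩).trans hT.2
  · simp only [dif_pos hT.1, dif_pos hT'.1] at h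
    ext j
    rw [hmem ⟨T, hT.1⟩, hmem ⟨T', hT'.1⟩, h]

end Deformation

section Minkowski
variable {d : ℕ} {J : Type*} [Fintype J] [DecidableEq J]

theorem finrank_vectorSpan_add_two (c : J → Bool) (m : J → Euc d) {T : Finset J}
    (hT : ∀ s, (T ∩ side c s).Nonempty) :
    Module.finrank ℝ (vectorSpan ℝ (m '' (T ∩ side c true : Finset J) +
      m '' (T ∩ side c false : Finset J))) + 2 =
      Module.finrank ℝ (Submodule.span ℝ (cay c m '' (T : Set J))) := by
  set S := m '' (T ∩ side c true : Finset J) + m '' (T ∩ side c false : Finset J) with hS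
  set W := Submodule.span ℝ (cay c m '' (T : Set J)) with hW
  have hmemS : ∀ i ∈ T ∩ side c true, ∀ j ∈ T ∩ side c false, m i + m j ∈ S := fun i hi j hj =>
    add_mem_add (mem_image_of_mem _ (by exact_mod_cast hi))
      (mem_image_of_mem _ (by exact_mod_cast hj))
  have hmemW : ∀ s, ∀ j ∈ T ∩ side c s, (m j, Pi.single s 1) ∈ W := fun s j hj => by
    rw [Finset.mem_inter, mem_side] at hj
    rw [← hj.2]
    exact Submodule.subset_span (mem_image_of_mem (cay c m) hj.1)
  obtain ⟨i₀, hi₀⟩ := hT true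
  obtain ⟨j₀, hj₀⟩ := hT false
  let Φ : vectorSpan ℝ S × (Bool → ℝ) →ₗ[ℝ] Euc d × (Bool → ℝ) :=
    ((vectorSpan ℝ S).subtype.comp (LinearMap.fst ℝ _ _) +
      ((LinearMap.proj true).comp (LinearMap.snd ℝ _ _)).smulRight (m i₀) +
      ((LinearMap.proj false).comp (LinearMap.snd ℝ _ _)).smulRight (m j₀)).prod
        (LinearMap.snd ℝ _ _)
  have hΦ : ∀ u t, Φ (u, t) = ((u : Euc d) + t true • m i₀ + t false • m j₀, t) := fun _ _ => rfl
  have hinj : Function.Injective Φ := by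
    rintro ⟨u, t⟩ ⟨u', t'⟩ h
    rw [hΦ, hΦ, Prod.mk.injEq] at h
    obtain ⟨h1, rfl⟩ := h
    rw [add_left_inj, add_left_inj] at h1
    rw [Subtype.ext h1]
  have hrange : LinearMap.range Φ = W := by
    refine le_antisymm ?_ (Submodule.span_le.2 ?_)
    · have hU : vectorSpan ℝ S ≤ W.comap (LinearMap.inl ℝ (Euc d) (Bool → ℝ)) := by
        refine Submodule.span_le.2 ?_
        rintro _ ⟨_, ⟨_, ⟨i, hi, rfl⟩, _, ⟨j, hj, rfl⟩, rfl⟩, _,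
          ⟨_, ⟨i', hi', rfl⟩, _, ⟨j', hj', rfl⟩, rfl⟩, rfl⟩
        have h1 := W.sub_mem (W.add_mem (hmemW true i hi) (hmemW false j hj))
          (W.add_mem (hmemW true i' hi') (hmemW false j' hj'))
        simpa using h1
      rintro _ ⟨⟨u, t⟩, rfl⟩
      rw [hΦ]
      have h1 := W.add_mem (W.add_mem (hU u.2) (W.smul_mem (t true) (hmemW true i₀ hi₀)))
        (W.smul_mem (t false) (hmemW false j₀ hj₀))
      convert h1 using 1
      refine Prod.ext (by simp) (funext fun s => ?_)
      cases s <;> simp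
    · rintro _ ⟨j, hj, rfl⟩
      have hj' : j ∈ T ∩ side c (c j) := Finset.mem_inter.2 ⟨hj, mem_side.2 rfl⟩
      rcases hc : c j with _ | _
      · rw [hc] at hj'
        refine ⟨(⟨m j - m j₀, ?_⟩, Pi.single false 1), ?_⟩
        · have := vsub_mem_vectorSpan ℝ (hmemS i₀ hi₀ j hj') (hmemS i₀ hi₀ j₀ hj₀)
          simpa using this
        · rw [hΦ, cay, hc]
          simp
      · rw [hc] at hj'
        refine ⟨(⟨m j - m i₀, ?_⟩, Pi.single true 1), ?_⟩
        · have := vsub_mem_vectorSpan ℝ (hmemS j hj' j₀ hj₀) (hmemS i₀ hi₀ j₀ hj₀)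
          simpa using this
        · rw [hΦ, cay, hc]
          simp
  rw [← hrange, LinearMap.finrank_range_of_inj hinj]
  simp

/-- Proper faces of a Minkowski sum come from mixed faces of the Cayley configuration. -/
theorem exists_mixed_of_isProperFaceOf (c : J → Bool) (m : J → Euc d) {F : Set (Euc d)}
    (hF : IsProperFaceOf (convexHull ℝ (m '' (side c true : Set J)) +
      convexHull ℝ (m '' (side c false : Set J))) F) :
    ∃ T ∈ mixed (cay c m) (side c true) (side c false),
      F = convexHull ℝ
        (m '' (T ∩ side c true : Finset J) + m '' (T ∩ side c false : Finset J)) := by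
  let p : side c true × side c false → Euc d := fun q => m q.1 + m q.2
  have hp : range p = m '' (side c true : Set J) + m '' (side c false : Set J) := by
    ext x
    simp only [p, mem_range, Prod.exists, mem_add, mem_image, Subtype.exists, Finset.mem_coe]
    constructor
    · rintro ⟨i, hi, j, hj, rfl⟩
      exact ⟨_, ⟨i, hi, rfl⟩, _, ⟨j, hj, rfl⟩, rfl⟩
    · rintro ⟨_, ⟨i, hi, rfl⟩, _, ⟨j, hj, rfl⟩, rfl⟩
      exact ⟨i, hi, j, hj, rfl⟩
  rw [← convexHull_add, ← hp] at hF
  obtain ⟨h1, h2, h3⟩ := hF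
  obtain ⟨l, b, hle, ⟨⟨⟨i₀, hi₀⟩, ⟨j₀, hj₀⟩⟩, heq⟩, rfl⟩ := exists_of_isExposed h1 h3
  have heq' : l (m i₀) + l (m j₀) = b := by rw [← map_add]; exact heq
  have hle' : ∀ i ∈ side c true, ∀ j ∈ side c false, l (m i) + l (m j) ≤ b := fun i hi j hj => by
    rw [← map_add]
    exact hle (⟨i, hi⟩, ⟨j, hj⟩)
  let y : Euc d × (Bool → ℝ) →L[ℝ] ℝ :=
    l (m i₀) • tag true + l (m j₀) • tag false - l.comp (ContinuousLinearMap.fst ℝ _ _)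
  have hyt : ∀ j ∈ side c true, y (cay c m j) = l (m i₀) - l (m j) := fun j hj => by
    have : y (cay c m j) = l (m i₀) * tag true (cay c m j) + l (m j₀) * tag false (cay c m j)
      - l (m j) := rfl
    rw [this, tag_cay, tag_cay, mem_side.1 hj]
    simp
  have hyf : ∀ j ∈ side c false, y (cay c m j) = l (m j₀) - l (m j) := fun j hj => by
    have : y (cay c m j) = l (m i₀) * tag true (cay c m j) + l (m j₀) * tag false (cay c m j)
      - l (m j) := rfl
    rw [this, tag_cay, tag_cay, mem_side.1 hj]
    simp
  have hy0 : Nonneg (cay c m) y := fun j => by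
    rcases hc : c j with _ | _
    · rw [hyf j (mem_side.2 hc)]
      linarith [hle' i₀ hi₀ j (mem_side.2 hc)]
    · rw [hyt j (mem_side.2 hc)]
      linarith [hle' j (mem_side.2 hc) j₀ hj₀]
  have htight : p '' {q | l (p q) = b} = m '' (zeroSet (cay c m) y ∩ side c true : Finset J) +
      m '' (zeroSet (cay c m) y ∩ side c false : Finset J) := by
    ext x
    simp only [p, mem_image, mem_ofPred_eq, Prod.exists, mem_add, Subtype.exists, Finset.mem_coe,
      Finset.mem_inter, mem_zeroSet]
    constructor
    · rintro ⟨i, hi, j, hj, h, rfl⟩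
      rw [map_add] at h
      have h5 := hle' i hi j₀ hj₀
      have h6 := hle' i₀ hi₀ j hj
      exact ⟨_, ⟨i, ⟨by rw [hyt i hi]; linarith, hi⟩, rfl⟩, _,
        ⟨j, ⟨by rw [hyf j hj]; linarith, hj⟩, rfl⟩, rfl⟩
    · rintro ⟨_, ⟨i, ⟨h5, hi⟩, rfl⟩, _, ⟨j, ⟨h6, hj⟩, rfl⟩, rfl⟩
      rw [hyt i hi] at h5
      rw [hyf j hj] at h6
      exact ⟨i, hi, j, hj, by rw [map_add]; linarith, rfl⟩
  refine ⟨_, ⟨y, hy0, fun h0 => h2 ?_, rfl, ⟨i₀, ?_⟩, ⟨j₀, ?_⟩⟩, by rw [htight]⟩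
  · have hz : zeroSet (cay c m) y = Finset.univ := by
      ext j
      rw [mem_zeroSet, h0]
      simp
    rw [htight, hp, hz, Finset.univ_inter, Finset.univ_inter]
  · rw [Finset.mem_inter, mem_zeroSet, hyt _ hi₀, sub_self]
    exact ⟨rfl, hi₀⟩
  · rw [Finset.mem_inter, mem_zeroSet, hyf _ hj₀, sub_self]
    exact ⟨rfl, hj₀⟩

theorem faceCount_add_le (c : J → Bool) (m : J → Euc d) (k : ℕ) :
    faceCount (convexHull ℝ (m '' (side c true : Set J)) +
      convexHull ℝ (m '' (side c false : Set J))) k ≤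
    {T | T ∈ mixed (cay c m) (side c true) (side c false) ∧
      Module.finrank ℝ (Submodule.span ℝ (cay c m '' (T : Set J))) = k + 2}.ncard := by
  refine (Set.ncard_le_ncard (t := (fun T : Finset J => convexHull ℝ
    (m '' (T ∩ side c true : Finset J) + m '' (T ∩ side c false : Finset J))) ''
      {T | T ∈ mixed (cay c m) (side c true) (side c false) ∧
      Module.finrank ℝ (Submodule.span ℝ (cay c m '' (T : Set J))) = k + 2}) ?_
      ((toFinite _).image _)).trans (Set.ncard_image_le (toFinite _))
  rintro F ⟨hF, hk⟩
  obtain ⟨T, hT, rfl⟩ := exists_mixed_of_isProperFaceOf c m hF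
  refine ⟨T, ⟨hT, ?_⟩, rfl⟩
  obtain ⟨y, -, -, -, h1, h2⟩ := hT
  rw [← finrank_vectorSpan_add_two c m fun s => by cases s <;> assumption, ← setDim_convexHull, hk]

theorem finite_vertSet {P : Set (Euc d)} (hP : IsPolytope P) : (vertSet P).Finite := by
  obtain ⟨S, hS, rfl⟩ := hP
  exact hS.subset extremePoints_convexHull_subset

theorem convexHull_vertSet {P : Set (Euc d)} (hP : IsPolytope P) :
    convexHull ℝ (vertSet P) = P := by
  have hfin := finite_vertSet hP
  obtain ⟨S, hS, rfl⟩ := hP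
  rw [← (hfin.isClosed_convexHull ℝ).closure_eq]
  exact closure_convexHull_extremePoints (hS.isCompact_convexHull ℝ) (convex_convexHull ℝ S)

theorem faceCount_le_minkBound {e k : ℕ} {P₁ P₂ : Set (Euc (e + 1))} (hP₁ : IsPolytope P₁)
    (hP₂ : IsPolytope P₂) (hn₁ : e + 2 ≤ vertCount P₁) (hn₂ : e + 2 ≤ vertCount P₂) :
    (faceCount (P₁ + P₂) k : ℤ) ≤ minkBound (e + 1) (vertCount P₁) (vertCount P₂) (k + 1) := by
  classical
  have := (finite_vertSet hP₁).fintype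
  have := (finite_vertSet hP₂).fintype
  let c : vertSet P₁ ⊕ vertSet P₂ → Bool := Sum.elim (fun _ => true) fun _ => false
  let m₀ : vertSet P₁ ⊕ vertSet P₂ → Euc (e + 1) := Sum.elim Subtype.val Subtype.val
  have ht : side c true = Finset.univ.map Function.Embedding.inl := by
    ext j
    rcases j with j | j <;> simp [mem_side, c]
  have hf : side c false = Finset.univ.map Function.Embedding.inr := by
    ext j
    rcases j with j | j <;> simp [mem_side, c]
  have htc : (side c true).card = vertCount P₁ := by
    rw [ht, Finset.card_map, Finset.card_univ, vertCount, Set.ncard_eq_toFinset_card',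
      Set.toFinset_card]
  have hfc : (side c false).card = vertCount P₂ := by
    rw [hf, Finset.card_map, Finset.card_univ, vertCount, Set.ncard_eq_toFinset_card',
      Set.toFinset_card]
  have hti : m₀ '' (side c true : Set _) = vertSet P₁ := by
    rw [ht]
    ext x
    simp [m₀]
  have hfi : m₀ '' (side c false : Set _) = vertSet P₂ := by
    rw [hf]
    ext x
    simp [m₀]
  have h1 := faceCount_add_le c m₀ k
  rw [hti, hfi, convexHull_vertSet hP₁, convexHull_vertSet hP₂] at h1
  obtain ⟨m, hm, h2⟩ := exists_isGP_ncard_le c m₀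
  have h3 := hm.ncard_mixed_le (fun s => by cases s <;> omega) (k + 1)
  rw [htc, hfc] at h3
  exact (Nat.cast_le.2 (h1.trans (h2 _))).trans h3

end Minkowski

end MinkUB

/-- the Karavelas–Tzanaki upper bound on the number of `(k-1)`-faces of the
Minkowski sum of two `d`-polytopes with `n1` and `n2` vertices. -/
theorem statement_0 (d n1 n2 : ℕ) (hd : 2 ≤ d)
    (P1 P2 : Set (Euc d)) (hP1 : IsPolytope P1) (hP2 : IsPolytope P2)
    (hdim1 : setDim P1 = d) (hdim2 : setDim P2 = d)
    (hv1 : vertCount P1 = n1) (hv2 : vertCount P2 = n2)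
    (hn1 : d + 1 ≤ n1) (hn2 : d + 1 ≤ n2)
    (k : ℕ) (hk1 : 1 ≤ k) (hkd : k ≤ d) :
    (faceCount (P1 + P2) (k - 1) : ℤ) ≤ minkBound d n1 n2 k := by
  obtain ⟨e, rfl⟩ : ∃ e, d = e + 1 := ⟨d - 1, by omega⟩
  obtain ⟨k, rfl⟩ : ∃ l, k = l + 1 := ⟨k - 1, by omega⟩
  subst hv1 hv2
  exact MinkUB.faceCount_le_minkBound hP1 hP2 hn1 hn2
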